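/- Let J ⊆ S, let d = (d_σ)_{σ∈S∖J} be nonnegative integers, let χ1, χ2 : F^× → E^× be locally J-analytic characters, set r = −v_p(χ1(p)) (where v_p(p)=1) and assume r ≥ 0. Put J' = J ∪ {σ ∈ S∖J : d_σ + 1 > r}, χ1' = χ1, χ2' = χ2 · ∏_{σ∈J'∖J} σ^{d_σ}, and d' = (d_σ)_{σ∈S∖J'}. Then for every g = (a b; c d) ∈ GL_2(F) and every f ∈ B(χ',J',d'), the function z ↦ χ1'(ad−bc) · χ2'χ1'^{−1}(−cz+a) · (−cz+a)^{d'} · f((dz−b)/(−cz+a)), defined for z ≠ a/c, extends by continuity at z = a/c to an element g·f of B(χ',J',d'), and f ↦ g·f is a continuous linear automorphism of the Banach space B(χ',J',d'); these maps define a left action of GL_2(F) on B(χ',J',d'). -/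

import Mathlib

/- Preamble: formalization of the basic objects from "Fonctions de classe C^r sur O_F"
   (C^r functions on O_F, locally analytic functions, locally J-analytic characters,
   the spaces V(χ,J,d), B(χ,J,d), the lattice Λ, etc.).

   Conventions:
   * F, E are nonarchimedean complete normed fields (abstracting finite extensions of ℚ_p);
   * O_F is encoded by the predicate ‖·‖ ≤ 1, and functions on O_F are encoded as
     functions on F whose defining conditions only quantify over the unit ball;
   * `q` is the residue cardinality, `ϖ` a uniformizer with ‖ϖ‖ = q⁻¹,
     and D(a,n) = {z : ‖z - a‖ ≤ q^(-n)};
   * S is the (finite) set of embeddings F → E, `emb σ` the corresponding ring maps;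
   * multi-indices are functions `i : S → ℕ`; a pair (k over S∖J, m over J) is encoded
     as the single multi-index agreeing with k off J and with m on J. -/

open scoped Classical Topology
open Filter

noncomputable section

namespace Paper

variable {F E : Type*} [NormedField F] [NormedField E]
variable {S : Type*} [Fintype S]

/-- total degree |i| of a multi-index -/
def mSum (i : S → ℕ) : ℕ := ∑ σ, i σ

/-- i! -/
def mFact (i : S → ℕ) : ℕ := ∏ σ, (i σ).factorial

/-- z^i = ∏_σ σ(z)^(i_σ) -/
def mPow (emb : S → (F →+* E)) (z : F) (i : S → ℕ) : E := ∏ σ, (emb σ z) ^ (i σ)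

/-- the (finite) set of multi-indices of total degree ≤ N -/
def degLE (S : Type*) [Fintype S] (N : ℕ) : Finset (S → ℕ) :=
  ((Finset.univ : Finset (S → Fin (N + 1))).image (fun i σ => (i σ : ℕ))).filter
    (fun i => mSum i ≤ N)

/-- the remainder ε_{f,N}(x,y) = f(x+y) - Σ_{|i| ≤ N} D_i f(x) y^i / i! -/
def crRem (emb : S → (F →+* E)) (N : ℕ) (f : F → E) (Df : (S → ℕ) → F → E)
    (x y : F) : E :=
  f (x + y) - ∑ i ∈ degLE S N, Df i x * mPow emb y i / (mFact i : E)

/-- `f` is of class C^r on O_F with derivative data `Df`: the `Df i` (|i| ≤ ⌊r⌋) are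
bounded on O_F and C_{f,r}(h) = sup_{x ∈ O_F, y ∈ ϖ^h O_F} |ε_{f,[r]}(x,y)| q^{rh} → 0. -/
def IsCrWith (q : ℕ) (emb : S → (F →+* E)) (r : ℝ) (f : F → E)
    (Df : (S → ℕ) → F → E) : Prop :=
  (∀ i : S → ℕ, mSum i ≤ ⌊r⌋₊ → ∃ C : ℝ, ∀ x : F, ‖x‖ ≤ 1 → ‖Df i x‖ ≤ C) ∧
  ∀ ε : ℝ, 0 < ε → ∃ H : ℕ, ∀ h : ℕ, H ≤ h → ∀ x y : F, ‖x‖ ≤ 1 →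
    ‖y‖ ≤ (q : ℝ) ^ (-(h : ℤ)) →
      ‖crRem emb ⌊r⌋₊ f Df x y‖ * (q : ℝ) ^ (r * (h : ℝ)) ≤ ε

/-- `f` is of class C^r on O_F -/
def IsCr (q : ℕ) (emb : S → (F →+* E)) (r : ℝ) (f : F → E) : Prop :=
  ∃ Df, IsCrWith q emb r f Df

/-- the C^r norm computed from derivative data `Df` -/
def crNormWith (emb : S → (F →+* E)) (r : ℝ) (f : F → E)
    (Df : (S → ℕ) → F → E) : ℝ :=
  sSup ({x | ∃ i : S → ℕ, mSum i ≤ ⌊r⌋₊ ∧ ∃ z : F, ‖z‖ ≤ 1 ∧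
          x = ‖Df i z / (mFact i : E)‖} ∪
        {x | ∃ z y : F, ‖z‖ ≤ 1 ∧ ‖y‖ ≤ 1 ∧ y ≠ 0 ∧
          x = ‖crRem emb ⌊r⌋₊ f Df z y‖ / ‖y‖ ^ r})

/-- the C^r norm of `f` (the derivative data being unique, the set below is a singleton
when `f` is of class C^r). -/
def crNorm (q : ℕ) (emb : S → (F →+* E)) (r : ℝ) (f : F → E) : ℝ :=
  sSup {c | ∃ Df, IsCrWith q emb r f Df ∧ c = crNormWith emb r f Df}

/-- membership in the closed subspace C^r(O_F, J, d) of C^r(O_F, E):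
∂^{dσ+1} f / ∂z_σ^{dσ+1} = 0 for σ ∉ J. -/
def IsCrJ (q : ℕ) (emb : S → (F →+* E)) (r : ℝ) (J : Set S) (d : S → ℕ)
    (f : F → E) : Prop :=
  ∃ Df, IsCrWith q emb r f Df ∧
    ∀ σ : S, σ ∉ J → ∀ x : F, ‖x‖ ≤ 1 → Df (Pi.single σ (d σ + 1)) x = 0

/-- `c` is the family of Taylor coefficients of an expansion of `f` on D(a,h), with
exponents bounded by `d` off `J`, and coefficients with ‖c m‖ q^{-h|m|} → 0. -/
def IsExpansionAt (q : ℕ) (emb : S → (F →+* E)) (J : Set S) (d : S → ℕ) (h : ℕ)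
    (a : F) (c : (S → ℕ) → E) (f : F → E) : Prop :=
  (∀ m : S → ℕ, ¬ (∀ σ, σ ∉ J → m σ ≤ d σ) → c m = 0) ∧
  Tendsto (fun m : S → ℕ => ‖c m‖ * (q : ℝ) ^ (-(h : ℝ) * (mSum m : ℝ)))
    cofinite (nhds 0) ∧
  ∀ z : F, ‖z - a‖ ≤ (q : ℝ) ^ (-(h : ℤ)) →
    HasSum (fun m : S → ℕ => c m * mPow emb (z - a) m) (f z)

/-- membership in F_h(O_F, J, d) -/
def IsFh (q : ℕ) (emb : S → (F →+* E)) (J : Set S) (d : S → ℕ) (h : ℕ)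
    (f : F → E) : Prop :=
  ∀ a : F, ‖a‖ ≤ 1 → ∃ c : (S → ℕ) → E, IsExpansionAt q emb J d h a c f

/-- membership in F(O_F, J, d) = ∪_h F_h(O_F, J, d) -/
def IsF (q : ℕ) (emb : S → (F →+* E)) (J : Set S) (d : S → ℕ) (f : F → E) : Prop :=
  ∃ h : ℕ, IsFh q emb J d h f

/-- the norm of F_h(O_F, J, d) -/
def FhNorm (q : ℕ) (emb : S → (F →+* E)) (J : Set S) (d : S → ℕ) (h : ℕ)
    (f : F → E) : ℝ :=
  sSup {x | ∃ a : F, ‖a‖ ≤ 1 ∧ ∃ c : (S → ℕ) → E, IsExpansionAt q emb J d h a c f ∧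
        ∃ m : S → ℕ, x = ‖c m‖ * (q : ℝ) ^ (-(h : ℝ) * (mSum m : ℝ))}

/-- membership in F^N(O_F, J, d): member of F(O_F,J,d) which is a sum of members of the
spaces F(O_F, ∅, d'') over multi-indices d'' of total degree ≤ N. -/
def IsFN (q : ℕ) (emb : S → (F →+* E)) (J : Set S) (d : S → ℕ) (N : ℕ)
    (f : F → E) : Prop :=
  IsF q emb J d f ∧ ∃ g : (S → ℕ) → (F → E),
    (∀ m ∈ degLE S N, IsF q emb (∅ : Set S) m (g m)) ∧
    ∀ z : F, ‖z‖ ≤ 1 → f z = ∑ m ∈ degLE S N, g m z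

/-- |d| = Σ_{σ ∉ J} d_σ -/
def dSum (J : Set S) (d : S → ℕ) : ℕ :=
  ∑ σ ∈ Finset.univ.filter (fun σ => σ ∉ J), d σ

/-- z^d = ∏_{σ ∉ J} σ(z)^{d_σ} -/
def dPow (emb : S → (F →+* E)) (J : Set S) (d : S → ℕ) (z : F) : E :=
  ∏ σ ∈ Finset.univ.filter (fun σ => σ ∉ J), (emb σ z) ^ (d σ)

/-- z^{d-k} z^{-m} where (k, m) is encoded by the single multi-index `i`
(k = i off J, m = i on J). -/
def negPow (emb : S → (F →+* E)) (J : Set S) (d : S → ℕ) (i : S → ℕ) (z : F) : E :=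
  (∏ σ ∈ Finset.univ.filter (fun σ => σ ∉ J), (emb σ z) ^ (d σ - i σ)) /
    (∏ σ ∈ Finset.univ.filter (fun σ => σ ∈ J), (emb σ z) ^ (i σ))

/-- the function 1_{D(a,n)}(z) (z-a)^i -/
def test1 (q : ℕ) (emb : S → (F →+* E)) (a : F) (n : ℤ) (i : S → ℕ) : F → E :=
  fun z => if ‖z - a‖ ≤ (q : ℝ) ^ (-n) then mPow emb (z - a) i else 0

/-- the function χ2 χ1⁻¹ -/
def chRatio (χ1 χ2 : F →* E) (z : F) : E := χ2 z / χ1 z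

/-- the function 1_{F∖D(a,n+1)}(z) χ2χ1⁻¹(z-a) (z-a)^{d-k} (z-a)^{-m} -/
def test2 (q : ℕ) (emb : S → (F →+* E)) (J : Set S) (d : S → ℕ) (χ1 χ2 : F →* E)
    (a : F) (n : ℤ) (i : S → ℕ) : F → E :=
  fun z => if ‖z - a‖ ≤ (q : ℝ) ^ (-(n + 1)) then 0
    else chRatio χ1 χ2 (z - a) * negPow emb J d i (z - a)

/-- the ϖ-adic valuation v(a) (so that ‖a‖ = q^{-v(a)} for a ≠ 0) -/
def valF (q : ℕ) (a : F) : ℤ := ⌊-(Real.logb q ‖a‖)⌋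

/-- the function 1_{D(1/a, n - 2v(a))}(z) χ2χ1⁻¹(z) z^d (1/z - a)^k (1/z - a)^m -/
def test3 (q : ℕ) (emb : S → (F →+* E)) (J : Set S) (d : S → ℕ) (χ1 χ2 : F →* E)
    (a : F) (n : ℤ) (i : S → ℕ) : F → E :=
  fun z => if ‖z - a⁻¹‖ ≤ (q : ℝ) ^ (-(n - 2 * valF q a))
    then chRatio χ1 χ2 z * dPow emb J d z * mPow emb (z⁻¹ - a) i else 0

/-- locally J-analytic character: continuous on F^× and, on each disk D(a,l) around a
unit, given by a convergent power series in the variables (σ(z) - σ(a))_{σ ∈ J}. -/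
def IsLocJChar (q : ℕ) (emb : S → (F →+* E)) (J : Set S) (χ : F →* E) : Prop :=
  ContinuousOn (χ : F → E) {z : F | z ≠ 0} ∧
  ∃ l : ℕ, ∀ a : F, ‖a‖ = 1 → ∃ c : (S → ℕ) → E,
    (∀ m : S → ℕ, ¬ (∀ σ, σ ∉ J → m σ = 0) → c m = 0) ∧
    ∀ z : F, ‖z - a‖ ≤ (q : ℝ) ^ (-(l : ℤ)) →
      HasSum (fun m : S → ℕ => c m * mPow emb (z - a) m) (χ z)

/-- the valuation v_p on E normalized by v_p(p) = 1, given that ‖x‖ = p^{-ef·v_p(x)}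
(ef = [F:ℚ_p]). -/
def vP (p : ℕ) (ef : ℕ) (x : E) : ℝ := -(Real.logb p ‖x‖) / (ef : ℝ)

/-- the monomial character z ↦ ∏_{σ ∈ T} σ(z)^{d_σ} -/
def monChar (emb : S → (F →+* E)) (T : Set S) (d : S → ℕ) : F →* E where
  toFun z := ∏ σ ∈ Finset.univ.filter (fun σ => σ ∈ T), (emb σ z) ^ (d σ)
  map_one' := by simp
  map_mul' := by
    intro x y
    simp [map_mul, mul_pow, Finset.prod_mul_distrib]

/-- `g` is (on O_F ∖ {0}) the function z ↦ χ2χ1⁻¹(z) z^d f(1/z); i.e. `g` is an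
extension to O_F of the second-chart transform of `f`. -/
def ExtProp (emb : S → (F →+* E)) (J : Set S) (d : S → ℕ) (χ1 χ2 : F →* E)
    (f g : F → E) : Prop :=
  ∀ z : F, z ≠ 0 → ‖z‖ ≤ 1 → g z = chRatio χ1 χ2 z * dPow emb J d z * f z⁻¹

/-- membership in V(χ, J, d) (global sections of the locally analytic sheaf) -/
def MemV (q : ℕ) (emb : S → (F →+* E)) (J : Set S) (d : S → ℕ) (χ1 χ2 : F →* E)
    (f : F → E) : Prop :=
  IsF q emb J d f ∧ ∃ g : F → E, IsF q emb J d g ∧ ExtProp emb J d χ1 χ2 f g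

/-- membership in the Banach space B(χ, J, d) -/
def MemB (q : ℕ) (emb : S → (F →+* E)) (r : ℝ) (J : Set S) (d : S → ℕ)
    (χ1 χ2 : F →* E) (f : F → E) : Prop :=
  IsCrJ q emb r J d f ∧ ∃ g : F → E, IsCrJ q emb r J d g ∧ ExtProp emb J d χ1 χ2 f g

/-- the norm of B(χ, J, d): ‖f‖_B = max(‖f₁‖_{C^r}, ‖f₂‖_{C^r}) where
f₁(z) = f(ϖ z) and f₂ is the extension of z ↦ χ2χ1⁻¹(z) z^d f(1/z). -/
def BNorm (q : ℕ) (emb : S → (F →+* E)) (r : ℝ) (J : Set S) (d : S → ℕ)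
    (χ1 χ2 : F →* E) (ϖ : F) (f : F → E) : ℝ :=
  sSup {x | ∃ g : F → E, IsCrJ q emb r J d g ∧ ExtProp emb J d χ1 χ2 f g ∧
    x = max (crNorm q emb r (fun z => f (ϖ * z))) (crNorm q emb r g)}

/-- the ring of integers O_E as a subring of E -/
def unitBall (E : Type*) [NormedField E] [IsUltrametricDist E] : Subring E where
  carrier := {x : E | ‖x‖ ≤ 1}
  mul_mem' := by
    intro a b ha hb
    simp only [Set.mem_setOf_eq] at *
    calc ‖a * b‖ = ‖a‖ * ‖b‖ := norm_mul a b
    _ ≤ 1 * 1 := mul_le_mul ha hb (norm_nonneg b) zero_le_one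
    _ = 1 := one_mul 1
  one_mem' := by simp
  add_mem' := by
    intro a b ha hb
    simp only [Set.mem_setOf_eq] at *
    exact le_trans (IsUltrametricDist.norm_add_le_max a b) (max_le ha hb)
  zero_mem' := by simp
  neg_mem' := by
    intro a ha
    simpa using ha

instance (E : Type*) [NormedField E] [IsUltrametricDist E] :
    Algebra (unitBall E) E := (unitBall E).subtype.toAlgebra

/-- the action of the Borel element [[t, u], [0, v]] on functions -/
def borelAct (emb : S → (F →+* E)) (J : Set S) (d : S → ℕ) (χ1 χ2 : F →* E)
    (t u v : F) (f : F → E) : F → E :=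
  fun z => χ1 (t * v) * chRatio χ1 χ2 t * dPow emb J d t * f ((v * z - u) / t)

/-- the generator 1_{O_F}(z) z^k z^m -/
def genPoly (emb : S → (F →+* E)) (i : S → ℕ) : F → E :=
  fun z => if ‖z‖ ≤ 1 then mPow emb z i else 0

/-- the generator 1_{F∖O_F}(z) χ2χ1⁻¹(z) z^{d-k} z^{-m} -/
def genSing (emb : S → (F →+* E)) (J : Set S) (d : S → ℕ) (χ1 χ2 : F →* E)
    (i : S → ℕ) : F → E :=
  fun z => if ‖z‖ ≤ 1 then 0 else chRatio χ1 χ2 z * negPow emb J d i z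

/-- the generating set of Λ: Borel translates of the basic generators -/
def lambdaGens (emb : S → (F →+* E)) (J : Set S) (d : S → ℕ) (χ1 χ2 : F →* E) :
    Set (F → E) :=
  {h | ∃ t u v : F, ∃ i : S → ℕ, t ≠ 0 ∧ v ≠ 0 ∧ (∀ σ, σ ∉ J → i σ ≤ d σ) ∧
    (h = borelAct emb J d χ1 χ2 t u v (genPoly emb i) ∨
     h = borelAct emb J d χ1 χ2 t u v (genSing emb J d χ1 χ2 i))}

/-- the O_E[P]-lattice Λ -/
def Lambda [IsUltrametricDist E] (emb : S → (F →+* E)) (J : Set S) (d : S → ℕ)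
    (χ1 χ2 : F →* E) : Submodule ↥(unitBall E) (F → E) :=
  Submodule.span ↥(unitBall E) (lambdaGens emb J d χ1 χ2)

/-- the gauge (jauge) ‖f‖_Λ = inf{‖λ‖ : λ ∈ E^×, f ∈ λΛ} of a lattice Λ -/
def lamGauge [IsUltrametricDist E] (Λ : Submodule ↥(unitBall E) (F → E))
    (f : F → E) : ℝ :=
  sInf {c : ℝ | ∃ lam : E, lam ≠ 0 ∧ c = ‖lam‖ ∧ ∃ g, g ∈ Λ ∧ f = lam • g}

/-- the formula for the action of g = (a b; c d) ∈ GL₂(F):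
(g·f)(z) = χ1(det g) χ2χ1⁻¹(-cz+a) (-cz+a)^d f((dz-b)/(-cz+a)) -/
def actFormula (emb : S → (F →+* E)) (J : Set S) (d : S → ℕ) (χ1 χ2 : F →* E)
    (g : Matrix (Fin 2) (Fin 2) F) (f : F → E) : F → E :=
  fun z => χ1 (g 0 0 * g 1 1 - g 0 1 * g 1 0) *
    chRatio χ1 χ2 (-(g 1 0) * z + g 0 0) * dPow emb J d (-(g 1 0) * z + g 0 0) *
    f ((g 1 1 * z - g 0 1) / (-(g 1 0) * z + g 0 0))

/-- the action of g ∈ GL₂(F) on functions, extended by continuity (i.e. by taking the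
limit) at the singular point z = a/c when c ≠ 0. -/
def gAct (emb : S → (F →+* E)) (J : Set S) (d : S → ℕ) (χ1 χ2 : F →* E)
    (g : Matrix (Fin 2) (Fin 2) F) (f : F → E) : F → E :=
  fun z => if g 1 0 ≠ 0 ∧ z = g 0 0 / g 1 0 then
      limUnder (𝓝[≠] z) (actFormula emb J d χ1 χ2 g f)
    else actFormula emb J d χ1 χ2 g f z

/-- μ belongs to I(χ,J,d)^∨: both components of μ restrict to continuous linear forms
on each Banach space F_h(O_F,J,d). -/
def MemIdual (q : ℕ) (emb : S → (F →+* E)) (J : Set S) (d : S → ℕ) (χ1 χ2 : F →* E)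
    (ϖ : F) (μ : (F → E) →ₗ[E] E) : Prop :=
  ∀ h : ℕ, ∃ K : ℝ, ∀ f g : F → E,
    IsFh q emb J d h (fun z => f (ϖ * z)) → IsFh q emb J d h g →
    ExtProp emb J d χ1 χ2 f g →
    ‖μ f‖ ≤ K * max (FhNorm q emb J d h (fun z => f (ϖ * z))) (FhNorm q emb J d h g)

/-- ν is a continuous (= bounded) linear form on the Banach space B(χ,J,d) -/
def BBounded (q : ℕ) (emb : S → (F →+* E)) (r : ℝ) (J : Set S) (d : S → ℕ)
    (χ1 χ2 : F →* E) (ϖ : F) (ν : (F → E) →ₗ[E] E) : Prop :=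
  ∃ K : ℝ, ∀ f : F → E, MemB q emb r J d χ1 χ2 f →
    ‖ν f‖ ≤ K * BNorm q emb r J d χ1 χ2 ϖ f

/-- the function z ↦ z^k z^m (a generator of L(χ,J,d)) -/
def lFun1 (emb : S → (F →+* E)) (i : S → ℕ) : F → E := fun z => mPow emb z i

/-- the function z ↦ χ2χ1⁻¹(z-a) (z-a)^{d-k} (z-a)^{-m} (value 0 at z = a),
a generator of L(χ,J,d) -/
def lFun2 (emb : S → (F →+* E)) (J : Set S) (d : S → ℕ) (χ1 χ2 : F →* E)
    (a : F) (i : S → ℕ) : F → E :=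
  fun z => if z = a then 0 else chRatio χ1 χ2 (z - a) * negPow emb J d i (z - a)

/-- the generating set of L(χ,J,d) -/
def lGens (emb : S → (F →+* E)) (J : Set S) (d : S → ℕ) (χ1 χ2 : F →* E)
    (r : ℝ) : Set (F → E) :=
  {h | ∃ i : S → ℕ, (∀ σ, σ ∉ J → i σ ≤ d σ) ∧ (mSum i : ℝ) < r ∧
    (h = lFun1 emb i ∨ ∃ a : F, h = lFun2 emb J d χ1 χ2 a i)}

/-- the distance in B(χ,J,d) from f to the subspace L(χ,J,d), i.e. the quotient
seminorm of B(χ,J,d)/L(χ,J,d) evaluated at the image of f. -/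
def distL (q : ℕ) (emb : S → (F →+* E)) (r : ℝ) (J : Set S) (d : S → ℕ)
    (χ1 χ2 : F →* E) (ϖ : F) (f : F → E) : ℝ :=
  sInf {x | ∃ l ∈ Submodule.span E (lGens emb J d χ1 χ2 r),
    x = BNorm q emb r J d χ1 χ2 ϖ (f - l)}

/-- the GL₂(F)-stable lattice generated by Λ under the group action -/
def LambdaG [IsUltrametricDist E] (emb : S → (F →+* E)) (J : Set S) (d : S → ℕ)
    (χ1 χ2 : F →* E) : Submodule ↥(unitBall E) (F → E) :=
  Submodule.span ↥(unitBall E)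
    {h | ∃ g : Matrix (Fin 2) (Fin 2) F, g 0 0 * g 1 1 - g 0 1 * g 1 0 ≠ 0 ∧
      ∃ x, x ∈ Lambda emb J d χ1 χ2 ∧ h = gAct emb J d χ1 χ2 g x}

/-- C^{r,id} remainder for h : O_F → F -/
def crRemId (N : ℕ) (h : F → F) (Dh : ℕ → F → F) (x y : F) : F :=
  h (x + y) - ∑ i ∈ Finset.range (N + 1), Dh i x * y ^ i / (Nat.factorial i : F)

/-- h : O_F → F is of class C^{r,id} -/
def IsCrId (q : ℕ) (r : ℝ) (h : F → F) : Prop :=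
  ∃ Dh : ℕ → F → F,
    (∀ i : ℕ, i ≤ ⌊r⌋₊ → ∃ C : ℝ, ∀ x : F, ‖x‖ ≤ 1 → ‖Dh i x‖ ≤ C) ∧
    ∀ ε : ℝ, 0 < ε → ∃ K : ℕ, ∀ k : ℕ, K ≤ k → ∀ x y : F, ‖x‖ ≤ 1 →
      ‖y‖ ≤ (q : ℝ) ^ (-(k : ℤ)) → ‖crRemId ⌊r⌋₊ h Dh x y‖ * (q : ℝ) ^ (r * (k : ℝ)) ≤ ε

/-- the set of values defining the dual norm ‖μ‖_{r,d} -/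
def dualSet (q : ℕ) (emb : S → (F →+* E)) (r : ℝ) (J : Set S) (d : S → ℕ)
    (μ : (F → E) →ₗ[E] E) : Set ℝ :=
  {x | ∃ (a : F) (n : ℕ) (i : S → ℕ), ‖a‖ ≤ 1 ∧ (∀ σ, σ ∉ J → i σ ≤ d σ) ∧
    x = ‖μ (test1 q emb a (n : ℤ) i)‖ * (q : ℝ) ^ (-(n : ℝ) * (r - (mSum i : ℝ)))}

/-- the dual norm ‖μ‖_{r,d} -/
def dualNorm (q : ℕ) (emb : S → (F →+* E)) (r : ℝ) (J : Set S) (d : S → ℕ)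
    (μ : (F → E) →ₗ[E] E) : ℝ :=
  sSup (dualSet q emb r J d μ)

/-- the operator norm of μ on C^r(O_F, J, d) -/
def opNorm (q : ℕ) (emb : S → (F →+* E)) (r : ℝ) (J : Set S) (d : S → ℕ)
    (μ : (F → E) →ₗ[E] E) : ℝ :=
  sSup {x | ∃ f : F → E, IsCrJ q emb r J d f ∧ crNorm q emb r f ≠ 0 ∧
    x = ‖μ f‖ / crNorm q emb r f}

/-! ### Multi-indices and monomials -/

theorem mem_degLE {N : ℕ} {i : S → ℕ} : i ∈ degLE S N ↔ mSum i ≤ N := by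
  unfold degLE
  rw [Finset.mem_filter]
  refine ⟨fun h => h.2, fun h => ⟨?_, h⟩⟩
  rw [Finset.mem_image]
  have hle : ∀ σ, i σ < N + 1 := fun σ =>
    Nat.lt_succ_of_le
      ((Finset.single_le_sum (f := i) (fun τ _ => Nat.zero_le _) (Finset.mem_univ σ)).trans h)
  exact ⟨fun σ => ⟨i σ, hle σ⟩, Finset.mem_univ _, rfl⟩

theorem mSum_add (i j : S → ℕ) : mSum (i + j) = mSum i + mSum j := by
  simp [mSum, Finset.sum_add_distrib]

theorem mSum_zero : mSum (0 : S → ℕ) = 0 := by simp [mSum]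

theorem mPow_mul (emb : S → (F →+* E)) (z w : F) (i : S → ℕ) :
    mPow emb (z * w) i = mPow emb z i * mPow emb w i := by
  simp [mPow, mul_pow, Finset.prod_mul_distrib]

theorem mPow_one (emb : S → (F →+* E)) (i : S → ℕ) : mPow emb 1 i = 1 := by
  simp [mPow]

theorem mPow_add (emb : S → (F →+* E)) (z : F) (i j : S → ℕ) :
    mPow emb z (i + j) = mPow emb z i * mPow emb z j := by
  simp [mPow, pow_add, Finset.prod_mul_distrib]

theorem mPow_index_zero (emb : S → (F →+* E)) (z : F) : mPow emb z 0 = 1 := by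
  simp [mPow]

theorem mPow_inv (emb : S → (F →+* E)) (z : F) (i : S → ℕ) :
    mPow emb z⁻¹ i = (mPow emb z i)⁻¹ := by
  simp [mPow]

theorem mPow_single (emb : S → (F →+* E)) (z : F) (σ : S) (n : ℕ) :
    mPow emb z (Pi.single σ n) = emb σ z ^ n := by
  unfold mPow
  rw [Finset.prod_eq_single σ] <;> simp +contextual

theorem mPow_zero (emb : S → (F →+* E)) {i : S → ℕ} (hi : i ≠ 0) : mPow emb 0 i = 0 := by
  obtain ⟨σ, hσ⟩ := Function.ne_iff.mp hi
  exact Finset.prod_eq_zero (Finset.mem_univ σ) (by simpa using hσ)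

theorem norm_mPow {emb : S → (F →+* E)} (hemb : ∀ (σ : S) (z : F), ‖emb σ z‖ = ‖z‖)
    (z : F) (i : S → ℕ) : ‖mPow emb z i‖ = ‖z‖ ^ mSum i := by
  simp [mPow, mSum, hemb, Finset.prod_pow_eq_pow_sum]

theorem norm_mPow_le_one {emb : S → (F →+* E)} (hemb : ∀ (σ : S) (z : F), ‖emb σ z‖ = ‖z‖)
    {z : F} (hz : ‖z‖ ≤ 1) (i : S → ℕ) : ‖mPow emb z i‖ ≤ 1 := by
  rw [norm_mPow hemb]
  exact pow_le_one₀ (norm_nonneg _) hz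

/-- The monomial `z ↦ z^i` as a monoid homomorphism. -/
def mPowHom (emb : S → (F →+* E)) (i : S → ℕ) : F →* E where
  toFun z := mPow emb z i
  map_one' := mPow_one emb i
  map_mul' z w := mPow_mul emb z w i

theorem mPowHom_apply (emb : S → (F →+* E)) (i : S → ℕ) (z : F) :
    mPowHom emb i z = mPow emb z i := rfl

theorem mPowHom_add (emb : S → (F →+* E)) (i j : S → ℕ) :
    mPowHom emb (i + j) = mPowHom emb i * mPowHom emb j := by
  ext z
  simp [mPowHom_apply, mPow_add]

theorem mPow_add_arg (emb : S → (F →+* E)) (y z : F) (i : S → ℕ) :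
    mPow emb (y + z) i = ∑ k ∈ Fintype.piFinset fun σ => Finset.range (i σ + 1),
      mPow emb y k * mPow emb z (i - k) * ((∏ σ, (i σ).choose (k σ) : ℕ) : E) := by
  unfold mPow
  simp_rw [map_add, add_pow]
  rw [Finset.prod_univ_sum]
  refine Finset.sum_congr rfl fun k _ => ?_
  rw [Nat.cast_prod, ← Finset.prod_mul_distrib, ← Finset.prod_mul_distrib]
  rfl

theorem mSum_eq_of_mPowHom_eq {emb : S → (F →+* E)}
    (hemb : ∀ (σ : S) (z : F), ‖emb σ z‖ = ‖z‖) {t : F} (ht0 : t ≠ 0) (ht : ‖t‖ < 1)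
    {i j : S → ℕ} (h : mPowHom emb i = mPowHom emb j) : mSum i = mSum j := by
  have h1 : ‖t‖ ^ mSum i = ‖t‖ ^ mSum j := by
    rw [← norm_mPow hemb, ← norm_mPow hemb, ← mPowHom_apply, h, mPowHom_apply]
  exact (pow_right_inj₀ (norm_pos_iff.mpr ht0) ht.ne).mp h1

/-! ### Taylor data -/

theorem norm_sum_le_of_ultra [IsUltrametricDist E] {ι : Type*} {s : Finset ι} {f : ι → E} {C : ℝ}
    (hC : 0 ≤ C) (h : ∀ i ∈ s, ‖f i‖ ≤ C) : ‖∑ i ∈ s, f i‖ ≤ C :=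
  IsUltrametricDist.norm_sum_le_of_forall_le_of_nonneg hC h

/-- The remainder of `f(x+y)` with respect to the polynomial `∑ c_i(x) y^i`. -/
def tayRem (emb : S → (F →+* E)) (N : ℕ) (f : F → E) (c : (S → ℕ) → F → E) (x y : F) : E :=
  f (x + y) - ∑ i ∈ degLE S N, c i x * mPow emb y i

/-- `|e(x,y)| ≤ M |y|^r` and `e(x,y) = o(|y|^r)` uniformly on the unit ball. -/
def SmallRem (r M : ℝ) (e : F → F → E) : Prop :=
  (∀ x y : F, ‖x‖ ≤ 1 → ‖y‖ ≤ 1 → ‖e x y‖ ≤ M * ‖y‖ ^ r) ∧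
  ∀ ε : ℝ, 0 < ε → ∃ δ : ℝ, 0 < δ ∧ ∀ x y : F, ‖x‖ ≤ 1 → ‖y‖ ≤ 1 → ‖y‖ ≤ δ →
    ‖e x y‖ ≤ ε * ‖y‖ ^ r

/-- `c` is a family of Taylor coefficients of order `r` of `f` on the unit ball, with all
coefficients and the normalized remainder bounded by `M`. -/
def HasTaylor (emb : S → (F →+* E)) (r : ℝ) (f : F → E) (c : (S → ℕ) → F → E) (M : ℝ) : Prop :=
  (∀ i : S → ℕ, mSum i ≤ ⌊r⌋₊ → ∀ x : F, ‖x‖ ≤ 1 → ‖c i x‖ ≤ M) ∧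
  SmallRem r M (tayRem emb ⌊r⌋₊ f c)

/-- The coefficients `c i` vanish on the unit ball unless `i σ ≤ d σ` for all `σ ∉ K`. -/
def SuppIn (K : Set S) (d : S → ℕ) (c : (S → ℕ) → F → E) : Prop :=
  ∀ i : S → ℕ, (∃ σ, σ ∉ K ∧ d σ < i σ) → ∀ x : F, ‖x‖ ≤ 1 → c i x = 0

/-- `f` has Taylor coefficients with bound `M` supported on the indices bounded by `d`
off `K`. -/
def TaylorIn (emb : S → (F →+* E)) (r : ℝ) (K : Set S) (d : S → ℕ) (f : F → E) (M : ℝ) : Prop :=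
  ∃ c, SuppIn K d c ∧ HasTaylor emb r f c M

theorem SmallRem.congr {r M : ℝ} {e e' : F → F → E} (h : SmallRem r M e)
    (hee : ∀ x y, ‖x‖ ≤ 1 → ‖y‖ ≤ 1 → e' x y = e x y) : SmallRem r M e' := by
  refine ⟨fun x y hx hy => by rw [hee x y hx hy]; exact h.1 x y hx hy, fun ε hε => ?_⟩
  obtain ⟨δ, hδ, H⟩ := h.2 ε hε
  exact ⟨δ, hδ, fun x y hx hy hyd => by rw [hee x y hx hy]; exact H x y hx hy hyd⟩

theorem SmallRem.mono {r M M' : ℝ} {e : F → F → E} (h : SmallRem r M e) (hM : M ≤ M') :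
    SmallRem r M' e :=
  ⟨fun x y hx hy => (h.1 x y hx hy).trans
    (mul_le_mul_of_nonneg_right hM (Real.rpow_nonneg (norm_nonneg _) _)), h.2⟩

theorem SmallRem.add [IsUltrametricDist E] {r M : ℝ} {e e' : F → F → E} (h : SmallRem r M e)
    (h' : SmallRem r M e') : SmallRem r M (fun x y => e x y + e' x y) := by
  refine ⟨fun x y hx hy => (IsUltrametricDist.norm_add_le_max _ _).trans
    (max_le (h.1 x y hx hy) (h'.1 x y hx hy)), fun ε hε => ?_⟩
  obtain ⟨δ, hδ, H⟩ := h.2 ε hε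
  obtain ⟨δ', hδ', H'⟩ := h'.2 ε hε
  exact ⟨min δ δ', lt_min hδ hδ', fun x y hx hy hyd =>
    (IsUltrametricDist.norm_add_le_max _ _).trans (max_le
      (H x y hx hy (hyd.trans (min_le_left _ _)))
      (H' x y hx hy (hyd.trans (min_le_right _ _))))⟩

theorem SmallRem.of_pow {r M : ℝ} {e : F → F → E} {n : ℕ} (hn : r < n) (hM : 0 ≤ M)
    (h : ∀ x y : F, ‖x‖ ≤ 1 → ‖y‖ ≤ 1 → ‖e x y‖ ≤ M * ‖y‖ ^ n) (hn0 : n ≠ 0) :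
    SmallRem r M e := by
  have key : ∀ y : F, ‖y‖ ≠ 0 → ‖y‖ ^ n = ‖y‖ ^ ((n : ℝ) - r) * ‖y‖ ^ r := by
    intro y hy
    rw [← Real.rpow_add (lt_of_le_of_ne (norm_nonneg y) hy.symm)]
    simp
  have hr : ∀ y : F, 0 ≤ ‖y‖ ^ r := fun y => Real.rpow_nonneg (norm_nonneg _) _
  refine ⟨fun x y hx hy => (h x y hx hy).trans (mul_le_mul_of_nonneg_left ?_ hM), fun ε hε => ?_⟩
  · rcases eq_or_ne ‖y‖ 0 with h0 | h0
    · rw [h0, zero_pow hn0]; exact Real.rpow_nonneg le_rfl _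
    · rw [key y h0]
      exact mul_le_of_le_one_left (hr y)
        (Real.rpow_le_one (norm_nonneg _) hy (sub_nonneg.mpr hn.le))
  · have hs : 0 < (n : ℝ) - r := sub_pos.mpr hn
    have hb : 0 < ε / (M + 1) := by positivity
    refine ⟨(ε / (M + 1)) ^ ((n : ℝ) - r)⁻¹, Real.rpow_pos_of_pos hb _, fun x y hx hy hyd => ?_⟩
    refine (h x y hx hy).trans ?_
    rcases eq_or_ne ‖y‖ 0 with h0 | h0
    · rw [h0, zero_pow hn0, mul_zero]
      exact mul_nonneg hε.le (Real.rpow_nonneg le_rfl _)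
    · rw [key y h0, ← mul_assoc]
      refine mul_le_mul_of_nonneg_right ?_ (hr y)
      have h1 : ‖y‖ ^ ((n : ℝ) - r) ≤ ε / (M + 1) := by
        have := Real.rpow_le_rpow (norm_nonneg y) hyd hs.le
        rwa [← Real.rpow_mul hb.le, inv_mul_cancel₀ hs.ne', Real.rpow_one] at this
      calc M * ‖y‖ ^ ((n : ℝ) - r) ≤ (M + 1) * (ε / (M + 1)) :=
            mul_le_mul (by linarith) h1 (Real.rpow_nonneg (norm_nonneg _) _) (by linarith)
        _ = ε := by field_simp

theorem SmallRem.apply_zero {r M : ℝ} {e : F → F → E} (h : SmallRem r M e) {x : F}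
    (hx : ‖x‖ ≤ 1) : e x 0 = 0 := by
  rw [← norm_le_zero_iff]
  refine le_of_forall_pos_le_add fun ε hε => ?_
  obtain ⟨δ, hδ, H⟩ := h.2 ε hε
  have h1 := H x 0 hx (by simp) (by simpa using hδ.le)
  rw [norm_zero] at h1
  have h2 : (0 : ℝ) ^ r ≤ 1 := Real.zero_rpow_le_one r
  nlinarith

theorem tayRem_zero (emb : S → (F →+* E)) (N : ℕ) (f : F → E) (c : (S → ℕ) → F → E) (x : F) :
    tayRem emb N f c x 0 = f x - c 0 x := by
  unfold tayRem
  rw [Finset.sum_eq_single 0]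
  · simp [mPow_index_zero]
  · intro i _ hi
    simp [mPow_zero emb hi]
  · intro h
    exact absurd (mem_degLE.mpr (by simp [mSum_zero])) h

theorem HasTaylor.apply_eq {emb : S → (F →+* E)} {r M : ℝ} {f : F → E} {c : (S → ℕ) → F → E}
    (h : HasTaylor emb r f c M) {x : F} (hx : ‖x‖ ≤ 1) : f x = c 0 x := by
  have h1 := h.2.apply_zero hx
  rwa [tayRem_zero, sub_eq_zero] at h1

theorem HasTaylor.norm_le {emb : S → (F →+* E)} {r M : ℝ} {f : F → E} {c : (S → ℕ) → F → E}
    (h : HasTaylor emb r f c M) {x : F} (hx : ‖x‖ ≤ 1) : ‖f x‖ ≤ M := by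
  rw [h.apply_eq hx]
  exact h.1 0 (by simp [mSum_zero]) x hx

theorem HasTaylor.nonneg {emb : S → (F →+* E)} {r M : ℝ} {f : F → E} {c : (S → ℕ) → F → E}
    (h : HasTaylor emb r f c M) : 0 ≤ M :=
  (norm_nonneg _).trans (h.norm_le (x := 0) (by simp))

theorem ball_add [IsUltrametricDist F] {x y : F} {ρ : ℝ} (hx : ‖x‖ ≤ ρ) (hy : ‖y‖ ≤ ρ) :
    ‖x + y‖ ≤ ρ :=
  (IsUltrametricDist.norm_add_le_max x y).trans (max_le hx hy)

theorem HasTaylor.congr [IsUltrametricDist F] {emb : S → (F →+* E)} {r M : ℝ} {f f' : F → E}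
    {c : (S → ℕ) → F → E} (h : HasTaylor emb r f c M) (hf : ∀ x, ‖x‖ ≤ 1 → f' x = f x) :
    HasTaylor emb r f' c M :=
  ⟨h.1, h.2.congr fun x y hx hy => by unfold tayRem; rw [hf _ (ball_add hx hy)]⟩

theorem TaylorIn.congr [IsUltrametricDist F] {emb : S → (F →+* E)} {r M : ℝ} {K : Set S}
    {d : S → ℕ} {f f' : F → E} (h : TaylorIn emb r K d f M) (hf : ∀ x, ‖x‖ ≤ 1 → f' x = f x) :
    TaylorIn emb r K d f' M :=
  let ⟨c, hc, hT⟩ := h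
  ⟨c, hc, hT.congr hf⟩

theorem TaylorIn.mono {emb : S → (F →+* E)} {r M M' : ℝ} {K : Set S}
    {d : S → ℕ} {f : F → E} (h : TaylorIn emb r K d f M) (hM : M ≤ M') :
    TaylorIn emb r K d f M' :=
  let ⟨c, hc, hT⟩ := h
  ⟨c, hc, fun i hi x hx => (hT.1 i hi x hx).trans hM, hT.2.mono hM⟩

theorem TaylorIn.nonneg {emb : S → (F →+* E)} {r M : ℝ} {K : Set S} {d : S → ℕ} {f : F → E}
    (h : TaylorIn emb r K d f M) : 0 ≤ M :=
  let ⟨_, _, hT⟩ := h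
  hT.nonneg

theorem TaylorIn.const_mul {emb : S → (F →+* E)} {r M : ℝ} {K : Set S} {d : S → ℕ} {f : F → E}
    (h : TaylorIn emb r K d f M) (a : E) : TaylorIn emb r K d (fun z => a * f z) (‖a‖ * M) := by
  obtain ⟨c, hc, h1, h2⟩ := h
  have hrem : ∀ x y, tayRem emb ⌊r⌋₊ (fun z => a * f z) (fun i x => a * c i x) x y =
      a * tayRem emb ⌊r⌋₊ f c x y := by
    intro x y
    simp only [tayRem, mul_sub, Finset.mul_sum, mul_assoc]
  refine ⟨fun i x => a * c i x, fun i hi x hx => by simp [hc i hi x hx], fun i hi x hx => ?_,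
    fun x y hx hy => ?_, fun ε hε => ?_⟩
  · rw [norm_mul]
    exact mul_le_mul_of_nonneg_left (h1 i hi x hx) (norm_nonneg _)
  · rw [hrem, norm_mul, mul_assoc]
    exact mul_le_mul_of_nonneg_left (h2.1 x y hx hy) (norm_nonneg _)
  · obtain ⟨δ, hδ, H⟩ := h2.2 (ε / (‖a‖ + 1)) (by positivity)
    refine ⟨δ, hδ, fun x y hx hy hyd => ?_⟩
    rw [hrem, norm_mul]
    have h3 := H x y hx hy hyd
    calc ‖a‖ * ‖tayRem emb ⌊r⌋₊ f c x y‖ ≤ (‖a‖ + 1) * (ε / (‖a‖ + 1) * ‖y‖ ^ r) :=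
          mul_le_mul (by linarith) h3 (norm_nonneg _) (by positivity)
      _ = ε * ‖y‖ ^ r := by field_simp

theorem rpow_norm_le_one {r : ℝ} (hr : 0 ≤ r) {y : F} (hy : ‖y‖ ≤ 1) : ‖y‖ ^ r ≤ 1 :=
  Real.rpow_le_one (norm_nonneg _) hy hr

/-- A function with Taylor coefficients is continuous at the origin. -/
theorem HasTaylor.continuousAt_zero [IsUltrametricDist E] {emb : S → (F →+* E)}
    (hemb : ∀ (σ : S) (z : F), ‖emb σ z‖ = ‖z‖) {r M : ℝ} (hr : 0 ≤ r) {f : F → E}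
    {c : (S → ℕ) → F → E} (h : HasTaylor emb r f c M) : ContinuousAt f 0 := by
  have hM := h.nonneg
  rw [Metric.continuousAt_iff]
  intro ε hε
  obtain ⟨δ, hδ, H⟩ := h.2.2 (ε / 2) (by positivity)
  refine ⟨min 1 (min δ (ε / (2 * (M + 1)))), by positivity, fun {y} hy => ?_⟩
  rw [dist_zero_right] at hy
  have hy1 : ‖y‖ ≤ 1 := (hy.le.trans (min_le_left _ _))
  have hy2 : ‖y‖ ≤ δ := (hy.le.trans ((min_le_right _ _).trans (min_le_left _ _)))
  have hy3 : ‖y‖ ≤ ε / (2 * (M + 1)) :=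
    (hy.le.trans ((min_le_right _ _).trans (min_le_right _ _)))
  rw [dist_eq_norm]
  have hsplit : f y - f 0 = tayRem emb ⌊r⌋₊ f c 0 y +
      ∑ i ∈ (degLE S ⌊r⌋₊).erase 0, c i 0 * mPow emb y i := by
    rw [h.apply_eq (x := 0) (by simp)]
    unfold tayRem
    rw [← Finset.add_sum_erase _ _ (mem_degLE.mpr (by simp [mSum_zero] : mSum (0 : S → ℕ) ≤ ⌊r⌋₊))]
    simp [mPow_index_zero, sub_add_eq_sub_sub]
  rw [hsplit]
  refine lt_of_le_of_lt (ball_add (ρ := ε / 2) ?_ ?_) (by linarith)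
  · refine (H 0 y (by simp) hy1 hy2).trans ?_
    have := rpow_norm_le_one hr hy1
    nlinarith
  · refine norm_sum_le_of_ultra (by positivity) fun i hi => ?_
    rw [Finset.mem_erase, mem_degLE] at hi
    rw [norm_mul, norm_mPow hemb]
    have hi0 : mSum i ≠ 0 := fun h0 => hi.1 (by
      ext σ
      exact (Finset.sum_eq_zero_iff.mp h0) σ (Finset.mem_univ σ))
    have h1 : ‖y‖ ^ mSum i ≤ ‖y‖ := pow_le_of_le_one (norm_nonneg _) hy1 hi0
    calc ‖c i 0‖ * ‖y‖ ^ mSum i ≤ (M + 1) * (ε / (2 * (M + 1))) :=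
          mul_le_mul ((h.1 i hi.2 0 (by simp)).trans (by linarith)) (h1.trans hy3)
            (by positivity) (by linarith)
      _ = ε / 2 := by field_simp

/-! ### Changing the presentation of Taylor data -/

theorem HasTaylor.push [IsUltrametricDist E] {emb : S → (F →+* E)} {r M : ℝ} {f : F → E}
    {c : (S → ℕ) → F → E} (h : HasTaylor emb r f c M) (μ : (S → ℕ) → (S → ℕ))
    (hdeg : ∀ i, mSum (μ i) = mSum i) (hμ : ∀ i, mPowHom emb (μ i) = mPowHom emb i) :
    HasTaylor emb r f (fun k x => ∑ i ∈ (degLE S ⌊r⌋₊).filter (fun i => μ i = k), c i x) M := by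
  refine ⟨fun k _ x hx => norm_sum_le_of_ultra h.nonneg fun i hi => ?_, h.2.congr fun x y _ _ => ?_⟩
  · rw [Finset.mem_filter, mem_degLE] at hi
    exact h.1 i hi.1 x hx
  · unfold tayRem
    congr 1
    rw [← Finset.sum_fiberwise_of_maps_to (s := degLE S ⌊r⌋₊) (t := degLE S ⌊r⌋₊) (g := μ)
      (fun i hi => by rw [mem_degLE] at hi ⊢; rwa [hdeg]) (fun i => c i x * mPow emb y i)]
    refine Finset.sum_congr rfl fun k _ => ?_
    rw [Finset.sum_mul]
    refine Finset.sum_congr rfl fun i hi => ?_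
    rw [← (Finset.mem_filter.mp hi).2, ← mPowHom_apply, ← mPowHom_apply, hμ]

/-- Extraction of a coefficient with respect to finitely many distinct characters. -/
theorem exists_coeff_functional (A : Finset (F →* E)) (m₀ : F →* E) :
    ∃ l : F →₀ E, ∀ m ∈ A, (l.sum fun z a => a * m z) = if m = m₀ then 1 else 0 := by
  let v : F → (A → E) := fun z m => m.1 z
  have hspan : Submodule.span E (Set.range v) = ⊤ := by
    by_contra hne
    obtain ⟨φ, hφ0, hφ⟩ := Submodule.exists_le_ker_of_lt_top _ (lt_top_iff_ne_top.mpr hne)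
    refine hφ0 (LinearMap.pi_ext' fun m => LinearMap.ext_ring ?_)
    have hli : LinearIndependent E (fun m : A => (m.1 : F → E)) :=
      (linearIndependent_monoidHom F E).comp _ Subtype.val_injective
    rw [Fintype.linearIndependent_iff] at hli
    have h0 : ∀ z, φ (v z) = 0 := fun z => hφ (Submodule.subset_span ⟨z, rfl⟩)
    have h1 := hli (fun m => φ (Pi.single m 1)) (by
      ext z
      have h2 := h0 z
      rw [← Finset.univ_sum_single (v z), map_sum] at h2
      rw [Finset.sum_apply]
      simp only [Pi.smul_apply, smul_eq_mul, Pi.zero_apply]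
      rw [← h2]
      refine Finset.sum_congr rfl fun m _ => ?_
      have h3 : (Pi.single m (v z m) : A → E) = v z m • Pi.single m 1 := by
        rw [← Pi.single_smul, smul_eq_mul, mul_one]
      simp [h3, v, mul_comm]) m
    simpa using h1
  have hmem : (fun m : A => if m.1 = m₀ then (1 : E) else 0) ∈ Submodule.span E (Set.range v) := by
    rw [hspan]; trivial
  obtain ⟨l, hl⟩ := (Finsupp.mem_span_range_iff_exists_finsupp).mp hmem
  refine ⟨l, fun m hm => ?_⟩
  have := congrFun hl ⟨m, hm⟩
  rw [← this, Finsupp.sum, Finsupp.sum, Finset.sum_apply]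
  rfl

/-- If the coefficient of `y^k₀` (grouped by equality of monomial functions) vanishes on the unit
ball, so does that of `y^(k₀+j₀)`. -/
theorem HasTaylor.fiber_sum_eq_zero [IsUltrametricDist F] [IsUltrametricDist E] [CharZero E]
    {emb : S → (F →+* E)} (hemb : ∀ (σ : S) (z : F), ‖emb σ z‖ = ‖z‖) {ϖ : F} (hϖ0 : ϖ ≠ 0)
    (hϖ1 : ‖ϖ‖ < 1) {r M : ℝ} (hr : 0 ≤ r) {f : F → E} {c : (S → ℕ) → F → E}
    (h : HasTaylor emb r f c M) {k₀ j₀ : S → ℕ} (hdeg : mSum (k₀ + j₀) ≤ ⌊r⌋₊)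
    (hk : ∀ x : F, ‖x‖ ≤ 1 →
      ∑ i ∈ (degLE S ⌊r⌋₊).filter (fun i => mPowHom emb i = mPowHom emb k₀), c i x = 0)
    {x : F} (hx : ‖x‖ ≤ 1) :
    ∑ i ∈ (degLE S ⌊r⌋₊).filter (fun i => mPowHom emb i = mPowHom emb (k₀ + j₀)), c i x = 0 := by
  set N := ⌊r⌋₊ with hN
  obtain ⟨lz, hlz⟩ := exists_coeff_functional ((degLE S N).image (mPowHom emb)) (mPowHom emb k₀)
  obtain ⟨ly, hly⟩ := exists_coeff_functional ((degLE S N).image (mPowHom emb)) (mPowHom emb j₀)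
  have hlz' : ∀ i ∈ degLE S N, ∑ z ∈ lz.support, lz z * mPow emb z i =
      if mPowHom emb i = mPowHom emb k₀ then 1 else 0 := fun i hi =>
    hlz _ (Finset.mem_image_of_mem _ hi)
  have hly' : ∀ i ∈ degLE S N, ∑ y ∈ ly.support, ly y * mPow emb y i =
      if mPowHom emb i = mPowHom emb j₀ then 1 else 0 := fun i hi =>
    hly _ (Finset.mem_image_of_mem _ hi)
  let W : (S → ℕ) → E := fun i =>
    ∑ y ∈ ly.support, ∑ z ∈ lz.support, ly y * lz z * mPow emb (y + z) i
  have hWnat : ∀ i ∈ degLE S N, W i =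
      ((∑ k ∈ Fintype.piFinset fun σ => Finset.range (i σ + 1),
        if mPowHom emb k = mPowHom emb j₀ ∧ mPowHom emb (i - k) = mPowHom emb k₀
        then ∏ σ, (i σ).choose (k σ) else 0 : ℕ) : E) := by
    intro i hi
    have h1 : W i = ∑ k ∈ Fintype.piFinset fun σ => Finset.range (i σ + 1),
        (∑ y ∈ ly.support, ly y * mPow emb y k) *
          (∑ z ∈ lz.support, lz z * mPow emb z (i - k)) *
            ((∏ σ, (i σ).choose (k σ) : ℕ) : E) := by
      simp only [W, mPow_add_arg, Finset.mul_sum, Finset.sum_mul]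
      rw [Finset.sum_congr rfl fun y _ => Finset.sum_comm, Finset.sum_comm]
      refine Finset.sum_congr rfl fun k _ => ?_
      rw [Finset.sum_comm]
      refine Finset.sum_congr rfl fun z _ => Finset.sum_congr rfl fun y _ => ?_
      ring
    rw [h1, Nat.cast_sum]
    refine Finset.sum_congr rfl fun k hk' => ?_
    have hki : k + (i - k) = i := by
      ext σ
      have := Finset.mem_range.mp (Fintype.mem_piFinset.mp hk' σ)
      simp only [Pi.add_apply, Pi.sub_apply]
      omega
    have hsum : mSum k + mSum (i - k) ≤ N := by
      rw [← mSum_add, hki]; exact mem_degLE.mp hi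
    rw [hly' k (mem_degLE.mpr (by omega)), hlz' (i - k) (mem_degLE.mpr (by omega))]
    by_cases h2 : mPowHom emb k = mPowHom emb j₀ <;>
      by_cases h3 : mPowHom emb (i - k) = mPowHom emb k₀ <;> simp [h2, h3]
  have hWzero : ∀ i ∈ degLE S N, mPowHom emb i ≠ mPowHom emb (k₀ + j₀) → W i = 0 := by
    intro i hi hne
    rw [hWnat i hi, Nat.cast_eq_zero]
    refine Finset.sum_eq_zero fun k hk' => if_neg fun h2 => hne ?_
    have hki : k + (i - k) = i := by
      ext σ
      have := Finset.mem_range.mp (Fintype.mem_piFinset.mp hk' σ)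
      simp only [Pi.add_apply, Pi.sub_apply]
      omega
    rw [← hki, mPowHom_add, mPowHom_add, h2.1, h2.2, mul_comm]
  have hW0 : W (k₀ + j₀) ≠ 0 := by
    rw [hWnat _ (mem_degLE.mpr hdeg), Nat.cast_ne_zero]
    refine (Finset.sum_pos' (fun _ _ => Nat.zero_le _) ⟨j₀, ?_, ?_⟩).ne'
    · simp [Fintype.mem_piFinset]
    · have : k₀ + j₀ - j₀ = k₀ := by ext σ; simp
      rw [if_pos ⟨rfl, by rw [this]⟩]
      exact Finset.prod_pos fun σ _ => Nat.choose_pos (by simp)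
  have hWeq : ∀ i, mPowHom emb i = mPowHom emb (k₀ + j₀) → W i = W (k₀ + j₀) := by
    intro i hi
    simp only [W, ← mPowHom_apply, hi]
  set D := ∑ i ∈ (degLE S N).filter (fun i => mPowHom emb i = mPowHom emb (k₀ + j₀)), c i x
    with hD
  have hid : ∀ t : F, (∀ y ∈ ly.support, ‖t * y‖ ≤ 1) →
      D * mPow emb t (k₀ + j₀) * W (k₀ + j₀) = ∑ y ∈ ly.support, ∑ z ∈ lz.support,
        ly y * lz z * (tayRem emb N f c (x + t * y) (t * z) -
          tayRem emb N f c x (t * (y + z))) := by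
    intro t hty
    have e1 : D * mPow emb t (k₀ + j₀) * W (k₀ + j₀) =
        ∑ y ∈ ly.support, ∑ z ∈ lz.support, ly y * lz z *
          ∑ i ∈ degLE S N, c i x * mPow emb (t * (y + z)) i := by
      have e2 : ∑ i ∈ degLE S N, c i x * mPow emb t i * W i =
          D * mPow emb t (k₀ + j₀) * W (k₀ + j₀) := by
        rw [hD, Finset.sum_filter, Finset.sum_mul, Finset.sum_mul]
        refine Finset.sum_congr rfl fun i hi => ?_
        split_ifs with h2
        · rw [hWeq i h2, ← mPowHom_apply, h2, mPowHom_apply]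
        · rw [hWzero i hi h2]; ring
      rw [← e2]
      simp only [W, Finset.mul_sum, mPow_mul]
      rw [Finset.sum_comm]
      refine Finset.sum_congr rfl fun y _ => ?_
      rw [Finset.sum_comm]
      refine Finset.sum_congr rfl fun z _ => Finset.sum_congr rfl fun i _ => ?_
      ring
    have e3 : ∑ y ∈ ly.support, ∑ z ∈ lz.support, ly y * lz z *
          ∑ i ∈ degLE S N, c i (x + t * y) * mPow emb (t * z) i = 0 := by
      refine Finset.sum_eq_zero fun y hy => ?_
      have e4 : ∑ z ∈ lz.support, ly y * lz z *
          ∑ i ∈ degLE S N, c i (x + t * y) * mPow emb (t * z) i =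
          ly y * mPow emb t k₀ * ∑ i ∈ (degLE S N).filter
            (fun i => mPowHom emb i = mPowHom emb k₀), c i (x + t * y) := by
        have e5 : ∑ z ∈ lz.support, ly y * lz z *
          ∑ i ∈ degLE S N, c i (x + t * y) * mPow emb (t * z) i =
            ∑ i ∈ degLE S N, ly y * c i (x + t * y) * mPow emb t i *
              ∑ z ∈ lz.support, lz z * mPow emb z i := by
          simp only [Finset.mul_sum, mPow_mul]
          rw [Finset.sum_comm]
          refine Finset.sum_congr rfl fun i _ => Finset.sum_congr rfl fun z _ => ?_
          ring
        rw [e5, Finset.sum_filter, Finset.mul_sum]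
        refine Finset.sum_congr rfl fun i hi => ?_
        rw [hlz' i hi]
        split_ifs with h2
        · rw [← mPowHom_apply, h2, mPowHom_apply]; ring
        · ring
      rw [e4, hk _ (ball_add hx (hty y hy)), mul_zero]
    rw [← sub_zero (D * mPow emb t (k₀ + j₀) * W (k₀ + j₀)), e1, ← e3, ← Finset.sum_sub_distrib]
    refine Finset.sum_congr rfl fun y _ => ?_
    rw [← Finset.sum_sub_distrib]
    refine Finset.sum_congr rfl fun z _ => ?_
    unfold tayRem
    rw [show x + t * y + t * z = x + t * (y + z) by ring]
    ring
  obtain ⟨B, hB1, hBy, hBz⟩ : ∃ B : ℝ, 1 ≤ B ∧ (∀ y ∈ ly.support, ‖y‖ ≤ B) ∧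
      ∀ z ∈ lz.support, ‖z‖ ≤ B := by
    refine ⟨1 + ∑ y ∈ ly.support ∪ lz.support, ‖y‖, ?_, fun y hy => ?_, fun y hy => ?_⟩
    · have : 0 ≤ ∑ y ∈ ly.support ∪ lz.support, ‖y‖ := Finset.sum_nonneg fun _ _ => norm_nonneg _
      linarith
    all_goals
      have : ‖y‖ ≤ ∑ y ∈ ly.support ∪ lz.support, ‖y‖ :=
        Finset.single_le_sum (f := fun y => ‖y‖) (fun _ _ => norm_nonneg _)
          (Finset.mem_union.mpr (by tauto))
      linarith
  obtain ⟨L, hL0, hL⟩ : ∃ L : ℝ, 0 ≤ L ∧ ∀ y ∈ ly.support, ∀ z ∈ lz.support,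
      ‖ly y * lz z‖ ≤ L := by
    refine ⟨∑ y ∈ ly.support, ∑ z ∈ lz.support, ‖ly y * lz z‖,
      Finset.sum_nonneg fun _ _ => Finset.sum_nonneg fun _ _ => norm_nonneg _, fun y hy z hz => ?_⟩
    refine (Finset.single_le_sum (f := fun z => ‖ly y * lz z‖) (fun _ _ => norm_nonneg _) hz).trans
      (Finset.single_le_sum (f := fun y => ∑ z ∈ lz.support, ‖ly y * lz z‖)
        (fun _ _ => Finset.sum_nonneg fun _ _ => norm_nonneg _) hy)
  have hB0 : 0 < B := by linarith
  have hest : ∀ ε : ℝ, 0 < ε → ‖D‖ * ‖W (k₀ + j₀)‖ ≤ L * (ε * B ^ r) := by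
    intro ε hε
    obtain ⟨δ, hδ, H⟩ := h.2.2 ε hε
    obtain ⟨n, hn⟩ := exists_pow_lt_of_lt_one (show (0 : ℝ) < min 1 δ / B by positivity) hϖ1
    set t := ϖ ^ n with ht
    have htn : 0 < ‖t‖ := norm_pos_iff.mpr (pow_ne_zero _ hϖ0)
    rw [← norm_pow, ← ht, lt_div_iff₀ hB0] at hn
    have hpt : ∀ w : F, ‖w‖ ≤ B → ‖t * w‖ ≤ 1 ∧ ‖t * w‖ ≤ δ ∧ ‖t * w‖ ^ r ≤ ‖t‖ ^ r * B ^ r := by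
      intro w hw
      have h1 : ‖t * w‖ ≤ ‖t‖ * B := by
        rw [norm_mul]; exact mul_le_mul_of_nonneg_left hw htn.le
      refine ⟨h1.trans (hn.le.trans (min_le_left _ _)),
        h1.trans (hn.le.trans (min_le_right _ _)), ?_⟩
      rw [← Real.mul_rpow htn.le hB0.le]
      exact Real.rpow_le_rpow (norm_nonneg _) h1 hr
    have hrem : ∀ x' w : F, ‖x'‖ ≤ 1 → ‖w‖ ≤ B →
        ‖tayRem emb N f c x' (t * w)‖ ≤ ε * (‖t‖ ^ r * B ^ r) := by
      intro x' w hx' hw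
      obtain ⟨h1, h2, h3⟩ := hpt w hw
      exact (H x' (t * w) hx' h1 h2).trans (mul_le_mul_of_nonneg_left h3 hε.le)
    have h1 := hid t fun y hy => (hpt y (hBy y hy)).1
    have h2 : ‖D * mPow emb t (k₀ + j₀) * W (k₀ + j₀)‖ ≤ L * (ε * (‖t‖ ^ r * B ^ r)) := by
      rw [h1]
      have hnn : 0 ≤ ε * (‖t‖ ^ r * B ^ r) := by positivity
      refine norm_sum_le_of_ultra (by positivity) fun y hy =>
        norm_sum_le_of_ultra (by positivity) fun z hz => ?_
      rw [norm_mul]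
      refine mul_le_mul (hL y hy z hz) ?_ (norm_nonneg _) hL0
      rw [sub_eq_add_neg]
      refine ball_add (hrem _ _ (ball_add hx (hpt y (hBy y hy)).1) (hBz z hz)) ?_
      rw [norm_neg]
      exact hrem _ _ hx (ball_add (hBy y hy) (hBz z hz))
    rw [norm_mul, norm_mul, norm_mPow hemb] at h2
    have h3 : ‖t‖ ^ r ≤ ‖t‖ ^ mSum (k₀ + j₀) := by
      rw [← Real.rpow_natCast]
      refine Real.rpow_le_rpow_of_exponent_ge htn ?_ ?_
      · rw [ht, norm_pow]; exact pow_le_one₀ (norm_nonneg _) hϖ1.le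
      · exact (Nat.cast_le.mpr hdeg).trans (Nat.floor_le hr)
    have h4 : 0 < ‖t‖ ^ r := Real.rpow_pos_of_pos htn _
    have h5 : ‖D‖ * ‖W (k₀ + j₀)‖ * ‖t‖ ^ r ≤ L * (ε * B ^ r) * ‖t‖ ^ r := by
      calc ‖D‖ * ‖W (k₀ + j₀)‖ * ‖t‖ ^ r ≤ ‖D‖ * ‖W (k₀ + j₀)‖ * ‖t‖ ^ mSum (k₀ + j₀) :=
            mul_le_mul_of_nonneg_left h3 (by positivity)
        _ = ‖D‖ * ‖t‖ ^ mSum (k₀ + j₀) * ‖W (k₀ + j₀)‖ := by ring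
        _ ≤ L * (ε * (‖t‖ ^ r * B ^ r)) := h2
        _ = _ := by ring
    exact le_of_mul_le_mul_right h5 h4
  have hzero : ‖D‖ * ‖W (k₀ + j₀)‖ ≤ 0 := by
    refine le_of_forall_pos_le_add fun ε hε => ?_
    have hBr : 0 ≤ B ^ r := Real.rpow_nonneg hB0.le _
    refine (hest (ε / (L * B ^ r + 1)) (by positivity)).trans ?_
    rw [zero_add]
    calc L * (ε / (L * B ^ r + 1) * B ^ r) = ε * (L * B ^ r / (L * B ^ r + 1)) := by ring
      _ ≤ ε * 1 := mul_le_mul_of_nonneg_left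
          ((div_le_one (by positivity)).mpr (by linarith)) hε.le
      _ = ε := mul_one ε
  have hWpos : 0 < ‖W (k₀ + j₀)‖ := norm_pos_iff.mpr hW0
  rw [← norm_le_zero_iff]
  by_contra hcon
  rw [not_le] at hcon
  have := mul_pos hcon hWpos
  linarith

theorem charZero_of_norm_natCast_lt_one [IsUltrametricDist E] {p : ℕ} (h0 : (p : E) ≠ 0)
    (h1 : ‖(p : E)‖ < 1) : CharZero E := by
  obtain ⟨l, hl⟩ := CharP.exists E
  rcases CharP.char_is_prime_or_zero E l with hp | rfl
  · exfalso
    by_cases hdvd : l ∣ p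
    · exact h0 ((CharP.cast_eq_zero_iff E l p).mpr hdvd)
    · have hco : IsCoprime (l : ℤ) (p : ℤ) :=
        Nat.isCoprime_iff_coprime.mpr ((Nat.Prime.coprime_iff_not_dvd hp).mpr hdvd)
      obtain ⟨u, v, huv⟩ := hco
      have h2 : (v : E) * (p : E) = 1 := by
        have := congrArg (Int.cast : ℤ → E) huv
        push_cast at this
        rwa [CharP.cast_eq_zero E l, mul_zero, zero_add] at this
      have h3 : ‖(v : E)‖ * ‖(p : E)‖ = 1 := by rw [← norm_mul, h2, norm_one]
      have h4 : ‖(v : E)‖ ≤ 1 := IsUltrametricDist.norm_intCast_le_one E v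
      have h5 := norm_nonneg (p : E)
      nlinarith
  · exact CharP.charP_to_charZero E

/-! ### The space `C^r(O_F, J, d)` in terms of Taylor data -/

theorem mFact_ne_zero [CharZero E] (i : S → ℕ) : (mFact i : E) ≠ 0 := by
  rw [Nat.cast_ne_zero]
  exact Finset.prod_ne_zero_iff.mpr fun σ _ => Nat.factorial_ne_zero _

theorem crRem_eq_tayRem (emb : S → (F →+* E)) (N : ℕ) (f : F → E) (Df : (S → ℕ) → F → E)
    (x y : F) : crRem emb N f Df x y = tayRem emb N f (fun i x => Df i x / (mFact i : E)) x y := by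
  unfold crRem tayRem
  congr 1
  exact Finset.sum_congr rfl fun i _ => by ring

theorem exists_nat_zpow_neg_le {q : ℕ} (hq : 1 < q) {δ : ℝ} (hδ : 0 < δ) :
    ∃ H : ℕ, (q : ℝ) ^ (-(H : ℤ)) ≤ δ := by
  have hq' : (1 : ℝ) < q := by exact_mod_cast hq
  obtain ⟨n, hn⟩ := exists_pow_lt_of_lt_one hδ (inv_lt_one_of_one_lt₀ hq')
  exact ⟨n, by rw [zpow_neg, zpow_natCast, ← inv_pow]; exact hn.le⟩

theorem rpow_zpow_neg {q : ℕ} (hq : 1 < q) (r : ℝ) (h : ℕ) :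
    ((q : ℝ) ^ (-(h : ℤ))) ^ r * (q : ℝ) ^ (r * (h : ℝ)) = 1 := by
  have hq0 : (0 : ℝ) < q := by exact_mod_cast (by omega : 0 < q)
  rw [← Real.rpow_intCast, ← Real.rpow_mul hq0.le, ← Real.rpow_add hq0]
  push_cast
  rw [show -(h : ℝ) * r + r * h = 0 by ring, Real.rpow_zero]

theorem HasTaylor.isCrWith [CharZero E] {q : ℕ} (hq : 1 < q) {emb : S → (F →+* E)} {r M : ℝ}
    (hr : 0 ≤ r) {f : F → E} {c : (S → ℕ) → F → E} (h : HasTaylor emb r f c M) :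
    IsCrWith q emb r f (fun i x => (mFact i : E) * c i x) := by
  have hq0 : (0 : ℝ) < q := by exact_mod_cast (by omega : 0 < q)
  refine ⟨fun i hi => ⟨‖(mFact i : E)‖ * M, fun x hx => ?_⟩, fun ε hε => ?_⟩
  · rw [norm_mul]
    exact mul_le_mul_of_nonneg_left (h.1 i hi x hx) (norm_nonneg _)
  · obtain ⟨δ, hδ, H⟩ := h.2.2 ε hε
    obtain ⟨n, hn⟩ := exists_nat_zpow_neg_le hq hδ
    refine ⟨n, fun k hk x y hx hy => ?_⟩
    have hq1 : (1 : ℝ) ≤ q := by exact_mod_cast hq.le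
    have hy1 : ‖y‖ ≤ 1 := hy.trans (zpow_le_one_of_nonpos₀ hq1 (by simp))
    have hyδ : ‖y‖ ≤ δ := hy.trans ((zpow_le_zpow_right₀ hq1 (by omega)).trans hn)
    rw [crRem_eq_tayRem]
    simp only [mul_div_cancel_left₀ _ (mFact_ne_zero (E := E) _)]
    have h1 : ‖y‖ ^ r ≤ ((q : ℝ) ^ (-(k : ℤ))) ^ r := Real.rpow_le_rpow (norm_nonneg _) hy hr
    have h2 : 0 ≤ (q : ℝ) ^ (r * (k : ℝ)) := Real.rpow_nonneg hq0.le _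
    calc _ ≤ (ε * ((q : ℝ) ^ (-(k : ℤ))) ^ r) * (q : ℝ) ^ (r * (k : ℝ)) :=
          mul_le_mul_of_nonneg_right ((H x y hx hy1 hyδ).trans
            (mul_le_mul_of_nonneg_left h1 hε.le)) h2
      _ = ε := by rw [mul_assoc, rpow_zpow_neg hq, mul_one]

theorem IsCrWith.exists_hasTaylor [IsUltrametricDist F] [IsUltrametricDist E] {q : ℕ} (hq : 1 < q)
    (hval : ∀ x : F, x ≠ 0 → ∃ n : ℤ, ‖x‖ = (q : ℝ) ^ n) {emb : S → (F →+* E)}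
    (hemb : ∀ (σ : S) (z : F), ‖emb σ z‖ = ‖z‖) {r : ℝ} (hr : 0 ≤ r) {f : F → E}
    {Df : (S → ℕ) → F → E} (h : IsCrWith q emb r f Df) :
    ∃ M, HasTaylor emb r f (fun i x => Df i x / (mFact i : E)) M := by
  have hq0 : (0 : ℝ) < q := by exact_mod_cast (by omega : 0 < q)
  have hq1 : (1 : ℝ) < q := by exact_mod_cast hq
  set c : (S → ℕ) → F → E := fun i x => Df i x / (mFact i : E) with hc
  set e : F → F → E := tayRem emb ⌊r⌋₊ f c with he
  have hrem0 : ∀ x : F, ‖x‖ ≤ 1 → e x 0 = 0 := by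
    intro x hx
    rw [← norm_le_zero_iff]
    refine le_of_forall_pos_le_add fun ε hε => ?_
    obtain ⟨H, hH⟩ := h.2 ε hε
    have h1 := hH H le_rfl x 0 hx (by rw [norm_zero]; positivity)
    rw [crRem_eq_tayRem] at h1
    have h2 : 1 ≤ (q : ℝ) ^ (r * (H : ℝ)) := Real.one_le_rpow hq1.le (by positivity)
    have h3 := norm_nonneg (e x 0)
    rw [zero_add]
    exact (le_mul_of_one_le_right h3 h2).trans h1
  have hsmall : ∀ ε : ℝ, 0 < ε → ∃ δ : ℝ, 0 < δ ∧ ∀ x y : F, ‖x‖ ≤ 1 → ‖y‖ ≤ 1 → ‖y‖ ≤ δ →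
      ‖e x y‖ ≤ ε * ‖y‖ ^ r := by
    intro ε hε
    obtain ⟨H, hH⟩ := h.2 ε hε
    refine ⟨(q : ℝ) ^ (-(H : ℤ)), by positivity, fun x y hx hy1 hy => ?_⟩
    rcases eq_or_ne y 0 with rfl | hy0
    · rw [hrem0 x hx, norm_zero]; positivity
    · obtain ⟨n, hn⟩ := hval y hy0
      rw [hn] at hy
      have hnH : n ≤ -(H : ℤ) := (zpow_le_zpow_iff_right₀ hq1).mp hy
      obtain ⟨k, rfl⟩ : ∃ k : ℕ, n = -(k : ℤ) := ⟨(-n).toNat, by omega⟩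
      have h1 := hH k (by omega) x y hx hn.le
      rw [crRem_eq_tayRem] at h1
      have h2 : 0 ≤ ((q : ℝ) ^ (-(k : ℤ))) ^ r := by positivity
      have h3 := mul_le_mul_of_nonneg_right h1 h2
      rw [mul_assoc, mul_comm ((q : ℝ) ^ (r * (k : ℝ))), rpow_zpow_neg hq, mul_one, ← hn] at h3
      exact h3
  obtain ⟨M, hM0, hM⟩ : ∃ M : ℝ, 0 ≤ M ∧ ∀ i : S → ℕ, mSum i ≤ ⌊r⌋₊ → ∀ x : F, ‖x‖ ≤ 1 →
      ‖c i x‖ ≤ M := by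
    choose C hC using h.1
    let C' : (S → ℕ) → ℝ := fun i => if hi : mSum i ≤ ⌊r⌋₊ then |C i hi| / ‖(mFact i : E)‖ else 0
    have hC'0 : ∀ i, 0 ≤ C' i := fun i => by
      simp only [C']; split_ifs <;> positivity
    refine ⟨∑ i ∈ degLE S ⌊r⌋₊, C' i, Finset.sum_nonneg fun i _ => hC'0 i, fun i hi x hx => ?_⟩
    refine le_trans ?_ (Finset.single_le_sum (fun i _ => hC'0 i) (mem_degLE.mpr hi))
    simp only [C', dif_pos hi, hc, norm_div]
    exact div_le_div_of_nonneg_right ((hC i hi x hx).trans (le_abs_self _)) (norm_nonneg _)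
  have hf : ∀ x : F, ‖x‖ ≤ 1 → ‖f x‖ ≤ M := by
    intro x hx
    have h1 := hrem0 x hx
    rw [he, tayRem_zero, sub_eq_zero] at h1
    rw [h1]
    exact hM 0 (by simp [mSum_zero]) x hx
  have hbd : ∀ x y : F, ‖x‖ ≤ 1 → ‖y‖ ≤ 1 → ‖e x y‖ ≤ M := by
    intro x y hx hy
    rw [he]
    unfold tayRem
    rw [sub_eq_add_neg]
    refine ball_add (hf _ (ball_add hx hy)) ?_
    rw [norm_neg]
    refine norm_sum_le_of_ultra hM0 fun i hi => ?_
    rw [norm_mul]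
    exact (mul_le_of_le_one_right (norm_nonneg _) (norm_mPow_le_one hemb hy i)).trans
      (hM i (mem_degLE.mp hi) x hx)
  obtain ⟨δ, hδ, hδ'⟩ := hsmall 1 one_pos
  have hδr : 0 < δ ^ r := Real.rpow_pos_of_pos hδ _
  refine ⟨M + 1 + M / δ ^ r, fun i hi x hx => (hM i hi x hx).trans ?_, fun x y hx hy => ?_, hsmall⟩
  · have : 0 ≤ M / δ ^ r := by positivity
    linarith
  · have hyr : 0 ≤ ‖y‖ ^ r := by positivity
    have hdiv : 0 ≤ M / δ ^ r := by positivity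
    rcases le_total ‖y‖ δ with h1 | h1
    · refine (hδ' x y hx hy h1).trans (mul_le_mul_of_nonneg_right ?_ hyr)
      linarith
    · refine (hbd x y hx hy).trans ?_
      have h2 : δ ^ r ≤ ‖y‖ ^ r := Real.rpow_le_rpow hδ.le h1 hr
      calc M = M / δ ^ r * δ ^ r := by field_simp
        _ ≤ M / δ ^ r * ‖y‖ ^ r := mul_le_mul_of_nonneg_left h2 hdiv
        _ ≤ _ := mul_le_mul_of_nonneg_right (by linarith) hyr

/-! ### The `C^r` norm -/

theorem HasTaylor.crNormWith_le {emb : S → (F →+* E)} {r M : ℝ} {f : F → E}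
    {Df : (S → ℕ) → F → E} (h : HasTaylor emb r f (fun i x => Df i x / (mFact i : E)) M) :
    BddAbove ({x | ∃ i : S → ℕ, mSum i ≤ ⌊r⌋₊ ∧ ∃ z : F, ‖z‖ ≤ 1 ∧
          x = ‖Df i z / (mFact i : E)‖} ∪
        {x | ∃ z y : F, ‖z‖ ≤ 1 ∧ ‖y‖ ≤ 1 ∧ y ≠ 0 ∧
          x = ‖crRem emb ⌊r⌋₊ f Df z y‖ / ‖y‖ ^ r}) ∧ crNormWith emb r f Df ≤ M := by
  have key : ∀ a ∈ ({x | ∃ i : S → ℕ, mSum i ≤ ⌊r⌋₊ ∧ ∃ z : F, ‖z‖ ≤ 1 ∧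
          x = ‖Df i z / (mFact i : E)‖} ∪
        {x | ∃ z y : F, ‖z‖ ≤ 1 ∧ ‖y‖ ≤ 1 ∧ y ≠ 0 ∧
          x = ‖crRem emb ⌊r⌋₊ f Df z y‖ / ‖y‖ ^ r} : Set ℝ), a ≤ M := by
    rintro a (⟨i, hi, z, hz, rfl⟩ | ⟨z, y, hz, hy, hy0, rfl⟩)
    · exact h.1 i hi z hz
    · rw [div_le_iff₀ (Real.rpow_pos_of_pos (norm_pos_iff.mpr hy0) _), crRem_eq_tayRem]
      exact h.2.1 z y hz hy
  exact ⟨⟨M, key⟩, Real.sSup_le key h.nonneg⟩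

theorem crNormWith_nonneg (emb : S → (F →+* E)) (r : ℝ) (f : F → E) (Df : (S → ℕ) → F → E) :
    0 ≤ crNormWith emb r f Df := by
  refine Real.sSup_nonneg ?_
  rintro a (⟨i, hi, z, hz, rfl⟩ | ⟨z, y, hz, hy, hy0, rfl⟩) <;> positivity

theorem HasTaylor.crNormWith {emb : S → (F →+* E)} {r M : ℝ} {f : F → E}
    {Df : (S → ℕ) → F → E} (h : HasTaylor emb r f (fun i x => Df i x / (mFact i : E)) M) :
    HasTaylor emb r f (fun i x => Df i x / (mFact i : E)) (crNormWith emb r f Df) := by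
  have hb := h.crNormWith_le.1
  refine ⟨fun i hi x hx => le_csSup hb (Or.inl ⟨i, hi, x, hx, rfl⟩), fun x y hx hy => ?_, h.2.2⟩
  rcases eq_or_ne y 0 with rfl | hy0
  · rw [h.2.apply_zero hx, norm_zero]
    exact mul_nonneg (crNormWith_nonneg _ _ _ _) (Real.rpow_nonneg (norm_nonneg _) _)
  · rw [← div_le_iff₀ (Real.rpow_pos_of_pos (norm_pos_iff.mpr hy0) _), ← crRem_eq_tayRem]
    exact le_csSup hb (Or.inr ⟨x, y, hx, hy, hy0, rfl⟩)

theorem crRem_congr [IsUltrametricDist F] {emb : S → (F →+* E)} {N : ℕ} {f f' : F → E}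
    {Df Df' : (S → ℕ) → F → E} (hf : ∀ x, ‖x‖ ≤ 1 → f x = f' x)
    (hD : ∀ i, mSum i ≤ N → ∀ x, ‖x‖ ≤ 1 → Df i x = Df' i x) {x y : F} (hx : ‖x‖ ≤ 1)
    (hy : ‖y‖ ≤ 1) : crRem emb N f Df x y = crRem emb N f' Df' x y := by
  unfold crRem
  rw [hf _ (ball_add hx hy)]
  congr 1
  exact Finset.sum_congr rfl fun i hi => by rw [hD i (mem_degLE.mp hi) x hx]

theorem crNormWith_congr [IsUltrametricDist F] {emb : S → (F →+* E)} {r : ℝ} {f f' : F → E}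
    {Df Df' : (S → ℕ) → F → E} (hf : ∀ x, ‖x‖ ≤ 1 → f x = f' x)
    (hD : ∀ i, mSum i ≤ ⌊r⌋₊ → ∀ x, ‖x‖ ≤ 1 → Df i x = Df' i x) :
    crNormWith emb r f Df = crNormWith emb r f' Df' := by
  unfold crNormWith
  congr 2
  · ext a
    refine exists_congr fun i => and_congr_right fun hi => exists_congr fun z =>
      and_congr_right fun hz => ?_
    rw [hD i hi z hz]
  · ext a
    refine exists_congr fun z => exists_congr fun y => and_congr_right fun hz =>
      and_congr_right fun hy => and_congr_right fun _ => ?_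
    rw [crRem_congr hf hD hz hy]

theorem IsCrWith.congr [IsUltrametricDist F] {q : ℕ} (hq : 1 < q) {emb : S → (F →+* E)} {r : ℝ}
    {f f' : F → E} {Df : (S → ℕ) → F → E} (h : IsCrWith q emb r f Df)
    (hf : ∀ x, ‖x‖ ≤ 1 → f' x = f x) : IsCrWith q emb r f' Df := by
  refine ⟨h.1, fun ε hε => ?_⟩
  obtain ⟨H, hH⟩ := h.2 ε hε
  refine ⟨H, fun k hk x y hx hy => ?_⟩
  have hq1 : (1 : ℝ) ≤ q := by exact_mod_cast hq.le
  rw [crRem_congr hf (fun _ _ _ _ => rfl) hx (hy.trans (zpow_le_one_of_nonpos₀ hq1 (by simp)))]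
  exact hH k hk x y hx hy

theorem crNorm_congr [IsUltrametricDist F] {q : ℕ} (hq : 1 < q) {emb : S → (F →+* E)} {r : ℝ}
    {f f' : F → E} (hf : ∀ x, ‖x‖ ≤ 1 → f x = f' x) : crNorm q emb r f = crNorm q emb r f' := by
  unfold crNorm
  congr 1
  ext a
  refine exists_congr fun Df => ?_
  rw [crNormWith_congr hf fun _ _ _ _ => rfl]
  exact and_congr_left fun _ => ⟨fun h => h.congr hq fun x hx => (hf x hx).symm,
    fun h => h.congr hq hf⟩

theorem IsCrWith.add_smul [IsUltrametricDist E] {q : ℕ} (hq : 1 < q) {emb : S → (F →+* E)}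
    {r : ℝ} {f g : F → E} {Df Dg : (S → ℕ) → F → E} (hf : IsCrWith q emb r f Df)
    (hg : IsCrWith q emb r g Dg) (a : E) :
    IsCrWith q emb r (fun x => f x + a * g x) (fun i x => Df i x + a * Dg i x) := by
  have hq0 : (0 : ℝ) < q := by exact_mod_cast (by omega : 0 < q)
  have hrem : ∀ x y, crRem emb ⌊r⌋₊ (fun x => f x + a * g x) (fun i x => Df i x + a * Dg i x) x y =
      crRem emb ⌊r⌋₊ f Df x y + a * crRem emb ⌊r⌋₊ g Dg x y := by
    intro x y
    unfold crRem
    have : ∑ i ∈ degLE S ⌊r⌋₊, (Df i x + a * Dg i x) * mPow emb y i / (mFact i : E) =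
        ∑ i ∈ degLE S ⌊r⌋₊, Df i x * mPow emb y i / (mFact i : E) +
          a * ∑ i ∈ degLE S ⌊r⌋₊, Dg i x * mPow emb y i / (mFact i : E) := by
      rw [Finset.mul_sum, ← Finset.sum_add_distrib]
      exact Finset.sum_congr rfl fun i _ => by ring
    rw [this]
    ring
  refine ⟨fun i hi => ?_, fun ε hε => ?_⟩
  · obtain ⟨C, hC⟩ := hf.1 i hi
    obtain ⟨C', hC'⟩ := hg.1 i hi
    refine ⟨C + ‖a‖ * C', fun x hx => (norm_add_le _ _).trans (add_le_add (hC x hx) ?_)⟩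
    rw [norm_mul]
    exact mul_le_mul_of_nonneg_left (hC' x hx) (norm_nonneg _)
  · obtain ⟨H, hH⟩ := hf.2 (ε / 2) (by positivity)
    obtain ⟨H', hH'⟩ := hg.2 (ε / 2 / (‖a‖ + 1)) (by positivity)
    refine ⟨max H H', fun k hk x y hx hy => ?_⟩
    have h1 := hH k (le_of_max_le_left hk) x y hx hy
    have h2 := hH' k (le_of_max_le_right hk) x y hx hy
    set Q := (q : ℝ) ^ (r * (k : ℝ)) with hQ
    have hQ0 : 0 ≤ Q := Real.rpow_nonneg hq0.le _
    rw [hrem]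
    calc _ ≤ (‖crRem emb ⌊r⌋₊ f Df x y‖ + ‖a‖ * ‖crRem emb ⌊r⌋₊ g Dg x y‖) * Q := by
          refine mul_le_mul_of_nonneg_right ?_ hQ0
          rw [← norm_mul]; exact norm_add_le _ _
      _ = ‖crRem emb ⌊r⌋₊ f Df x y‖ * Q + ‖a‖ * (‖crRem emb ⌊r⌋₊ g Dg x y‖ * Q) := by ring
      _ ≤ ε / 2 + (‖a‖ + 1) * (ε / 2 / (‖a‖ + 1)) := by
          refine add_le_add h1 (mul_le_mul (by linarith) h2 ?_ (by positivity))
          exact mul_nonneg (norm_nonneg _) hQ0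
      _ = ε := by field_simp; ring

/-- Either the derivative data of a `C^r` function are determined by the function, or the norm
`crNorm` vanishes identically. -/
theorem crNorm_eq_or_eq_zero [IsUltrametricDist F] [IsUltrametricDist E] [CharZero E]
    {q : ℕ} (hq : 1 < q) (hval : ∀ x : F, x ≠ 0 → ∃ n : ℤ, ‖x‖ = (q : ℝ) ^ n)
    {emb : S → (F →+* E)} (hemb : ∀ (σ : S) (z : F), ‖emb σ z‖ = ‖z‖) {r : ℝ} (hr : 0 ≤ r)
    {a : E} (ha : 1 < ‖a‖) :
    (∀ (f : F → E) (Df : (S → ℕ) → F → E), IsCrWith q emb r f Df →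
      crNorm q emb r f = crNormWith emb r f Df) ∨ ∀ f : F → E, crNorm q emb r f = 0 := by
  by_cases hU : ∀ Z : (S → ℕ) → F → E, IsCrWith q emb r (fun _ => 0) Z →
      ∀ i, mSum i ≤ ⌊r⌋₊ → ∀ x : F, ‖x‖ ≤ 1 → Z i x = 0
  · left
    intro f Df hDf
    unfold crNorm
    have : {c | ∃ Df, IsCrWith q emb r f Df ∧ c = crNormWith emb r f Df} =
        {crNormWith emb r f Df} := by
      ext c
      constructor
      · rintro ⟨Df', hDf', rfl⟩
        refine crNormWith_congr (fun _ _ => rfl) fun i hi x hx => ?_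
        have h1 := hDf'.add_smul hq hDf (-1)
        have h2 := hU _ (h1.congr hq fun x _ => by ring) i hi x hx
        linear_combination h2
      · rintro rfl
        exact ⟨Df, hDf, rfl⟩
    rw [this, csSup_singleton]
  · right
    push Not at hU
    obtain ⟨Z, hZ, i, hi, x, hx, hne⟩ := hU
    intro f
    by_cases hf : ∃ Df, IsCrWith q emb r f Df
    · obtain ⟨Df, hDf⟩ := hf
      refine Real.sSup_of_not_bddAbove ?_
      rintro ⟨B, hB⟩
      have hpos : 0 < ‖Z i x / (mFact i : E)‖ :=
        norm_pos_iff.mpr (div_ne_zero hne (mFact_ne_zero i))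
      obtain ⟨n, hn⟩ := pow_unbounded_of_one_lt
        ((B + ‖Df i x / (mFact i : E)‖) / ‖Z i x / (mFact i : E)‖) ha
      rw [div_lt_iff₀ hpos, ← norm_pow, ← norm_mul] at hn
      have h1 : IsCrWith q emb r f (fun i x => Df i x + a ^ n * Z i x) :=
        (hDf.add_smul hq hZ (a ^ n)).congr hq fun x _ => by simp
      obtain ⟨M, hM⟩ := h1.exists_hasTaylor hq hval hemb hr
      have h2 := hM.crNormWith.1 i hi x hx
      have h3 := hB ⟨_, h1, rfl⟩
      have h4 : a ^ n * (Z i x / (mFact i : E)) =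
          (Df i x + a ^ n * Z i x) / (mFact i : E) - Df i x / (mFact i : E) := by ring
      have h5 := norm_sub_le ((Df i x + a ^ n * Z i x) / (mFact i : E)) (Df i x / (mFact i : E))
      rw [← h4] at h5
      linarith
    · have : {c | ∃ Df, IsCrWith q emb r f Df ∧ c = crNormWith emb r f Df} = ∅ :=
        Set.eq_empty_of_forall_notMem fun c ⟨Df, hDf, _⟩ => hf ⟨Df, hDf⟩
      unfold crNorm
      rw [this, Real.sSup_empty]

/-- The directions along which the vanishing conditions defining `C^r(O_F, J, d)` impose nothing
on the function: besides those of `J`, these are the `σ` for which the monomial `σ^(d σ + 1)`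
has another presentation. -/
def freeDirs (emb : S → (F →+* E)) (J : Set S) (d : S → ℕ) : Set S :=
  {σ | σ ∈ J ∨ ∃ i : S → ℕ, mPowHom emb i = mPowHom emb (Pi.single σ (d σ + 1)) ∧
    ∀ τ, τ ∉ J → i ≠ Pi.single τ (d τ + 1)}

theorem subset_freeDirs (emb : S → (F →+* E)) (J : Set S) (d : S → ℕ) :
    J ⊆ freeDirs emb J d := fun _ h => Or.inl h

theorem SuppIn.push_rep {emb : S → (F →+* E)} [IsUltrametricDist F] [IsUltrametricDist E]
    [CharZero E] (hemb : ∀ (σ : S) (z : F), ‖emb σ z‖ = ‖z‖) {ϖ : F} (hϖ0 : ϖ ≠ 0)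
    (hϖ1 : ‖ϖ‖ < 1) {r M : ℝ} (hr : 0 ≤ r) {J : Set S} {d : S → ℕ} {f : F → E}
    {c : (S → ℕ) → F → E} (h : HasTaylor emb r f c M)
    (hc : ∀ σ, σ ∉ J → ∀ x : F, ‖x‖ ≤ 1 → c (Pi.single σ (d σ + 1)) x = 0) :
    TaylorIn emb r (freeDirs emb J d) d f M := by
  let rep : (S → ℕ) → (S → ℕ) := fun i =>
    Classical.choose (⟨i, rfl⟩ : ∃ j, mPowHom emb j = mPowHom emb i)
  have hrep : ∀ i, mPowHom emb (rep i) = mPowHom emb i := fun i =>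
    Classical.choose_spec (⟨i, rfl⟩ : ∃ j, mPowHom emb j = mPowHom emb i)
  have hrep' : ∀ i j, mPowHom emb i = mPowHom emb j → rep i = rep j := by
    intro i j hij
    simp only [rep, hij]
  have hdeg := fun {i j : S → ℕ} => mSum_eq_of_mPowHom_eq (i := i) (j := j) hemb hϖ0 hϖ1
  refine ⟨_, ?_, h.push rep (fun i => hdeg (hrep i)) hrep⟩
  rintro k ⟨σ, hσ, hlt⟩ x hx
  by_cases hk : ∃ i ∈ degLE S ⌊r⌋₊, rep i = k
  · obtain ⟨i₀, hi₀, hik⟩ := hk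
    have hkN : mSum k ≤ ⌊r⌋₊ := by
      rw [← hik, hdeg (hrep i₀)]; exact mem_degLE.mp hi₀
    have hdec : Pi.single σ (d σ + 1) + (k - Pi.single σ (d σ + 1)) = k := by
      ext τ
      rcases eq_or_ne τ σ with rfl | hne
      · simp; omega
      · simp [hne]
    have h0 := h.fiber_sum_eq_zero hemb hϖ0 hϖ1 hr (k₀ := Pi.single σ (d σ + 1))
      (j₀ := k - Pi.single σ (d σ + 1)) (by rw [hdec]; exact hkN) (fun x hx => by
        refine Finset.sum_eq_zero fun i hi => ?_
        have hi' := (Finset.mem_filter.mp hi).2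
        simp only [freeDirs, Set.mem_ofPred_eq, not_or, not_exists, not_and, not_forall,
          not_not] at hσ
        obtain ⟨τ, hτ, hiτ⟩ := hσ.2 i hi'
        rw [hiτ]
        exact hc τ hτ x hx) hx
    rw [hdec] at h0
    rw [← h0]
    refine Finset.sum_congr (Finset.filter_congr fun i _ => ⟨fun hi => ?_, fun hi => ?_⟩)
      fun _ _ => rfl
    · rw [← hrep i, hi]
    · rw [← hik]
      refine hrep' _ _ ?_
      rw [hi, ← hik, hrep]
  · refine Finset.sum_eq_zero fun i hi => ?_
    rw [Finset.mem_filter] at hi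
    exact absurd ⟨i, hi.1, hi.2⟩ hk

theorem TaylorIn.isCrJ {emb : S → (F →+* E)} [IsUltrametricDist E]
    [CharZero E] {q : ℕ} (hq : 1 < q) (hemb : ∀ (σ : S) (z : F), ‖emb σ z‖ = ‖z‖) {ϖ : F}
    (hϖ0 : ϖ ≠ 0) (hϖ1 : ‖ϖ‖ < 1) {r M : ℝ} (hr : 0 ≤ r) {J : Set S} {d : S → ℕ} {f : F → E}
    (h : TaylorIn emb r (freeDirs emb J d) d f M) : IsCrJ q emb r J d f := by
  obtain ⟨c, hc, hT⟩ := h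
  let good : (S → ℕ) → Prop := fun i => ∀ τ, τ ∉ J → i ≠ Pi.single τ (d τ + 1)
  let P : (S → ℕ) → (S → ℕ) → Prop := fun i j =>
    mPowHom emb j = mPowHom emb i ∧ (good j ∨ (j = i ∧ ¬ ∃ j', mPowHom emb j' = mPowHom emb i ∧
      good j'))
  have hex : ∀ i, ∃ j, P i j := by
    intro i
    by_cases h1 : ∃ j', mPowHom emb j' = mPowHom emb i ∧ good j'
    · exact ⟨h1.choose, h1.choose_spec.1, Or.inl h1.choose_spec.2⟩
    · exact ⟨i, rfl, Or.inr ⟨rfl, h1⟩⟩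
  choose μ hμ using hex
  have hT' := hT.push μ (fun i => mSum_eq_of_mPowHom_eq hemb hϖ0 hϖ1 (hμ i).1) fun i => (hμ i).1
  refine ⟨_, hT'.isCrWith hq hr, fun σ hσ x hx => ?_⟩
  rw [Finset.sum_eq_zero, mul_zero]
  intro i hi
  have hi' := (Finset.mem_filter.mp hi).2
  rcases (hμ i).2 with h1 | ⟨h1, h2⟩
  · exact absurd hi' (h1 σ hσ)
  · have hi2 : i = Pi.single σ (d σ + 1) := h1.symm.trans hi'
    refine hc i ⟨σ, fun hσK => ?_, by rw [hi2]; simp⟩ x hx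
    rcases hσK with h3 | ⟨j, hj1, hj2⟩
    · exact hσ h3
    · exact h2 ⟨j, by rw [hi2]; exact hj1, hj2⟩

theorem IsCrJ.taylorIn {emb : S → (F →+* E)} [IsUltrametricDist F] [IsUltrametricDist E]
    [CharZero E] {q : ℕ} (hq : 1 < q) (hval : ∀ x : F, x ≠ 0 → ∃ n : ℤ, ‖x‖ = (q : ℝ) ^ n)
    (hemb : ∀ (σ : S) (z : F), ‖emb σ z‖ = ‖z‖) {ϖ : F}
    (hϖ0 : ϖ ≠ 0) (hϖ1 : ‖ϖ‖ < 1) {r : ℝ} (hr : 0 ≤ r) {J : Set S} {d : S → ℕ} {f : F → E}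
    (h : IsCrJ q emb r J d f) : ∃ Df, IsCrWith q emb r f Df ∧
      TaylorIn emb r (freeDirs emb J d) d f (crNormWith emb r f Df) := by
  obtain ⟨Df, hDf, h0⟩ := h
  obtain ⟨M, hM⟩ := hDf.exists_hasTaylor hq hval hemb hr
  exact ⟨Df, hDf, SuppIn.push_rep hemb hϖ0 hϖ1 hr hM.crNormWith fun σ hσ x hx => by
    simp [h0 σ hσ x hx]⟩

theorem TaylorIn.exists_isCrWith {emb : S → (F →+* E)} [CharZero E] {q : ℕ} (hq : 1 < q)
    {r M : ℝ} (hr : 0 ≤ r) {K : Set S} {d : S → ℕ} {f : F → E} (h : TaylorIn emb r K d f M) :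
    ∃ Df, IsCrWith q emb r f Df ∧ crNormWith emb r f Df ≤ M := by
  obtain ⟨c, hc, hT⟩ := h
  have h1 : HasTaylor emb r f (fun i x => (mFact i : E) * c i x / (mFact i : E)) M := by
    have : (fun i x => (mFact i : E) * c i x / (mFact i : E)) = c := by
      ext i x
      have := mFact_ne_zero (E := E) i
      field_simp
    rwa [this]
  exact ⟨_, hT.isCrWith hq hr, h1.crNormWith_le.2⟩

/-! ### Jets at the origin -/

/-- `u` agrees to order `N + 1` at the origin, on the disc of radius `ρ`, with a polynomial
whose exponents are bounded by `e` off `K`. -/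
def IsJet (emb : S → (F →+* E)) (N : ℕ) (ρ : ℝ) (K : Set S) (e : S → ℕ) (u : F → E) : Prop :=
  ∃ (b : (S → ℕ) → E) (C : ℝ), (∀ m : S → ℕ, (∃ σ, σ ∉ K ∧ e σ < m σ) → b m = 0) ∧
    (∀ m ∈ degLE S N, ‖b m‖ ≤ C) ∧
    ∀ t : F, ‖t‖ ≤ ρ → ‖u t - ∑ m ∈ degLE S N, b m * mPow emb t m‖ ≤ C * ‖t‖ ^ (N + 1)

theorem zero_mem_degLE (N : ℕ) : (0 : S → ℕ) ∈ degLE S N :=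
  mem_degLE.mpr (by simp [mSum_zero])

section Jet

variable {emb : S → (F →+* E)} {N : ℕ} {ρ : ℝ} {K : Set S} {e e' : S → ℕ} {u v : F → E}

theorem IsJet.mono (h : IsJet emb N ρ K e u) (he : ∀ σ, σ ∉ K → e σ ≤ e' σ) :
    IsJet emb N ρ K e' u :=
  let ⟨b, C, h1, h2⟩ := h
  ⟨b, C, fun m ⟨σ, hσ, hm⟩ => h1 m ⟨σ, hσ, (he σ hσ).trans_lt hm⟩, h2⟩

theorem IsJet.of_sub_le (h : IsJet emb N ρ K e v) {B : ℝ}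
    (hB : ∀ t : F, ‖t‖ ≤ ρ → ‖u t - v t‖ ≤ B * ‖t‖ ^ (N + 1)) : IsJet emb N ρ K e u := by
  obtain ⟨b, C, h1, h2, h3⟩ := h
  have hC : 0 ≤ C := (norm_nonneg _).trans (h2 _ (zero_mem_degLE N))
  refine ⟨b, C + |B|, h1, fun m hm => (h2 m hm).trans (by linarith [abs_nonneg B]),
    fun t ht => ?_⟩
  have h4 := h3 t ht
  have h5 : B * ‖t‖ ^ (N + 1) ≤ |B| * ‖t‖ ^ (N + 1) :=
    mul_le_mul_of_nonneg_right (le_abs_self B) (by positivity)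
  have h6 := norm_add_le (u t - v t) (v t - ∑ m ∈ degLE S N, b m * mPow emb t m)
  rw [sub_add_sub_cancel] at h6
  have := hB t ht
  linarith

theorem IsJet.congr (h : IsJet emb N ρ K e v) (huv : ∀ t : F, ‖t‖ ≤ ρ → u t = v t) :
    IsJet emb N ρ K e u :=
  h.of_sub_le (B := 0) fun t ht => by simp [huv t ht]

theorem IsJet.add (hu : IsJet emb N ρ K e u) (hv : IsJet emb N ρ K e v) :
    IsJet emb N ρ K e (fun t => u t + v t) := by
  obtain ⟨b, C, h1, h2, h3⟩ := hu
  obtain ⟨b', C', h1', h2', h3'⟩ := hv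
  refine ⟨fun m => b m + b' m, C + C', fun m hm => by simp [h1 m hm, h1' m hm],
    fun m hm => (norm_add_le _ _).trans (add_le_add (h2 m hm) (h2' m hm)), fun t ht => ?_⟩
  have : u t + v t - ∑ m ∈ degLE S N, (b m + b' m) * mPow emb t m =
      (u t - ∑ m ∈ degLE S N, b m * mPow emb t m) +
        (v t - ∑ m ∈ degLE S N, b' m * mPow emb t m) := by
    simp only [add_mul, Finset.sum_add_distrib]; ring
  rw [this, add_mul]
  exact (norm_add_le _ _).trans (add_le_add (h3 t ht) (h3' t ht))

theorem isJet_zero : IsJet emb N ρ K e (fun _ => 0) :=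
  ⟨fun _ => 0, 0, fun _ _ => rfl, fun _ _ => by simp, fun _ _ => by simp⟩

theorem IsJet.sum {ι : Type*} {s : Finset ι} {u : ι → F → E}
    (h : ∀ i ∈ s, IsJet emb N ρ K e (u i)) : IsJet emb N ρ K e (fun t => ∑ i ∈ s, u i t) := by
  induction s using Finset.induction_on with
  | empty => simpa using isJet_zero
  | insert a s ha ih =>
    simp only [Finset.sum_insert ha]
    exact (h a (Finset.mem_insert_self a s)).add
      (ih fun i hi => h i (Finset.mem_insert_of_mem hi))

theorem isJet_monomial (hemb : ∀ (σ : S) (z : F), ‖emb σ z‖ = ‖z‖) (hρ : ρ ≤ 1) (a : E)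
    (m : S → ℕ) (hm : a ≠ 0 → ∀ σ, σ ∉ K → m σ ≤ e σ) :
    IsJet emb N ρ K e (fun t => a * mPow emb t m) := by
  by_cases hmN : m ∈ degLE S N
  · refine ⟨fun k => if k = m then a else 0, ‖a‖, ?_, fun k _ => ?_, fun t _ => ?_⟩
    · rintro k ⟨σ, hσ, hk⟩
      beta_reduce
      split_ifs with h
      · by_contra ha
        have := hm ha σ hσ
        rw [h] at hk
        omega
      · rfl
    · beta_reduce
      split_ifs <;> simp
    · rw [Finset.sum_eq_single_of_mem m hmN fun k _ hk => by simp [hk]]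
      simp only [if_true, sub_self, norm_zero]
      positivity
  · refine isJet_zero.of_sub_le (B := ‖a‖) fun t ht => ?_
    rw [sub_zero, norm_mul, norm_mPow hemb]
    rw [mem_degLE, not_le] at hmN
    exact mul_le_mul_of_nonneg_left (pow_le_pow_of_le_one (norm_nonneg _) (ht.trans hρ) hmN)
      (norm_nonneg _)

theorem isJet_const (hemb : ∀ (σ : S) (z : F), ‖emb σ z‖ = ‖z‖) (hρ : ρ ≤ 1) (a : E) :
    IsJet emb N ρ K e (fun _ => a) :=
  (isJet_monomial hemb hρ a 0 fun _ _ _ => Nat.zero_le _).congr fun t _ => by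
    rw [mPow_index_zero, mul_one]

theorem norm_jet_poly_le [IsUltrametricDist E] (hemb : ∀ (σ : S) (z : F), ‖emb σ z‖ = ‖z‖)
    {b : (S → ℕ) → E} {C : ℝ} (hb : ∀ m ∈ degLE S N, ‖b m‖ ≤ C) {t : F} (ht : ‖t‖ ≤ 1) :
    ‖∑ m ∈ degLE S N, b m * mPow emb t m‖ ≤ C := by
  have hC : 0 ≤ C := (norm_nonneg _).trans (hb _ (zero_mem_degLE N))
  refine norm_sum_le_of_ultra hC fun m hm => ?_
  rw [norm_mul]
  exact (mul_le_of_le_one_right (norm_nonneg _) (norm_mPow_le_one hemb ht m)).trans (hb m hm)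

theorem IsJet.bounded [IsUltrametricDist E] (hemb : ∀ (σ : S) (z : F), ‖emb σ z‖ = ‖z‖)
    (hρ : ρ ≤ 1) (h : IsJet emb N ρ K e u) : ∃ B, 0 ≤ B ∧ ∀ t : F, ‖t‖ ≤ ρ → ‖u t‖ ≤ B := by
  obtain ⟨b, C, h1, h2, h3⟩ := h
  have hC : 0 ≤ C := (norm_nonneg _).trans (h2 _ (zero_mem_degLE N))
  refine ⟨C, hC, fun t ht => ?_⟩
  have h4 := h3 t ht
  have h5 : ‖t‖ ^ (N + 1) ≤ 1 := pow_le_one₀ (norm_nonneg _) (ht.trans hρ)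
  have h6 := ball_add (h4.trans (mul_le_of_le_one_right hC h5))
    (norm_jet_poly_le hemb h2 (ht.trans hρ))
  rwa [sub_add_cancel] at h6

theorem IsJet.mul [IsUltrametricDist E] (hemb : ∀ (σ : S) (z : F), ‖emb σ z‖ = ‖z‖)
    (hρ : ρ ≤ 1) (hu : IsJet emb N ρ K e u) (hv : IsJet emb N ρ K e' v) :
    IsJet emb N ρ K (e + e') (fun t => u t * v t) := by
  obtain ⟨B, hB0, hB⟩ := hv.bounded hemb hρ
  obtain ⟨b, C, h1, h2, h3⟩ := hu
  obtain ⟨b', C', h1', h2', h3'⟩ := hv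
  have hC : 0 ≤ C := (norm_nonneg _).trans (h2 _ (zero_mem_degLE N))
  have hC' : 0 ≤ C' := (norm_nonneg _).trans (h2' _ (zero_mem_degLE N))
  have hP : IsJet emb N ρ K (e + e')
      (fun t => ∑ m ∈ degLE S N, ∑ m' ∈ degLE S N, (b m * b' m') * mPow emb t (m + m')) := by
    refine IsJet.sum fun m _ => IsJet.sum fun m' _ => isJet_monomial hemb hρ _ _ ?_
    intro hne σ hσ
    have hm : m σ ≤ e σ := by
      by_contra hlt
      exact hne (by rw [h1 m ⟨σ, hσ, not_le.mp hlt⟩, zero_mul])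
    have hm' : m' σ ≤ e' σ := by
      by_contra hlt
      exact hne (by rw [h1' m' ⟨σ, hσ, not_le.mp hlt⟩, mul_zero])
    exact Nat.add_le_add hm hm'
  refine hP.of_sub_le (B := C * B + C * C') fun t ht => ?_
  have hsplit : u t * v t -
      ∑ m ∈ degLE S N, ∑ m' ∈ degLE S N, (b m * b' m') * mPow emb t (m + m') =
      (u t - ∑ m ∈ degLE S N, b m * mPow emb t m) * v t +
      (∑ m ∈ degLE S N, b m * mPow emb t m) * (v t - ∑ m ∈ degLE S N, b' m * mPow emb t m) := by
    have : ∑ m ∈ degLE S N, ∑ m' ∈ degLE S N, (b m * b' m') * mPow emb t (m + m') =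
        (∑ m ∈ degLE S N, b m * mPow emb t m) * (∑ m ∈ degLE S N, b' m * mPow emb t m) := by
      rw [Finset.sum_mul_sum]
      refine Finset.sum_congr rfl fun m _ => Finset.sum_congr rfl fun m' _ => ?_
      rw [mPow_add]; ring
    rw [this]; ring
  rw [hsplit]
  refine (norm_add_le _ _).trans ?_
  rw [norm_mul, norm_mul, add_mul]
  refine add_le_add ?_ ?_
  · calc _ ≤ (C * ‖t‖ ^ (N + 1)) * B :=
          mul_le_mul (h3 t ht) (hB t ht) (norm_nonneg _) (by positivity)
      _ = _ := by ring
  · calc _ ≤ C * (C' * ‖t‖ ^ (N + 1)) :=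
          mul_le_mul (norm_jet_poly_le hemb h2 (ht.trans hρ)) (h3' t ht) (norm_nonneg _) hC
      _ = _ := by ring

theorem IsJet.prod [IsUltrametricDist E] (hemb : ∀ (σ : S) (z : F), ‖emb σ z‖ = ‖z‖)
    (hρ : ρ ≤ 1) {ι : Type*} {s : Finset ι} {u : ι → F → E} {e : ι → S → ℕ}
    (h : ∀ i ∈ s, IsJet emb N ρ K (e i) (u i)) :
    IsJet emb N ρ K (∑ i ∈ s, e i) (fun t => ∏ i ∈ s, u i t) := by
  induction s using Finset.induction_on with
  | empty => simpa using isJet_const hemb hρ 1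
  | insert a s ha ih =>
    simp only [Finset.prod_insert ha, Finset.sum_insert ha]
    exact (h a (Finset.mem_insert_self a s)).mul hemb hρ
      (ih fun i hi => h i (Finset.mem_insert_of_mem hi))

theorem IsJet.pow [IsUltrametricDist E] (hemb : ∀ (σ : S) (z : F), ‖emb σ z‖ = ‖z‖)
    (hρ : ρ ≤ 1) (h : IsJet emb N ρ K 0 u) (n : ℕ) : IsJet emb N ρ K 0 (fun t => u t ^ n) := by
  have := IsJet.prod hemb hρ (s := Finset.range n) (u := fun _ => u) (e := fun _ => 0)
    fun _ _ => h
  simpa using this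

theorem IsJet.sub_le [IsUltrametricDist E] (hemb : ∀ (σ : S) (z : F), ‖emb σ z‖ = ‖z‖)
    (hρ0 : 0 ≤ ρ) (hρ : ρ ≤ 1) (h : IsJet emb N ρ K e u) :
    ∃ B, 0 ≤ B ∧ ∀ t : F, ‖t‖ ≤ ρ → ‖u t - u 0‖ ≤ B * ‖t‖ := by
  obtain ⟨b, C, h1, h2, h3⟩ := h
  have hC : 0 ≤ C := (norm_nonneg _).trans (h2 _ (zero_mem_degLE N))
  have hne : ∀ m ∈ (degLE S N).erase 0, m ≠ 0 := fun m hm => (Finset.mem_erase.mp hm).1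
  have hu0 : u 0 = b 0 := by
    have h4 := h3 0 (by simpa using hρ0)
    rw [← Finset.add_sum_erase _ _ (zero_mem_degLE N),
      Finset.sum_eq_zero fun m hm => by rw [mPow_zero emb (hne m hm), mul_zero]] at h4
    simpa [mPow_index_zero, sub_eq_zero] using h4
  refine ⟨C, hC, fun t ht => ?_⟩
  have ht1 := ht.trans hρ
  have hsplit : u t - u 0 = (u t - ∑ m ∈ degLE S N, b m * mPow emb t m) +
      ∑ m ∈ (degLE S N).erase 0, b m * mPow emb t m := by
    rw [← Finset.add_sum_erase _ _ (zero_mem_degLE N), hu0, mPow_index_zero]; ring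
  rw [hsplit]
  refine ball_add ((h3 t ht).trans (mul_le_mul_of_nonneg_left ?_ hC)) ?_
  · exact pow_le_of_le_one (norm_nonneg _) ht1 (Nat.succ_ne_zero N)
  · refine norm_sum_le_of_ultra (by positivity) fun m hm => ?_
    rw [norm_mul, norm_mPow hemb]
    refine mul_le_mul (h2 m (Finset.mem_of_mem_erase hm)) ?_ (by positivity) hC
    refine pow_le_of_le_one (norm_nonneg _) ht1 fun h0 => hne m hm ?_
    ext σ
    exact (Finset.sum_eq_zero_iff.mp h0) σ (Finset.mem_univ σ)

theorem IsJet.inv [IsUltrametricDist E] (hemb : ∀ (σ : S) (z : F), ‖emb σ z‖ = ‖z‖)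
    (hρ0 : 0 ≤ ρ) (hρ : ρ ≤ 1) (h : IsJet emb N ρ K 0 u) (hu0 : u 0 = 1) {B : ℝ}
    (hne : ∀ t : F, ‖t‖ ≤ ρ → u t ≠ 0) (hB : ∀ t : F, ‖t‖ ≤ ρ → ‖(u t)⁻¹‖ ≤ B) :
    IsJet emb N ρ K 0 (fun t => (u t)⁻¹) := by
  obtain ⟨A, hA0, hA⟩ := h.sub_le hemb hρ0 hρ
  have h1 : IsJet emb N ρ K 0 (fun t => 1 - u t) :=
    ((isJet_const (e := 0) hemb hρ 1).add
      ((isJet_const (e := 0) hemb hρ (-1)).mul hemb hρ h |>.mono (e' := 0)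
        fun _ _ => by simp)).congr
      fun t _ => by ring
  have h2 : IsJet emb N ρ K 0 (fun t => ∑ k ∈ Finset.range (N + 1), (1 - u t) ^ k) :=
    IsJet.sum fun k _ => h1.pow hemb hρ k
  refine h2.of_sub_le (B := A ^ (N + 1) * B) fun t ht => ?_
  have hgeom : (u t)⁻¹ - ∑ k ∈ Finset.range (N + 1), (1 - u t) ^ k =
      (1 - u t) ^ (N + 1) * (u t)⁻¹ := by
    have h3 := mul_neg_geom_sum (1 - u t) (N + 1)
    have h4 := hne t ht
    field_simp
    linear_combination -h3
  rw [hgeom, norm_mul, norm_pow]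
  have h5 : ‖1 - u t‖ ≤ A * ‖t‖ := by
    rw [norm_sub_rev, ← hu0]; exact hA t ht
  calc ‖1 - u t‖ ^ (N + 1) * ‖(u t)⁻¹‖ ≤ (A * ‖t‖) ^ (N + 1) * B :=
        mul_le_mul (pow_le_pow_left₀ (norm_nonneg _) h5 _) (hB t ht) (norm_nonneg _) (by positivity)
    _ = _ := by ring

theorem norm_one_add_eq_one [IsUltrametricDist F] {t : F} (ht : ‖t‖ < 1) : ‖1 + t‖ = 1 := by
  rw [IsUltrametricDist.norm_add_eq_max_of_norm_ne_norm (by rw [norm_one]; exact ht.ne'), norm_one]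
  exact max_eq_left ht.le

theorem exists_inv_one_add [IsUltrametricDist F] (hρ1 : ρ < 1) {t : F} (ht : ‖t‖ ≤ ρ) :
    ∃ s : F, ‖s‖ ≤ ρ ∧ (1 + t)⁻¹ = 1 + s := by
  have h1 := norm_one_add_eq_one (ht.trans_lt hρ1)
  have h0 : (1 + t) ≠ 0 := norm_ne_zero_iff.mp (by rw [h1]; exact one_ne_zero)
  refine ⟨-t * (1 + t)⁻¹, ?_, ?_⟩
  · rw [norm_mul, norm_neg, norm_inv, h1]; simpa using ht
  · field_simp; ring

/-- The inverse of a multiplicative function which is a jet near `1`. -/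
theorem IsJet.monoidHom_inv [IsUltrametricDist F] [IsUltrametricDist E]
    (hemb : ∀ (σ : S) (z : F), ‖emb σ z‖ = ‖z‖) (hρ0 : 0 ≤ ρ) (hρ1 : ρ < 1) (χ : F →* E)
    (h : IsJet emb N ρ K 0 (fun t => χ (1 + t))) :
    IsJet emb N ρ K 0 (fun t => (χ (1 + t))⁻¹) := by
  obtain ⟨B, hB0, hB⟩ := h.bounded hemb hρ1.le
  have hmul : ∀ t : F, ‖t‖ ≤ ρ → χ (1 + t) * χ (1 + t)⁻¹ = 1 := fun t ht => by
    have h1 := norm_one_add_eq_one (ht.trans_lt hρ1)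
    have h0 : (1 + t) ≠ 0 := norm_ne_zero_iff.mp (by rw [h1]; exact one_ne_zero)
    rw [← map_mul, mul_inv_cancel₀ h0, map_one]
  refine h.inv hemb hρ0 hρ1.le (by simp) (fun t ht => left_ne_zero_of_mul_eq_one (hmul t ht))
    (B := B) fun t ht => ?_
  rw [inv_eq_of_mul_eq_one_right (hmul t ht)]
  obtain ⟨s, hs, hst⟩ := exists_inv_one_add hρ1 ht
  rw [hst]
  exact hB s hs

theorem isJet_emb_one_add [IsUltrametricDist E] (hemb : ∀ (σ : S) (z : F), ‖emb σ z‖ = ‖z‖)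
    (hρ : ρ ≤ 1) {σ : S} (hσ : σ ∈ K) : IsJet emb N ρ K 0 (fun t => emb σ (1 + t)) := by
  refine ((isJet_const hemb hρ 1).add (isJet_monomial hemb hρ 1 (Pi.single σ 1) ?_)).congr
    fun t _ => ?_
  · intro _ τ hτ
    have : τ ≠ σ := fun h => hτ (h ▸ hσ)
    simp [this]
  · rw [mPow_single, map_add, map_one, one_mul, pow_one]

theorem isJet_emb_one_add_pow [IsUltrametricDist E]
    (hemb : ∀ (σ : S) (z : F), ‖emb σ z‖ = ‖z‖) (hρ : ρ ≤ 1) (σ : S) (n : ℕ) :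
    IsJet emb N ρ K (Pi.single σ n) (fun t => emb σ (1 + t) ^ n) := by
  have h : IsJet emb N ρ K (Pi.single σ n)
      (fun t => ∑ k ∈ Finset.range (n + 1), (n.choose k : E) * mPow emb t (Pi.single σ k)) := by
    refine IsJet.sum fun k hk => isJet_monomial hemb hρ _ _ fun _ τ _ => ?_
    have := Finset.mem_range.mp hk
    rcases eq_or_ne τ σ with rfl | hne
    · simp; omega
    · simp [hne]
  refine h.congr fun t _ => ?_
  rw [map_add, map_one, add_comm, add_pow]
  exact Finset.sum_congr rfl fun k _ => by rw [mPow_single]; ring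

theorem exists_norm_le_of_summable {ι : Type*} {f : ι → E} (h : Summable f) :
    ∃ C, 0 ≤ C ∧ ∀ i, ‖f i‖ ≤ C := by
  have h1 : {i | ¬ ‖f i‖ < 1}.Finite := by
    have := h.tendsto_cofinite_zero.norm
    rw [norm_zero] at this
    exact this.eventually (gt_mem_nhds one_pos)
  refine ⟨1 + ∑ i ∈ h1.toFinset, ‖f i‖, by positivity, fun i => ?_⟩
  by_cases hi : ‖f i‖ < 1
  · have : 0 ≤ ∑ i ∈ h1.toFinset, ‖f i‖ := by positivity
    linarith
  · have := Finset.single_le_sum (f := fun i => ‖f i‖) (fun _ _ => norm_nonneg _)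
      (h1.mem_toFinset.mpr hi)
    linarith

theorem isJet_of_hasSum [IsUltrametricDist E] (hemb : ∀ (σ : S) (z : F), ‖emb σ z‖ = ‖z‖)
    {t₀ : F} (ht₀ : t₀ ≠ 0) {J : Set S} (hJK : J ⊆ K) {c : (S → ℕ) → E}
    (hc : ∀ m : S → ℕ, ¬ (∀ σ, σ ∉ J → m σ = 0) → c m = 0)
    (hs : ∀ t : F, ‖t‖ ≤ ‖t₀‖ → HasSum (fun m => c m * mPow emb t m) (u t)) (hρ : ρ ≤ ‖t₀‖) :
    IsJet emb N ρ K 0 u := by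
  have ht₀' : 0 < ‖t₀‖ := norm_pos_iff.mpr ht₀
  obtain ⟨B, hB0, hB⟩ := exists_norm_le_of_summable (hs t₀ le_rfl).summable
  refine ⟨c, B / ‖t₀‖ ^ (N + 1) + ∑ m ∈ degLE S N, ‖c m‖, ?_, fun m hm => ?_, fun t ht => ?_⟩
  · rintro m ⟨σ, hσ, hm⟩
    exact hc m fun h => by
      have := h σ fun h' => hσ (hJK h')
      simp only [Pi.zero_apply] at hm
      omega
  · have h1 := Finset.single_le_sum (f := fun m => ‖c m‖) (fun _ _ => norm_nonneg _) hm
    have h2 : 0 ≤ B / ‖t₀‖ ^ (N + 1) := by positivity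
    linarith
  · have hpart : ∀ s : Finset (S → ℕ), degLE S N ⊆ s →
        ‖∑ m ∈ s, c m * mPow emb t m - ∑ m ∈ degLE S N, c m * mPow emb t m‖ ≤
          B / ‖t₀‖ ^ (N + 1) * ‖t‖ ^ (N + 1) := by
      intro s hs'
      rw [← Finset.sum_sdiff hs', add_sub_cancel_right]
      refine norm_sum_le_of_ultra (by positivity) fun m hm => ?_
      rw [Finset.mem_sdiff, mem_degLE, not_le] at hm
      have h1 := hB m
      rw [norm_mul, norm_mPow hemb] at h1 ⊢
      have h2 : ‖t‖ / ‖t₀‖ ≤ 1 := (div_le_one ht₀').mpr (ht.trans hρ)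
      calc ‖c m‖ * ‖t‖ ^ mSum m = (‖c m‖ * ‖t₀‖ ^ mSum m) * (‖t‖ / ‖t₀‖) ^ mSum m := by
            rw [div_pow]; field_simp
        _ ≤ B * (‖t‖ / ‖t₀‖) ^ (N + 1) :=
            mul_le_mul h1 (pow_le_pow_of_le_one (by positivity) h2 hm.2) (by positivity) hB0
        _ = _ := by rw [div_pow]; ring
    have hlim : ‖u t - ∑ m ∈ degLE S N, c m * mPow emb t m‖ ≤
        B / ‖t₀‖ ^ (N + 1) * ‖t‖ ^ (N + 1) :=
      le_of_tendsto ((hs t (ht.trans hρ)).sub_const _).norm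
        ((eventually_ge_atTop (degLE S N)).mono hpart)
    refine hlim.trans (mul_le_mul_of_nonneg_right ?_ (by positivity))
    have : 0 ≤ ∑ m ∈ degLE S N, ‖c m‖ := by positivity
    linarith

end Jet

/-! ### The automorphy factor -/

theorem dPow_mul (emb : S → (F →+* E)) (J : Set S) (d : S → ℕ) (x y : F) :
    dPow emb J d (x * y) = dPow emb J d x * dPow emb J d y := by
  simp [dPow, mul_pow, Finset.prod_mul_distrib]

theorem monChar_apply (emb : S → (F →+* E)) (T : Set S) (d : S → ℕ) (z : F) :
    monChar emb T d z = ∏ σ ∈ Finset.univ.filter (fun σ => σ ∈ T), (emb σ z) ^ (d σ) := rfl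

/-- The automorphy factor `χ2 χ1⁻¹(z) z^d` of the action. -/
def autoFactor (emb : S → (F →+* E)) (J : Set S) (d : S → ℕ) (χ1 χ2 : F →* E) : F →* E where
  toFun z := chRatio χ1 χ2 z * dPow emb J d z
  map_one' := by simp [chRatio, dPow]
  map_mul' x y := by rw [dPow_mul, chRatio, chRatio, chRatio, map_mul, map_mul]; ring

theorem autoFactor_apply (emb : S → (F →+* E)) (J : Set S) (d : S → ℕ) (χ1 χ2 : F →* E) (z : F) :
    autoFactor emb J d χ1 χ2 z = chRatio χ1 χ2 z * dPow emb J d z := rfl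

theorem IsLocJChar.exists_isJet [IsUltrametricDist E] {emb : S → (F →+* E)}
    (hemb : ∀ (σ : S) (z : F), ‖emb σ z‖ = ‖z‖) {q : ℕ} {ϖ : F} (hϖ0 : ϖ ≠ 0)
    (hϖ : ‖ϖ‖ = (q : ℝ)⁻¹) {J K : Set S} (hJK : J ⊆ K) {χ : F →* E}
    (h : IsLocJChar q emb J χ) :
    ∃ l : ℕ, ∀ (N : ℕ) (ρ : ℝ), ρ ≤ ‖ϖ‖ ^ l → IsJet emb N ρ K 0 (fun t => χ (1 + t)) := by
  obtain ⟨_, l, hl⟩ := h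
  obtain ⟨c, hc, hs⟩ := hl 1 norm_one
  refine ⟨l, fun N ρ hρ => isJet_of_hasSum hemb (pow_ne_zero l hϖ0) hJK hc (fun t ht => ?_)
    (by rwa [norm_pow])⟩
  have := hs (1 + t) (by
    rw [add_sub_cancel_left, zpow_neg, zpow_natCast, ← inv_pow, ← hϖ, ← norm_pow]; exact ht)
  simpa only [add_sub_cancel_left] using this

theorem exists_isJet_autoFactor [IsUltrametricDist F] [IsUltrametricDist E] {emb : S → (F →+* E)}
    (hemb : ∀ (σ : S) (z : F), ‖emb σ z‖ = ‖z‖) {q : ℕ} {ϖ : F} (hϖ0 : ϖ ≠ 0) (hϖ1 : ‖ϖ‖ < 1)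
    (hϖ : ‖ϖ‖ = (q : ℝ)⁻¹) {J J' K : Set S} (hJJ' : J ⊆ J') (hJ'K : J' ⊆ K) (d : S → ℕ)
    {χ1 χ2 : F →* E} (hχ1 : IsLocJChar q emb J χ1) (hχ2 : IsLocJChar q emb J χ2) :
    ∃ ρ : ℝ, 0 < ρ ∧ ρ < 1 ∧ ∀ (N : ℕ) (i : S → ℕ), (∀ σ, σ ∉ K → i σ ≤ d σ) →
      IsJet emb N ρ K (fun σ => d σ - i σ) (fun t =>
        autoFactor emb J' d χ1 (χ2 * monChar emb {σ : S | σ ∈ J' ∧ σ ∉ J} d) (1 + t) *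
          (mPow emb (1 + t) i)⁻¹) := by
  have hJK := hJJ'.trans hJ'K
  obtain ⟨l1, h1⟩ := hχ1.exists_isJet hemb hϖ0 hϖ hJK
  obtain ⟨l2, h2⟩ := hχ2.exists_isJet hemb hϖ0 hϖ hJK
  set ρ : ℝ := ‖ϖ‖ ^ (max l1 l2 + 1) with hρ
  have hϖp : 0 < ‖ϖ‖ := norm_pos_iff.mpr hϖ0
  have hρ0 : 0 < ρ := pow_pos hϖp _
  have hρ1 : ρ < 1 := pow_lt_one₀ hϖp.le hϖ1 (Nat.succ_ne_zero _)
  refine ⟨ρ, hρ0, hρ1, fun N i hi => ?_⟩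
  have hj1 := (h1 N ρ (pow_le_pow_of_le_one hϖp.le hϖ1.le
    ((le_max_left _ _).trans (Nat.le_succ _)))).monoidHom_inv hemb hρ0.le hρ1
  have hj2 := h2 N ρ (pow_le_pow_of_le_one hϖp.le hϖ1.le
    ((le_max_right _ _).trans (Nat.le_succ _)))
  have hw : ∀ σ, IsJet emb N ρ K (Pi.single σ (d σ - i σ)) (fun t =>
      (if σ ∈ J then 1 else emb σ (1 + t) ^ d σ) * (emb σ (1 + t) ^ i σ)⁻¹) := by
    intro σ
    by_cases hσ : σ ∈ K
    · have he := isJet_emb_one_add (N := N) hemb hρ1.le hσ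
      have hinv : IsJet emb N ρ K 0 (fun t => (emb σ (1 + t) ^ i σ)⁻¹) :=
        ((he.monoidHom_inv hemb hρ0.le hρ1 (emb σ : F →* E)).pow hemb hρ1.le (i σ)).congr
          fun t _ => by simp
      have hd : IsJet emb N ρ K 0 (fun t => if σ ∈ J then 1 else emb σ (1 + t) ^ d σ) := by
        split_ifs
        · exact isJet_const hemb hρ1.le 1
        · exact he.pow hemb hρ1.le _
      exact (hd.mul hemb hρ1.le hinv).mono fun _ _ => Nat.zero_le _
    · refine (isJet_emb_one_add_pow hemb hρ1.le σ (d σ - i σ)).congr fun t ht => ?_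
      rw [if_neg fun h => hσ (hJK h)]
      have h0 : emb σ (1 + t) ≠ 0 := norm_ne_zero_iff.mp (by
        rw [hemb, norm_one_add_eq_one (ht.trans_lt hρ1)]; exact one_ne_zero)
      rw [pow_sub₀ _ h0 (hi σ hσ)]
  refine (((hj2.mul hemb hρ1.le hj1).mul hemb hρ1.le
    (IsJet.prod hemb hρ1.le fun σ (_ : σ ∈ Finset.univ) => hw σ)).mono fun τ _ => ?_).congr
      fun t _ => ?_
  · simp [Finset.sum_apply, Finset.sum_pi_single]
  · have hprod : monChar emb {σ : S | σ ∈ J' ∧ σ ∉ J} d (1 + t) * dPow emb J' d (1 + t) =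
        ∏ σ, if σ ∈ J then 1 else emb σ (1 + t) ^ d σ := by
      rw [monChar_apply, dPow, Finset.prod_filter, Finset.prod_filter, ← Finset.prod_mul_distrib]
      refine Finset.prod_congr rfl fun σ _ => ?_
      by_cases h1 : σ ∈ J
      · simp [h1, hJJ' h1]
      · by_cases h2 : σ ∈ J' <;> simp [h1, h2]
    rw [Finset.prod_mul_distrib, ← hprod, Finset.prod_inv_distrib, autoFactor_apply, chRatio,
      MonoidHom.mul_apply, mPow]
    ring

/-! ### Composition with fractional linear maps -/

theorem SmallRem.of_comp {r M B : ℝ} (hr : 0 ≤ r) {e e' : F → F → E} (h : SmallRem r M e)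
    (hB : 0 ≤ B) {φ : F → F} {s : F → F → F}
    (hφ : ∀ x, ‖x‖ ≤ 1 → ‖φ x‖ ≤ 1) (hs : ∀ x y, ‖x‖ ≤ 1 → ‖y‖ ≤ 1 → ‖s x y‖ ≤ ‖y‖)
    (hee : ∀ x y, ‖x‖ ≤ 1 → ‖y‖ ≤ 1 → ‖e' x y‖ ≤ B * ‖e (φ x) (s x y)‖) (hM : 0 ≤ M) :
    SmallRem r (B * M) e' := by
  have hpow : ∀ x y, ‖x‖ ≤ 1 → ‖y‖ ≤ 1 → ‖s x y‖ ^ r ≤ ‖y‖ ^ r := fun x y hx hy =>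
    Real.rpow_le_rpow (norm_nonneg _) (hs x y hx hy) hr
  refine ⟨fun x y hx hy => ?_, fun ε hε => ?_⟩
  · have h1 := h.1 (φ x) (s x y) (hφ x hx) ((hs x y hx hy).trans hy)
    calc ‖e' x y‖ ≤ B * (M * ‖y‖ ^ r) := (hee x y hx hy).trans (mul_le_mul_of_nonneg_left
          (h1.trans (mul_le_mul_of_nonneg_left (hpow x y hx hy) hM)) hB)
      _ = _ := by ring
  · obtain ⟨δ, hδ, H⟩ := h.2 (ε / (B + 1)) (by positivity)
    refine ⟨δ, hδ, fun x y hx hy hyδ => ?_⟩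
    have hsy := hs x y hx hy
    have h1 := H (φ x) (s x y) (hφ x hx) (hsy.trans hy) (hsy.trans hyδ)
    calc ‖e' x y‖ ≤ (B + 1) * (ε / (B + 1) * ‖y‖ ^ r) := (hee x y hx hy).trans
          (mul_le_mul (by linarith) (h1.trans (mul_le_mul_of_nonneg_left (hpow x y hx hy)
            (by positivity))) (norm_nonneg _) (by positivity))
      _ = _ := by field_simp

/-- An expansion over an arbitrary finite family of monomials yields Taylor coefficients. -/
theorem TaylorIn.of_family [IsUltrametricDist E] {emb : S → (F →+* E)}
    (hemb : ∀ (σ : S) (z : F), ‖emb σ z‖ = ‖z‖) {r M : ℝ} {K : Set S} {d : S → ℕ} {f : F → E}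
    {ι : Type*} (P : Finset ι) (k : ι → S → ℕ) (A : ι → F → E) (hM : 0 ≤ M)
    (hA : ∀ p ∈ P, ∀ x, ‖x‖ ≤ 1 → ‖A p x‖ ≤ M)
    (hsupp : ∀ p ∈ P, (∃ σ, σ ∉ K ∧ d σ < k p σ) → ∀ x, ‖x‖ ≤ 1 → A p x = 0)
    (hrem : SmallRem r M (fun x y => f (x + y) - ∑ p ∈ P, A p x * mPow emb y (k p))) :
    TaylorIn emb r K d f M := by
  refine ⟨fun j x => ∑ p ∈ P.filter (fun p => k p = j), A p x, fun j hj x hx => ?_,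
    fun j _ x hx => ?_, ?_⟩
  · refine Finset.sum_eq_zero fun p hp => ?_
    rw [Finset.mem_filter] at hp
    exact hsupp p hp.1 (by rw [hp.2]; exact hj) x hx
  · exact norm_sum_le_of_ultra hM fun p hp => hA p (Finset.mem_filter.mp hp).1 x hx
  · have hhigh : SmallRem r M (fun x y =>
        ∑ p ∈ P.filter (fun p => k p ∉ degLE S ⌊r⌋₊), A p x * mPow emb y (k p)) := by
      refine SmallRem.of_pow (n := ⌊r⌋₊ + 1) (by exact_mod_cast Nat.lt_floor_add_one r) hM
        (fun x y hx hy => ?_) (Nat.succ_ne_zero _)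
      refine norm_sum_le_of_ultra (by positivity) fun p hp => ?_
      rw [Finset.mem_filter, mem_degLE, not_le] at hp
      rw [norm_mul, norm_mPow hemb]
      exact mul_le_mul (hA p hp.1 x hx) (pow_le_pow_of_le_one (norm_nonneg _) hy hp.2)
        (by positivity) hM
    refine (hrem.add hhigh).congr fun x y _ _ => ?_
    have hsplit : ∑ p ∈ P, A p x * mPow emb y (k p) =
        ∑ j ∈ degLE S ⌊r⌋₊, (∑ p ∈ P.filter (fun p => k p = j), A p x) * mPow emb y j +
        ∑ p ∈ P.filter (fun p => k p ∉ degLE S ⌊r⌋₊), A p x * mPow emb y (k p) := by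
      rw [← Finset.sum_filter_add_sum_filter_not P (fun p => k p ∈ degLE S ⌊r⌋₊)]
      congr 1
      rw [← Finset.sum_fiberwise_of_maps_to (g := k) (t := degLE S ⌊r⌋₊)
        fun p hp => (Finset.mem_filter.mp hp).2]
      refine Finset.sum_congr rfl fun j hj => ?_
      rw [Finset.sum_mul, Finset.filter_filter]
      refine Finset.sum_congr (Finset.filter_congr fun p _ => ⟨fun h => h.2, fun h =>
        ⟨by rw [h]; exact hj, h⟩⟩) fun p hp => ?_
      rw [(Finset.mem_filter.mp hp).2]
    unfold tayRem
    rw [hsplit]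
    ring

theorem TaylorIn.comp_moebius [IsUltrametricDist F] [IsUltrametricDist E] {emb : S → (F →+* E)}
    (hemb : ∀ (σ : S) (z : F), ‖emb σ z‖ = ‖z‖) {r ρ : ℝ} (hr : 0 ≤ r) (hρ1 : ρ < 1)
    {K : Set S} {d : S → ℕ} {θ : F →* E}
    (hθ : ∀ i : S → ℕ, (∀ σ, σ ∉ K → i σ ≤ d σ) → IsJet emb ⌊r⌋₊ ρ K (fun σ => d σ - i σ)
      (fun t => θ (1 + t) * (mPow emb (1 + t) i)⁻¹)) :
    ∃ W : ℝ, 0 ≤ W ∧ ∀ α β γ : F, ‖α‖ ≤ 1 → ‖β‖ ≤ 1 → ‖γ‖ ≤ ρ → ∀ (f : F → E) (M : ℝ),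
      TaylorIn emb r K d f M →
      TaylorIn emb r K d (fun z => θ (1 + γ * z) * f ((α * z + β) / (1 + γ * z))) (W * M) := by
  have hθ0 : IsJet emb ⌊r⌋₊ ρ K (fun σ => d σ - 0) (fun t => θ (1 + t)) :=
    (hθ 0 fun _ _ => Nat.zero_le _).congr fun t _ => by simp [mPow_index_zero]
  obtain ⟨B, hB0, hB⟩ := hθ0.bounded hemb hρ1.le
  have hθ' : ∀ i : S → ℕ, ∃ (b : (S → ℕ) → E) (C : ℝ), (∀ σ, σ ∉ K → i σ ≤ d σ) →
      (∀ m : S → ℕ, (∃ σ, σ ∉ K ∧ d σ - i σ < m σ) → b m = 0) ∧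
      (∀ m ∈ degLE S ⌊r⌋₊, ‖b m‖ ≤ C) ∧
      ∀ t : F, ‖t‖ ≤ ρ → ‖θ (1 + t) * (mPow emb (1 + t) i)⁻¹ -
        ∑ m ∈ degLE S ⌊r⌋₊, b m * mPow emb t m‖ ≤ C * ‖t‖ ^ (⌊r⌋₊ + 1) := by
    intro i
    by_cases hi : ∀ σ, σ ∉ K → i σ ≤ d σ
    · obtain ⟨b, C, h⟩ := hθ i hi
      exact ⟨b, C, fun _ => h⟩
    · exact ⟨fun _ => 0, 0, fun h => absurd h hi⟩
  choose b C hbC using hθ'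
  set V : ℝ := B + ∑ i ∈ degLE S ⌊r⌋₊, |C i| with hV
  have hBV : B ≤ V := le_add_of_nonneg_right (by positivity)
  have hV0 : 0 ≤ V := hB0.trans hBV
  have hCV : ∀ i ∈ degLE S ⌊r⌋₊, C i ≤ V := fun i hi =>
    (le_abs_self _).trans ((Finset.single_le_sum (f := fun i => |C i|) (fun _ _ => abs_nonneg _)
      hi).trans (le_add_of_nonneg_left hB0))
  refine ⟨V * V, by positivity, fun α β γ hα hβ hγ f M hf => ?_⟩
  have hM := hf.nonneg
  obtain ⟨c, hc, hT⟩ := hf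
  have hρ0 : 0 ≤ ρ := (norm_nonneg _).trans hγ
  have hγx : ∀ x : F, ‖x‖ ≤ 1 → ‖γ * x‖ ≤ ρ := fun x hx => by
    rw [norm_mul]
    exact (mul_le_of_le_one_right (norm_nonneg _) hx).trans hγ
  have hu : ∀ x : F, ‖x‖ ≤ 1 → ‖1 + γ * x‖ = 1 := fun x hx =>
    norm_one_add_eq_one ((hγx x hx).trans_lt hρ1)
  have hu0 : ∀ x : F, ‖x‖ ≤ 1 → 1 + γ * x ≠ 0 := fun x hx =>
    norm_ne_zero_iff.mp (by rw [hu x hx]; exact one_ne_zero)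
  have hαx : ∀ x : F, ‖x‖ ≤ 1 → ‖α * x‖ ≤ 1 := fun x hx => by
    rw [norm_mul]; exact mul_le_one₀ hα (norm_nonneg _) hx
  set φ : F → F := fun x => (α * x + β) / (1 + γ * x) with hφ_def
  have hφ : ∀ x : F, ‖x‖ ≤ 1 → ‖φ x‖ ≤ 1 := fun x hx => by
    rw [hφ_def, norm_div, hu x hx, div_one]
    exact ball_add (hαx x hx) hβ
  set Δ : F := α - β * γ with hΔ
  have hΔ1 : ‖Δ‖ ≤ 1 := by
    rw [hΔ, sub_eq_add_neg]
    refine ball_add hα ?_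
    rw [norm_neg, norm_mul]
    exact mul_le_one₀ hβ (norm_nonneg _) (hγ.trans hρ1.le)
  set s : F → F → F := fun x y => Δ * y / ((1 + γ * x) * (1 + γ * (x + y))) with hs_def
  have hs : ∀ x y : F, ‖x‖ ≤ 1 → ‖y‖ ≤ 1 → ‖s x y‖ ≤ ‖y‖ := fun x y hx hy => by
    rw [hs_def, norm_div, norm_mul, norm_mul, hu x hx, hu _ (ball_add hx hy), one_mul, div_one]
    exact mul_le_of_le_one_left (norm_nonneg _) hΔ1
  have hφs : ∀ x y : F, ‖x‖ ≤ 1 → ‖y‖ ≤ 1 → φ (x + y) = φ x + s x y := fun x y hx hy => by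
    have h1 := hu0 x hx
    have h2 := hu0 _ (ball_add hx hy)
    simp only [hφ_def, hs_def, hΔ]
    rw [div_add_div _ _ h1 (mul_ne_zero h1 h2), div_eq_div_iff h2 (mul_ne_zero h1
      (mul_ne_zero h1 h2))]
    ring
  set τ : F → F → F := fun x y => γ * y / (1 + γ * x) with hτ_def
  have hτ : ∀ x y : F, ‖x‖ ≤ 1 → ‖τ x y‖ ≤ ρ * ‖y‖ := fun x y hx => by
    rw [hτ_def, norm_div, hu x hx, div_one, norm_mul]
    exact mul_le_mul_of_nonneg_right hγ (norm_nonneg _)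
  have hτρ : ∀ x y : F, ‖x‖ ≤ 1 → ‖y‖ ≤ 1 → ‖τ x y‖ ≤ ρ := fun x y hx hy =>
    (hτ x y hx).trans (mul_le_of_le_one_right hρ0 hy)
  have hτy : ∀ x y : F, ‖x‖ ≤ 1 → ‖τ x y‖ ≤ ‖y‖ := fun x y hx =>
    (hτ x y hx).trans (mul_le_of_le_one_left (norm_nonneg _) hρ1.le)
  have huτ : ∀ x y : F, ‖x‖ ≤ 1 → 1 + γ * (x + y) = (1 + γ * x) * (1 + τ x y) := fun x y hx => by
    have h1 := hu0 x hx
    simp only [hτ_def]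
    field_simp
    ring
  set D : F → F := fun x => Δ / (1 + γ * x) ^ 2 with hD_def
  have hD : ∀ x : F, ‖x‖ ≤ 1 → ‖D x‖ ≤ 1 := fun x hx => by
    rw [hD_def, norm_div, norm_pow, hu x hx, one_pow, div_one]; exact hΔ1
  have hsD : ∀ x y : F, ‖x‖ ≤ 1 → ‖y‖ ≤ 1 → s x y = D x * y * (1 + τ x y)⁻¹ := fun x y hx hy => by
    have h1 := hu0 x hx
    have h2 := hu0 _ (ball_add hx hy)
    have h3 := huτ x y hx
    have h4 : 1 + τ x y ≠ 0 := right_ne_zero_of_mul (h3 ▸ h2)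
    simp only [hs_def, hD_def]
    rw [h3]
    field_simp
  have hγu : ∀ x : F, ‖x‖ ≤ 1 → ‖γ / (1 + γ * x)‖ ≤ 1 := fun x hx => by
    rw [norm_div, hu x hx, div_one]; exact hγ.trans hρ1.le
  set G := (degLE S ⌊r⌋₊).filter (fun i => ∀ σ, σ ∉ K → i σ ≤ d σ) with hG
  have hG1 : ∀ i ∈ G, i ∈ degLE S ⌊r⌋₊ := fun i hi => (Finset.mem_filter.mp hi).1
  have hG2 : ∀ i ∈ G, ∀ σ, σ ∉ K → i σ ≤ d σ := fun i hi => (Finset.mem_filter.mp hi).2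
  have hθu : ∀ x : F, ‖x‖ ≤ 1 → ‖θ (1 + γ * x)‖ ≤ V := fun x hx => (hB _ (hγx x hx)).trans hBV
  set a : (S → ℕ) → F → E := fun i x => c i (φ x) * θ (1 + γ * x) * mPow emb (D x) i with ha_def
  have ha : ∀ i ∈ G, ∀ x, ‖x‖ ≤ 1 → ‖a i x‖ ≤ M * V := fun i hi x hx => by
    rw [ha_def, norm_mul, norm_mul]
    refine (mul_le_of_le_one_right (by positivity) (norm_mPow_le_one hemb (hD x hx) i)).trans ?_
    exact mul_le_mul (hT.1 i (mem_degLE.mp (hG1 i hi)) _ (hφ x hx)) (hθu x hx) (norm_nonneg _) hM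
  refine TaylorIn.of_family hemb (G ×ˢ degLE S ⌊r⌋₊) (fun p => p.1 + p.2)
    (fun p x => a p.1 x * (b p.1 p.2 * mPow emb (γ / (1 + γ * x)) p.2)) (by positivity)
    (fun p hp x hx => ?_) (fun p hp hk x hx => ?_) ?_
  · rw [Finset.mem_product] at hp
    have h1 := ha p.1 hp.1 x hx
    have h2 : ‖b p.1 p.2 * mPow emb (γ / (1 + γ * x)) p.2‖ ≤ V := by
      rw [norm_mul]
      exact (mul_le_of_le_one_right (norm_nonneg _) (norm_mPow_le_one hemb (hγu x hx) _)).trans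
        (((hbC p.1 (hG2 p.1 hp.1)).2.1 p.2 hp.2).trans (hCV p.1 (hG1 p.1 hp.1)))
    rw [norm_mul]
    calc _ ≤ (M * V) * V := mul_le_mul h1 h2 (norm_nonneg _) (by positivity)
      _ = _ := by ring
  · rw [Finset.mem_product] at hp
    obtain ⟨σ, hσ, hlt⟩ := hk
    have h1 := hG2 p.1 hp.1 σ hσ
    rw [(hbC p.1 (hG2 p.1 hp.1)).1 p.2 ⟨σ, hσ, by simp only [Pi.add_apply] at hlt; omega⟩]
    simp
  · have hR1 : SmallRem r (V * V * M) (fun x y =>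
        θ (1 + γ * x) * θ (1 + τ x y) * tayRem emb ⌊r⌋₊ f c (φ x) (s x y)) := by
      refine hT.2.of_comp hr (by positivity) hφ hs (fun x y hx hy => ?_) hM
      rw [norm_mul, norm_mul]
      refine mul_le_mul_of_nonneg_right ?_ (norm_nonneg _)
      exact mul_le_mul (hθu x hx) ((hB _ (hτρ x y hx hy)).trans hBV) (norm_nonneg _) hV0
    have hR2 : SmallRem r (V * V * M) (fun x y => ∑ i ∈ G, a i x * mPow emb y i *
        (θ (1 + τ x y) * (mPow emb (1 + τ x y) i)⁻¹ -
          ∑ m ∈ degLE S ⌊r⌋₊, b i m * mPow emb (τ x y) m)) := by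
      refine SmallRem.of_pow (n := ⌊r⌋₊ + 1) (by exact_mod_cast Nat.lt_floor_add_one r)
        (by positivity) (fun x y hx hy => ?_) (Nat.succ_ne_zero _)
      refine norm_sum_le_of_ultra (by positivity) fun i hi => ?_
      rw [norm_mul, norm_mul]
      have h1 := (hbC i (hG2 i hi)).2.2 (τ x y) (hτρ x y hx hy)
      have h2 : ‖τ x y‖ ^ (⌊r⌋₊ + 1) ≤ ‖y‖ ^ (⌊r⌋₊ + 1) :=
        pow_le_pow_left₀ (norm_nonneg _) (hτy x y hx) _
      have h3 := h1.trans (mul_le_mul (hCV i (hG1 i hi)) h2 (by positivity) hV0)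
      have h4 : ‖a i x‖ * ‖mPow emb y i‖ ≤ M * V :=
        (mul_le_of_le_one_right (norm_nonneg _) (norm_mPow_le_one hemb hy i)).trans (ha i hi x hx)
      calc _ ≤ (M * V) * (V * ‖y‖ ^ (⌊r⌋₊ + 1)) :=
            mul_le_mul h4 h3 (norm_nonneg _) (by positivity)
        _ = _ := by ring
    refine (hR1.add hR2).congr fun x y hx hy => ?_
    have hf : f (φ x + s x y) = tayRem emb ⌊r⌋₊ f c (φ x) (s x y) +
        ∑ i ∈ G, c i (φ x) * mPow emb (s x y) i := by
      rw [hG, Finset.sum_filter_of_ne]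
      · unfold tayRem; ring
      · intro i hi hne σ hσ
        by_contra hlt
        exact hne (by rw [hc i ⟨σ, hσ, not_le.mp hlt⟩ _ (hφ x hx), zero_mul])
    have hF : θ (1 + γ * (x + y)) * f ((α * (x + y) + β) / (1 + γ * (x + y))) =
        θ (1 + γ * x) * θ (1 + τ x y) * f (φ x + s x y) := by
      rw [← hφs x y hx hy, huτ x y hx, map_mul, ← huτ x y hx]
    rw [hF, hf, Finset.sum_product, mul_add, add_sub_assoc, Finset.mul_sum,
      ← Finset.sum_sub_distrib]
    congr 1
    refine Finset.sum_congr rfl fun i hi => ?_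
    rw [mul_sub, hsD x y hx hy, mPow_mul, mPow_mul, mPow_inv, Finset.mul_sum]
    congr 1
    · simp only [ha_def]; ring
    · refine Finset.sum_congr rfl fun m _ => ?_
      have hτm : mPow emb (τ x y) m = mPow emb (γ / (1 + γ * x)) m * mPow emb y m := by
        rw [← mPow_mul]
        congr 1
        simp only [hτ_def]
        ring
      rw [hτm, mPow_add]
      ring

/-! ### Gluing along a finite cover -/

theorem exists_finset_cover [IsUltrametricDist F] {q : ℕ} (hq : 1 < q)
    (hres : ∀ (a : F) (n : ℤ), ∃ R : Finset F, R.card = q ∧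
      (∀ x ∈ R, ‖x - a‖ ≤ (q : ℝ) ^ (-n)) ∧
      ∀ z : F, ‖z - a‖ ≤ (q : ℝ) ^ (-n) → ∃! x, x ∈ R ∧ ‖z - x‖ ≤ (q : ℝ) ^ (-(n + 1)))
    (n : ℕ) : ∃ R : Finset F, (∀ a ∈ R, ‖a‖ ≤ 1) ∧
      ∀ z : F, ‖z‖ ≤ 1 → ∃ a ∈ R, ‖z - a‖ ≤ (q : ℝ)⁻¹ ^ n := by
  have hqn : ∀ n : ℕ, (q : ℝ) ^ (-(n : ℤ)) = (q : ℝ)⁻¹ ^ n := fun n => by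
    rw [zpow_neg, zpow_natCast, inv_pow]
  induction n with
  | zero => exact ⟨{0}, by simp, fun z hz => ⟨0, by simp, by simpa using hz⟩⟩
  | succ n ih =>
    obtain ⟨R, hR1, hR2⟩ := ih
    choose T _ hT2 hT3 using fun a : F => hres a n
    refine ⟨R.biUnion T, fun x hx => ?_, fun z hz => ?_⟩
    · obtain ⟨a, ha, hxa⟩ := Finset.mem_biUnion.mp hx
      have h1 := hT2 a x hxa
      rw [hqn] at h1
      have hq1 : (q : ℝ)⁻¹ ≤ 1 := inv_le_one_of_one_le₀ (by exact_mod_cast hq.le)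
      have h2 := ball_add (h1.trans (pow_le_one₀ (by positivity) hq1)) (hR1 a ha)
      rwa [sub_add_cancel] at h2
    · obtain ⟨a, ha, hza⟩ := hR2 z hz
      obtain ⟨x, ⟨hx, hzx⟩, _⟩ := hT3 a z (by rw [hqn]; exact hza)
      refine ⟨x, Finset.mem_biUnion.mpr ⟨a, ha, hx⟩, ?_⟩
      rwa [← hqn, Nat.cast_succ]

theorem TaylorIn.glue [IsUltrametricDist F] [IsUltrametricDist E] {emb : S → (F →+* E)}
    (hemb : ∀ (σ : S) (z : F), ‖emb σ z‖ = ‖z‖) {r M : ℝ} (hr : 0 ≤ r) (hM : 0 ≤ M) {K : Set S}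
    {d : S → ℕ} {f : F → E} {l : F} (hl0 : l ≠ 0) (hl1 : ‖l‖ ≤ 1) {R : Finset F}
    (hR : ∀ z : F, ‖z‖ ≤ 1 → ∃ a ∈ R, ‖z - a‖ ≤ ‖l‖)
    (h : ∀ a ∈ R, TaylorIn emb r K d (fun z => f (a + l * z)) M) :
    TaylorIn emb r K d f (M * (‖l‖⁻¹ ^ (⌊r⌋₊ + 1) * ‖l‖⁻¹ ^ (⌊r⌋₊ + 1))) := by
  have hlp : 0 < ‖l‖ := norm_pos_iff.mpr hl0
  have hl' : 1 ≤ ‖l‖⁻¹ := (one_le_inv₀ hlp).mpr hl1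
  set L : ℝ := ‖l‖⁻¹ ^ (⌊r⌋₊ + 1) with hL
  have hL1 : 1 ≤ L := one_le_pow₀ hl'
  have hLr : ‖l‖⁻¹ ^ r ≤ L := by
    rw [hL, ← Real.rpow_natCast]
    exact Real.rpow_le_rpow_of_exponent_le hl' (by exact_mod_cast (Nat.lt_floor_add_one r).le)
  have hMLL : M * L ≤ M * (L * L) :=
    mul_le_mul_of_nonneg_left (le_mul_of_one_le_left (by positivity) hL1) hM
  have hML : M ≤ M * L := le_mul_of_one_le_right hM hL1
  have hex : ∀ z : F, ∃ a : F, ‖z‖ ≤ 1 → a ∈ R ∧ ‖z - a‖ ≤ ‖l‖ := fun z => by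
    by_cases hz : ‖z‖ ≤ 1
    · obtain ⟨a, ha, hza⟩ := hR z hz
      exact ⟨a, fun _ => ⟨ha, hza⟩⟩
    · exact ⟨0, fun h => absurd h hz⟩
  choose A hA using hex
  have hex' : ∀ a : F, ∃ c : (S → ℕ) → F → E, a ∈ R →
      SuppIn K d c ∧ HasTaylor emb r (fun z => f (a + l * z)) c M := fun a => by
    by_cases ha : a ∈ R
    · obtain ⟨c, hc⟩ := h a ha
      exact ⟨c, fun _ => hc⟩
    · exact ⟨fun _ _ => 0, fun h => absurd h ha⟩
  choose c hc using hex'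
  set w : F → F := fun x => (x - A x) / l with hw_def
  have hw : ∀ x : F, ‖x‖ ≤ 1 → ‖w x‖ ≤ 1 := fun x hx => by
    rw [hw_def, norm_div]
    exact (div_le_one hlp).mpr (hA x hx).2
  have hwx : ∀ x, A x + l * w x = x := fun x => by
    simp only [hw_def]
    field_simp
    ring
  set C : (S → ℕ) → F → E := fun i x => c (A x) i (w x) * mPow emb l⁻¹ i with hC_def
  have hC : ∀ i : S → ℕ, mSum i ≤ ⌊r⌋₊ → ∀ x : F, ‖x‖ ≤ 1 → ‖C i x‖ ≤ M * L := fun i hi x hx => by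
    rw [hC_def, norm_mul, norm_mPow hemb, norm_inv]
    exact mul_le_mul ((hc _ (hA x hx).1).2.1 i hi _ (hw x hx))
      (pow_le_pow_right₀ hl' (hi.trans (Nat.le_succ _))) (by positivity) hM
  have hfb : ∀ x : F, ‖x‖ ≤ 1 → ‖f x‖ ≤ M := fun x hx => by
    have h1 := (hc _ (hA x hx).1).2.norm_le (hw x hx)
    simp only [hwx] at h1
    exact h1
  have hsmall : ∀ x y : F, ‖x‖ ≤ 1 → tayRem emb ⌊r⌋₊ f C x y =
      tayRem emb ⌊r⌋₊ (fun z => f (A x + l * z)) (c (A x)) (w x) (y / l) := fun x y hx => by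
    have h1 : A x + l * (w x + y / l) = x + y := by
      rw [mul_add, ← add_assoc, hwx, mul_div_cancel₀ _ hl0]
    unfold tayRem
    beta_reduce
    rw [h1]
    congr 1
    refine Finset.sum_congr rfl fun i _ => ?_
    rw [div_eq_mul_inv, mPow_mul, hC_def]
    ring
  have hyl : ∀ y : F, ‖y / l‖ ^ r = ‖l‖⁻¹ ^ r * ‖y‖ ^ r := fun y => by
    rw [norm_div, div_eq_mul_inv, mul_comm, Real.mul_rpow (by positivity) (norm_nonneg _)]
  refine ⟨C, fun i hi x hx => ?_, fun i hi x hx => (hC i hi x hx).trans hMLL,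
    fun x y hx hy => ?_, fun ε hε => ?_⟩
  · simp only [hC_def]
    rw [(hc _ (hA x hx).1).1 i hi _ (hw x hx), zero_mul]
  · rcases le_total ‖y‖ ‖l‖ with h1 | h1
    · rw [hsmall x y hx]
      refine ((hc _ (hA x hx).1).2.2.1 (w x) (y / l) (hw x hx) (by
        rw [norm_div]; exact (div_le_one hlp).mpr h1)).trans ?_
      rw [hyl, ← mul_assoc]
      exact mul_le_mul_of_nonneg_right ((mul_le_mul_of_nonneg_left hLr hM).trans hMLL)
        (Real.rpow_nonneg (norm_nonneg _) _)
    · have h2 : ‖tayRem emb ⌊r⌋₊ f C x y‖ ≤ M * L := by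
        unfold tayRem
        rw [sub_eq_add_neg]
        refine ball_add ((hfb _ (ball_add hx hy)).trans hML) ?_
        rw [norm_neg]
        refine norm_sum_le_of_ultra (by positivity) fun i hi => ?_
        rw [norm_mul]
        exact (mul_le_of_le_one_right (norm_nonneg _) (norm_mPow_le_one hemb hy i)).trans
          (hC i (mem_degLE.mp hi) x hx)
      refine h2.trans ?_
      have h3 : 1 ≤ L * ‖y‖ ^ r := by
        calc (1 : ℝ) = ‖l‖⁻¹ ^ r * ‖l‖ ^ r := by
              rw [← Real.mul_rpow (by positivity) (by positivity), inv_mul_cancel₀ hlp.ne',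
                Real.one_rpow]
          _ ≤ L * ‖y‖ ^ r := mul_le_mul hLr (Real.rpow_le_rpow hlp.le h1 hr) (by positivity)
              (by positivity)
      calc M * L ≤ M * L * (L * ‖y‖ ^ r) := le_mul_of_one_le_right (by positivity) h3
        _ = _ := by ring
  · have hev : ∀ a ∈ R, ∀ᶠ δ : ℝ in 𝓝[>] 0, ∀ x y : F, ‖x‖ ≤ 1 → ‖y‖ ≤ 1 → ‖y‖ ≤ δ →
        ‖tayRem emb ⌊r⌋₊ (fun z => f (a + l * z)) (c a) x y‖ ≤ ε / L * ‖y‖ ^ r := by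
      intro a ha
      obtain ⟨δ, hδ, H⟩ := (hc a ha).2.2.2 (ε / L) (by positivity)
      filter_upwards [Ioc_mem_nhdsGT hδ] with η hη x y hx hy hyη
      exact H x y hx hy (hyη.trans hη.2)
    obtain ⟨δ, H, hδ⟩ := (((Finset.eventually_all R).mpr hev).and self_mem_nhdsWithin).exists
    have hδ0 : 0 < δ := hδ
    refine ⟨min 1 δ * ‖l‖, by positivity, fun x y hx hy hyδ => ?_⟩
    have h1 : ‖y / l‖ ≤ min 1 δ := by rwa [norm_div, div_le_iff₀ hlp]
    rw [hsmall x y hx]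
    refine (H _ (hA x hx).1 _ _ (hw x hx) (h1.trans (min_le_left _ _))
      (h1.trans (min_le_right _ _))).trans ?_
    rw [hyl, ← mul_assoc]
    refine mul_le_mul_of_nonneg_right ?_ (Real.rpow_nonneg (norm_nonneg _) _)
    calc ε / L * ‖l‖⁻¹ ^ r ≤ ε / L * L := mul_le_mul_of_nonneg_left hLr (by positivity)
      _ = ε := by field_simp

/-! ### Homogeneous functions on the plane -/

/-- `Φ` is homogeneous of character `θ`. -/
def IsHomog (θ : F →* E) (Φ : F → F → E) : Prop :=
  ∀ l x y : F, l ≠ 0 → Φ (l * x) (l * y) = θ l * Φ x y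

theorem norm_le_or_le_of_norm_eq_zpow {q : ℕ} (hq : 1 < q)
    (hval : ∀ x : F, x ≠ 0 → ∃ n : ℤ, ‖x‖ = (q : ℝ) ^ n) {ϖ : F} (hϖ : ‖ϖ‖ = (q : ℝ)⁻¹)
    (X Y : F) : ‖X‖ ≤ ‖ϖ‖ * ‖Y‖ ∨ ‖Y‖ ≤ ‖X‖ := by
  have hq1 : (1 : ℝ) < q := by exact_mod_cast hq
  rcases eq_or_ne X 0 with rfl | hX
  · left
    rw [norm_zero]
    positivity
  rcases eq_or_ne Y 0 with rfl | hY
  · right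
    rw [norm_zero]
    positivity
  obtain ⟨m, hm⟩ := hval X hX
  obtain ⟨k, hk⟩ := hval Y hY
  rw [hm, hk, hϖ]
  rcases lt_or_ge m k with h | h
  · left
    rw [← zpow_neg_one, ← zpow_add₀ (by positivity)]
    exact zpow_le_zpow_right₀ hq1.le (by omega)
  · right
    exact zpow_le_zpow_right₀ hq1.le h

theorem IsHomog.exists_taylorIn_linear [IsUltrametricDist F] [IsUltrametricDist E]
    {q : ℕ} (hq : 1 < q) {ϖ : F} (hϖ : ‖ϖ‖ = (q : ℝ)⁻¹)
    (hval : ∀ x : F, x ≠ 0 → ∃ n : ℤ, ‖x‖ = (q : ℝ) ^ n)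
    (hres : ∀ (a : F) (n : ℤ), ∃ R : Finset F, R.card = q ∧
      (∀ x ∈ R, ‖x - a‖ ≤ (q : ℝ) ^ (-n)) ∧
      ∀ z : F, ‖z - a‖ ≤ (q : ℝ) ^ (-n) → ∃! x, x ∈ R ∧ ‖z - x‖ ≤ (q : ℝ) ^ (-(n + 1)))
    {emb : S → (F →+* E)} (hemb : ∀ (σ : S) (z : F), ‖emb σ z‖ = ‖z‖) {r ρ : ℝ} (hr : 0 ≤ r)
    (hρ0 : 0 < ρ) (hρ1 : ρ < 1) {K : Set S} {d : S → ℕ} {θ : F →* E}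
    (hθ : ∀ i : S → ℕ, (∀ σ, σ ∉ K → i σ ≤ d σ) → IsJet emb ⌊r⌋₊ ρ K (fun σ => d σ - i σ)
      (fun t => θ (1 + t) * (mPow emb (1 + t) i)⁻¹))
    {α β γ δ : F} (hD : α * δ - β * γ ≠ 0) :
    ∃ C : ℝ, 0 ≤ C ∧ ∀ Φ : F → F → E, IsHomog θ Φ → ∀ M : ℝ,
      TaylorIn emb r K d (fun z => Φ (ϖ * z) 1) M → TaylorIn emb r K d (fun z => Φ 1 z) M →
      TaylorIn emb r K d (fun z => Φ (α * z + β) (γ * z + δ)) (C * M) := by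
  have hq1 : (1 : ℝ) < q := by exact_mod_cast hq
  have hϖp : 0 < ‖ϖ‖ := by rw [hϖ]; positivity
  have hϖ1 : ‖ϖ‖ < 1 := by rw [hϖ]; exact inv_lt_one_of_one_lt₀ hq1
  have hϖ0 : ϖ ≠ 0 := norm_pos_iff.mp hϖp
  obtain ⟨W, hW0, hW⟩ := TaylorIn.comp_moebius hemb hr hρ1 hθ
  have hfac : ∀ {x : F}, x ≠ 0 → ∀ {v z : F}, ‖v‖ ≤ ρ * ‖x‖ → ‖z‖ ≤ 1 → 1 + v / x * z ≠ 0 := by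
    intro x hx v z hv hz
    have h1 : ‖v / x * z‖ < 1 := by
      rw [norm_mul, norm_div]
      refine (mul_le_of_le_one_right (by positivity) hz).trans_lt (lt_of_le_of_lt ?_ hρ1)
      rwa [div_le_iff₀ (norm_pos_iff.mpr hx)]
    have h2 := norm_one_add_eq_one h1
    intro h3
    rw [h3, norm_zero] at h2
    exact zero_ne_one h2
  have hA : ∀ {Φ : F → F → E}, IsHomog θ Φ → ∀ {M : ℝ},
      TaylorIn emb r K d (fun z => Φ (ϖ * z) 1) M → ∀ {X Y u v : F}, Y ≠ 0 →
      ‖X‖ ≤ ‖ϖ‖ * ‖Y‖ → ‖u‖ ≤ ‖ϖ‖ * ‖Y‖ → ‖v‖ ≤ ρ * ‖Y‖ →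
      TaylorIn emb r K d (fun z => Φ (X + u * z) (Y + v * z)) (‖θ Y‖ * (W * M)) := by
    intro Φ hΦ M hM X Y u v hY hX hu hv
    have hYp := norm_pos_iff.mpr hY
    refine ((hW (ϖ⁻¹ * u / Y) (ϖ⁻¹ * X / Y) (v / Y) ?_ ?_ ?_ _ M hM).const_mul (θ Y)).congr
      fun z hz => ?_
    · rw [norm_div, norm_mul, norm_inv, div_le_one hYp, inv_mul_le_iff₀ hϖp]
      exact hu
    · rw [norm_div, norm_mul, norm_inv, div_le_one hYp, inv_mul_le_iff₀ hϖp]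
      exact hX
    · rw [norm_div, div_le_iff₀ hYp]
      exact hv
    · have h1 := hfac hY hv hz
      rw [← hΦ _ _ _ h1, ← hΦ _ _ _ hY]
      congr 1
      · generalize 1 + v / Y * z = m at h1 ⊢
        field_simp
        ring
      · field_simp
  have hB : ∀ {Φ : F → F → E}, IsHomog θ Φ → ∀ {M : ℝ},
      TaylorIn emb r K d (fun z => Φ 1 z) M → ∀ {X Y u v : F}, X ≠ 0 →
      ‖Y‖ ≤ ‖X‖ → ‖v‖ ≤ ‖X‖ → ‖u‖ ≤ ρ * ‖X‖ →
      TaylorIn emb r K d (fun z => Φ (X + u * z) (Y + v * z)) (‖θ X‖ * (W * M)) := by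
    intro Φ hΦ M hM X Y u v hX hY hv hu
    have hXp := norm_pos_iff.mpr hX
    refine ((hW (v / X) (Y / X) (u / X) ?_ ?_ ?_ _ M hM).const_mul (θ X)).congr
      fun z hz => ?_
    · rw [norm_div, div_le_one hXp]
      exact hv
    · rw [norm_div, div_le_one hXp]
      exact hY
    · rw [norm_div, div_le_iff₀ hXp]
      exact hu
    · have h1 := hfac hX hu hz
      rw [← hΦ _ _ _ h1, ← hΦ _ _ _ hX]
      congr 1
      · field_simp
      · generalize 1 + u / X * z = m at h1 ⊢
        field_simp
        ring
  set B : ℝ := max ‖α‖ ‖γ‖ with hBdef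
  have hDp := norm_pos_iff.mpr hD
  have hB0 : 0 < B := by
    by_contra h
    have h1 : ‖α‖ ≤ 0 := (le_max_left _ _).trans (not_lt.mp h)
    have h2 : ‖γ‖ ≤ 0 := (le_max_right _ _).trans (not_lt.mp h)
    rw [norm_le_zero_iff] at h1 h2
    exact hD (by rw [h1, h2]; ring)
  set η : ℝ := min ρ ‖ϖ‖ with hη
  have hη0 : 0 < η := lt_min hρ0 hϖp
  obtain ⟨n, hn⟩ := exists_pow_lt_of_lt_one
    (show 0 < η * (‖α * δ - β * γ‖ / B) / B by positivity) hϖ1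
  rw [lt_div_iff₀ hB0] at hn
  set l : F := ϖ ^ n with hl
  have hln : ‖l‖ = (q : ℝ)⁻¹ ^ n := by rw [hl, norm_pow, hϖ]
  have hl1 : ‖l‖ ≤ 1 := by rw [hl, norm_pow]; exact pow_le_one₀ hϖp.le hϖ1.le
  have hl0 : l ≠ 0 := pow_ne_zero _ hϖ0
  rw [← norm_pow, ← hl] at hn
  obtain ⟨R, -, hR⟩ := exists_finset_cover hq hres n
  rw [← hln] at hR
  set T : ℝ := ∑ a ∈ R, (‖θ (α * a + β)‖ + ‖θ (γ * a + δ)‖) with hT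
  have hT0 : 0 ≤ T := Finset.sum_nonneg fun _ _ => by positivity
  have hTa : ∀ a ∈ R, ‖θ (α * a + β)‖ ≤ T ∧ ‖θ (γ * a + δ)‖ ≤ T := fun a ha => by
    have h1 : ‖θ (α * a + β)‖ + ‖θ (γ * a + δ)‖ ≤ T :=
      Finset.single_le_sum (f := fun a => ‖θ (α * a + β)‖ + ‖θ (γ * a + δ)‖)
        (fun _ _ => by positivity) ha
    exact ⟨(le_add_of_nonneg_right (norm_nonneg _)).trans h1,
      (le_add_of_nonneg_left (norm_nonneg _)).trans h1⟩
  refine ⟨T * W * (‖l‖⁻¹ ^ (⌊r⌋₊ + 1) * ‖l‖⁻¹ ^ (⌊r⌋₊ + 1)), by positivity,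
    fun Φ hΦ M h1 h2 => ?_⟩
  have hM := h1.nonneg
  have key : ∀ a ∈ R, TaylorIn emb r K d
      (fun z => Φ (α * (a + l * z) + β) (γ * (a + l * z) + δ)) (T * (W * M)) := by
    intro a ha
    set X : F := α * a + β with hX
    set Y : F := γ * a + δ with hY
    have hDle : ‖α * δ - β * γ‖ ≤ B * max ‖X‖ ‖Y‖ := by
      have h3 : α * δ - β * γ = -(γ * X) + α * Y := by rw [hX, hY]; ring
      rw [h3]
      refine ball_add ?_ ?_
      · rw [norm_neg, norm_mul]
        exact mul_le_mul (le_max_right _ _) (le_max_left _ _) (norm_nonneg _) hB0.le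
      · rw [norm_mul]
        exact mul_le_mul (le_max_left _ _) (le_max_right _ _) (norm_nonneg _) hB0.le
    have hmax : ‖l‖ * B ≤ η * max ‖X‖ ‖Y‖ := by
      refine hn.le.trans (mul_le_mul_of_nonneg_left ?_ hη0.le)
      rwa [div_le_iff₀' hB0]
    have hmax0 : 0 < max ‖X‖ ‖Y‖ := pos_of_mul_pos_right (hDp.trans_le hDle) hB0.le
    have hu : ‖α * l‖ ≤ η * max ‖X‖ ‖Y‖ := by
      rw [norm_mul, mul_comm]
      exact (mul_le_mul_of_nonneg_left (le_max_left _ _) (norm_nonneg _)).trans hmax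
    have hv : ‖γ * l‖ ≤ η * max ‖X‖ ‖Y‖ := by
      rw [norm_mul, mul_comm]
      exact (mul_le_mul_of_nonneg_left (le_max_right _ _) (norm_nonneg _)).trans hmax
    have hfun : (fun z => Φ (α * (a + l * z) + β) (γ * (a + l * z) + δ)) =
        fun z => Φ (X + α * l * z) (Y + γ * l * z) := by
      funext z
      congr 1
      · rw [hX]; ring
      · rw [hY]; ring
    rw [hfun]
    rcases norm_le_or_le_of_norm_eq_zpow hq hval hϖ X Y with hXY | hXY
    · rw [max_eq_right (hXY.trans (mul_le_of_le_one_left (norm_nonneg _) hϖ1.le))]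
        at hu hv hmax0
      refine (hA hΦ h1 (norm_pos_iff.mp hmax0) hXY
        (hu.trans (mul_le_mul_of_nonneg_right (min_le_right _ _) (norm_nonneg _)))
        (hv.trans (mul_le_mul_of_nonneg_right (min_le_left _ _) (norm_nonneg _)))).mono ?_
      exact mul_le_mul_of_nonneg_right (hTa a ha).2 (by positivity)
    · rw [max_eq_left hXY] at hu hv hmax0
      have hη1 : η * ‖X‖ ≤ ‖X‖ :=
        mul_le_of_le_one_left (norm_nonneg _) ((min_le_left _ _).trans hρ1.le)
      refine (hB hΦ h2 (norm_pos_iff.mp hmax0) hXY (hv.trans hη1)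
        (hu.trans (mul_le_mul_of_nonneg_right (min_le_left _ _) (norm_nonneg _)))).mono ?_
      exact mul_le_mul_of_nonneg_right (hTa a ha).1 (by positivity)
  have := TaylorIn.glue hemb hr (by positivity) hl0 hl1 hR
    (f := fun z => Φ (α * z + β) (γ * z + δ)) key
  refine this.mono (le_of_eq ?_)
  ring

/-- `Φ` is a homogeneous function whose restrictions to the two standard charts of the projective
line have Taylor expansions bounded by `M`. -/
def IsSection (emb : S → (F →+* E)) (r : ℝ) (K : Set S) (d : S → ℕ) (ϖ : F) (θ : F →* E)
    (Φ : F → F → E) (M : ℝ) : Prop :=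
  IsHomog θ Φ ∧ TaylorIn emb r K d (fun z => Φ (ϖ * z) 1) M ∧
    TaylorIn emb r K d (fun z => Φ 1 z) M

/-- Sections have Taylor expansions along all affine lines avoiding the origin. -/
def LinearlyStable (emb : S → (F →+* E)) (r : ℝ) (K : Set S) (d : S → ℕ) (ϖ : F)
    (θ : F →* E) : Prop :=
  ∀ α β γ δ : F, α * δ - β * γ ≠ 0 → ∃ C : ℝ, 0 ≤ C ∧ ∀ (Φ : F → F → E) (M : ℝ),
    IsSection emb r K d ϖ θ Φ M →
      TaylorIn emb r K d (fun z => Φ (α * z + β) (γ * z + δ)) (C * M)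

/-- The action of a matrix on functions on the plane. -/
def planeAct (χ : F →* E) (g : Matrix (Fin 2) (Fin 2) F) (Φ : F → F → E) : F → F → E :=
  fun x y => χ (g 0 0 * g 1 1 - g 0 1 * g 1 0) *
    Φ (g 1 1 * x - g 0 1 * y) (-(g 1 0) * x + g 0 0 * y)

theorem IsHomog.act {θ : F →* E} {Φ : F → F → E} (h : IsHomog θ Φ) (χ : F →* E)
    (g : Matrix (Fin 2) (Fin 2) F) : IsHomog θ (planeAct χ g Φ) := fun l x y hl => by
  unfold planeAct
  have h1 := h l (g 1 1 * x - g 0 1 * y) (-(g 1 0) * x + g 0 0 * y) hl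
  refine Eq.trans ?_ (mul_left_comm _ _ _)
  rw [← h1]
  congr 2 <;> ring

theorem planeAct_mul (χ : F →* E) (g h : Matrix (Fin 2) (Fin 2) F) (Φ : F → F → E) :
    planeAct χ (g * h) Φ = planeAct χ g (planeAct χ h Φ) := by
  funext x y
  simp only [planeAct, Matrix.mul_apply, Fin.sum_univ_two]
  rw [← mul_assoc, ← map_mul]
  congr 1
  · congr 1
    ring
  · congr 1 <;> ring

theorem IsSection.exists_act [IsUltrametricDist F] {emb : S → (F →+* E)} {r : ℝ} {K : Set S}
    {d : S → ℕ} {ϖ : F} {θ : F →* E} (hϖ0 : ϖ ≠ 0) (hst : LinearlyStable emb r K d ϖ θ)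
    (χ : F →* E) {g : Matrix (Fin 2) (Fin 2) F} (hg : g 0 0 * g 1 1 - g 0 1 * g 1 0 ≠ 0) :
    ∃ C : ℝ, 0 ≤ C ∧ ∀ (Φ : F → F → E) (M : ℝ), IsSection emb r K d ϖ θ Φ M →
      IsSection emb r K d ϖ θ (planeAct χ g Φ) (C * M) := by
  obtain ⟨C1, hC1, H1⟩ := hst (g 1 1 * ϖ) (-(g 0 1)) (-(g 1 0) * ϖ) (g 0 0) (by
    have : g 1 1 * ϖ * g 0 0 - -(g 0 1) * (-(g 1 0) * ϖ) =
      (g 0 0 * g 1 1 - g 0 1 * g 1 0) * ϖ := by ring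
    rw [this]
    exact mul_ne_zero hg hϖ0)
  obtain ⟨C2, hC2, H2⟩ := hst (-(g 0 1)) (g 1 1) (g 0 0) (-(g 1 0)) (by
    have : -(g 0 1) * -(g 1 0) - g 1 1 * g 0 0 = -(g 0 0 * g 1 1 - g 0 1 * g 1 0) := by ring
    rw [this]
    exact neg_ne_zero.mpr hg)
  set D : F := g 0 0 * g 1 1 - g 0 1 * g 1 0 with hD
  refine ⟨‖χ D‖ * max C1 C2, by positivity, fun Φ M h => ⟨h.1.act χ g, ?_, ?_⟩⟩
  · refine (((H1 Φ M h).const_mul (χ D)).congr fun z _ => ?_).mono ?_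
    · unfold planeAct
      rw [← hD]
      congr 2 <;> ring
    · rw [mul_assoc]
      exact mul_le_mul_of_nonneg_left
        (mul_le_mul_of_nonneg_right (le_max_left _ _) h.2.1.nonneg) (norm_nonneg _)
  · refine (((H2 Φ M h).const_mul (χ D)).congr fun z _ => ?_).mono ?_
    · unfold planeAct
      rw [← hD]
      congr 2 <;> ring
    · rw [mul_assoc]
      exact mul_le_mul_of_nonneg_left
        (mul_le_mul_of_nonneg_right (le_max_right _ _) h.2.1.nonneg) (norm_nonneg _)

theorem IsSection.continuous [IsUltrametricDist E] {emb : S → (F →+* E)}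
    (hemb : ∀ (σ : S) (z : F), ‖emb σ z‖ = ‖z‖) {r M : ℝ} (hr : 0 ≤ r) {K : Set S}
    {d : S → ℕ} {ϖ : F} {θ : F →* E} (hst : LinearlyStable emb r K d ϖ θ) {Φ : F → F → E}
    (h : IsSection emb r K d ϖ θ Φ M) : Continuous fun z => Φ z 1 := by
  rw [continuous_iff_continuousAt]
  intro x
  obtain ⟨C, -, H⟩ := hst 1 x 0 1 (by simp)
  obtain ⟨c, -, hc⟩ := H Φ M h
  have h1 := hc.continuousAt_zero hemb hr
  have h2 : ContinuousAt (fun z : F => z - x) x := by fun_prop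
  have h3 : ContinuousAt (fun z => Φ (1 * z + x) (0 * z + 1)) (x - x) := by rwa [sub_self]
  have h4 := ContinuousAt.comp (f := fun z : F => z - x) h3 h2
  refine h4.congr (Eventually.of_forall fun z => ?_)
  simp

theorem nhdsNE_neBot_of_norm_lt_one {ϖ : F} (hϖ0 : ϖ ≠ 0) (hϖ1 : ‖ϖ‖ < 1) (x : F) :
    (𝓝[≠] x).NeBot := by
  have h : Tendsto (fun n : ℕ => x + ϖ ^ n) atTop (𝓝[≠] x) := by
    refine tendsto_nhdsWithin_iff.mpr ⟨?_, Eventually.of_forall fun n => ?_⟩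
    · simpa using (tendsto_pow_atTop_nhds_zero_of_norm_lt_one hϖ1).const_add x
    · simp [hϖ0]
  exact h.neBot

theorem IsHomog.actFormula_eq {emb : S → (F →+* E)} {J : Set S} {d : S → ℕ} {χ1 χ2 : F →* E}
    {Φ : F → F → E} (h : IsHomog (autoFactor emb J d χ1 χ2) Φ) (g : Matrix (Fin 2) (Fin 2) F)
    {z : F} (hz : -(g 1 0) * z + g 0 0 ≠ 0) :
    actFormula emb J d χ1 χ2 g (fun z => Φ z 1) z = planeAct χ1 g Φ z 1 := by
  have h1 := h _ ((g 1 1 * z - g 0 1) / (-(g 1 0) * z + g 0 0)) 1 hz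
  rw [mul_div_cancel₀ _ hz, mul_one, autoFactor_apply] at h1
  unfold actFormula planeAct
  rw [mul_one, mul_one, h1]
  ring

theorem IsHomog.gAct_eq {emb : S → (F →+* E)} {J : Set S} {d : S → ℕ} {χ1 χ2 : F →* E}
    {Φ : F → F → E} (h : IsHomog (autoFactor emb J d χ1 χ2) Φ) {ϖ : F} (hϖ0 : ϖ ≠ 0)
    (hϖ1 : ‖ϖ‖ < 1) {g : Matrix (Fin 2) (Fin 2) F} (hg : g 0 0 * g 1 1 - g 0 1 * g 1 0 ≠ 0)
    (hc : Continuous fun z => planeAct χ1 g Φ z 1) :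
    gAct emb J d χ1 χ2 g (fun z => Φ z 1) = fun z => planeAct χ1 g Φ z 1 := by
  funext z
  unfold gAct
  split_ifs with hz
  · obtain ⟨hc0, rfl⟩ := hz
    have := nhdsNE_neBot_of_norm_lt_one hϖ0 hϖ1 (g 0 0 / g 1 0)
    refine Tendsto.limUnder_eq ((hc.continuousAt.tendsto.mono_left nhdsWithin_le_nhds).congr' ?_)
    filter_upwards [self_mem_nhdsWithin] with z hz
    refine (h.actFormula_eq g fun h0 => hz ?_).symm
    rw [Set.mem_singleton_iff, eq_div_iff hc0]
    linear_combination -h0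
  · refine h.actFormula_eq g fun h0 => ?_
    rcases eq_or_ne (g 1 0) 0 with hc0 | hc0
    · rw [hc0, neg_zero, zero_mul, zero_add] at h0
      rw [hc0, h0] at hg
      simp at hg
    · refine hz ⟨hc0, ?_⟩
      rw [eq_div_iff hc0]
      linear_combination -h0

theorem IsSection.extProp {emb : S → (F →+* E)} {ϖ : F} {r M : ℝ} {J : Set S} {d : S → ℕ}
    {χ1 χ2 : F →* E} {K : Set S} {Φ : F → F → E}
    (h : IsSection emb r K d ϖ (autoFactor emb J d χ1 χ2) Φ M) :
    ExtProp emb J d χ1 χ2 (fun z => Φ z 1) (fun z => Φ 1 z) := fun z hz _ => by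
  rw [← autoFactor_apply, ← h.1 _ _ _ hz, mul_inv_cancel₀ hz, mul_one]

theorem TaylorIn.crNorm_le [CharZero E] {q : ℕ} (hq : 1 < q)
    {emb : S → (F →+* E)} {r M : ℝ} {d : S → ℕ} (hr : 0 ≤ r)
    (hu : ∀ (f : F → E) (Df : (S → ℕ) → F → E), IsCrWith q emb r f Df →
      Paper.crNorm q emb r f = crNormWith emb r f Df) {K : Set S} {f : F → E}
    (h : TaylorIn emb r K d f M) : Paper.crNorm q emb r f ≤ M := by
  obtain ⟨Df, hDf, hle⟩ := h.exists_isCrWith hq hr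
  rwa [hu f Df hDf]

section Norms

variable [IsUltrametricDist F] [IsUltrametricDist E] [CharZero E] {q : ℕ}
  {emb : S → (F →+* E)} {ϖ : F} {r M : ℝ} {J : Set S} {d : S → ℕ} {χ1 χ2 : F →* E}

theorem IsSection.memB (hq : 1 < q) (hemb : ∀ (σ : S) (z : F), ‖emb σ z‖ = ‖z‖)
    (hϖ0 : ϖ ≠ 0) (hϖ1 : ‖ϖ‖ < 1) (hr : 0 ≤ r)
    (hst : LinearlyStable emb r (freeDirs emb J d) d ϖ (autoFactor emb J d χ1 χ2))
    {Φ : F → F → E}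
    (h : IsSection emb r (freeDirs emb J d) d ϖ (autoFactor emb J d χ1 χ2) Φ M) :
    MemB q emb r J d χ1 χ2 (fun z => Φ z 1) := by
  obtain ⟨C, -, H⟩ := hst 1 0 0 1 (by simp)
  have h1 := (H Φ M h).congr (f' := fun z => Φ z 1) fun z _ => by simp
  exact ⟨h1.isCrJ hq hemb hϖ0 hϖ1 hr, _, h.2.2.isCrJ hq hemb hϖ0 hϖ1 hr, h.extProp⟩

theorem IsSection.bNorm_eq (hq : 1 < q)
    (hval : ∀ x : F, x ≠ 0 → ∃ n : ℤ, ‖x‖ = (q : ℝ) ^ n)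
    (hemb : ∀ (σ : S) (z : F), ‖emb σ z‖ = ‖z‖)
    (hϖ0 : ϖ ≠ 0) (hϖ1 : ‖ϖ‖ < 1) (hr : 0 ≤ r) {Φ : F → F → E}
    (h : IsSection emb r (freeDirs emb J d) d ϖ (autoFactor emb J d χ1 χ2) Φ M) :
    BNorm q emb r J d χ1 χ2 ϖ (fun z => Φ z 1) =
      max (crNorm q emb r fun z => Φ (ϖ * z) 1) (crNorm q emb r fun z => Φ 1 z) := by
  unfold BNorm
  refine (congrArg sSup (Set.eq_singleton_iff_unique_mem.mpr ⟨?_, ?_⟩)).trans (csSup_singleton _)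
  · exact ⟨_, h.2.2.isCrJ hq hemb hϖ0 hϖ1 hr, h.extProp, rfl⟩
  · rintro _ ⟨g, hg, hext, rfl⟩
    have hne : ∀ z : F, z ≠ 0 → ‖z‖ ≤ 1 → g z = Φ 1 z := fun z hz hz1 => by
      exact (hext z hz hz1).trans (h.extProp z hz hz1).symm
    have h0 : g 0 = Φ 1 0 := by
      obtain ⟨_, -, c, -, hc⟩ := hg.taylorIn hq hval hemb hϖ0 hϖ1 hr
      obtain ⟨c', -, hc'⟩ := h.2.2
      have := nhdsNE_neBot_of_norm_lt_one hϖ0 hϖ1 (0 : F)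
      have t1 := (hc.continuousAt_zero hemb hr).tendsto.mono_left
        (nhdsWithin_le_nhds (s := {0}ᶜ))
      have t2 := (hc'.continuousAt_zero hemb hr).tendsto.mono_left
        (nhdsWithin_le_nhds (s := {0}ᶜ))
      refine tendsto_nhds_unique (t1.congr' ?_) t2
      filter_upwards [self_mem_nhdsWithin,
        nhdsWithin_le_nhds (Metric.closedBall_mem_nhds (0 : F) one_pos)] with z hz hz1
      exact hne z hz (mem_closedBall_zero_iff.mp hz1)
    congr 1
    refine crNorm_congr hq fun z hz => ?_
    rcases eq_or_ne z 0 with rfl | hz0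
    · exact h0
    · exact hne z hz0 hz

theorem MemB.exists_isSection (hq : 1 < q)
    (hval : ∀ x : F, x ≠ 0 → ∃ n : ℤ, ‖x‖ = (q : ℝ) ^ n)
    (hemb : ∀ (σ : S) (z : F), ‖emb σ z‖ = ‖z‖)
    (hϖ0 : ϖ ≠ 0) (hϖ1 : ‖ϖ‖ < 1) (hr : 0 ≤ r)
    {ρ : ℝ} (hρ0 : 0 < ρ) (hρ1 : ρ < 1)
    (hθ : ∀ i : S → ℕ, (∀ σ, σ ∉ freeDirs emb J d → i σ ≤ d σ) →
      IsJet emb ⌊r⌋₊ ρ (freeDirs emb J d) (fun σ => d σ - i σ)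
        (fun t => autoFactor emb J d χ1 χ2 (1 + t) * (mPow emb (1 + t) i)⁻¹))
    {f : F → E} (hf : MemB q emb r J d χ1 χ2 f) :
    ∃ (Φ : F → F → E) (M : ℝ), (f = fun z => Φ z 1) ∧
      IsSection emb r (freeDirs emb J d) d ϖ (autoFactor emb J d χ1 χ2) Φ M := by
  obtain ⟨hf1, g, hg, hext⟩ := hf
  obtain ⟨Df, -, hT1⟩ := hf1.taylorIn hq hval hemb hϖ0 hϖ1 hr
  obtain ⟨Dg, -, hT2⟩ := hg.taylorIn hq hval hemb hϖ0 hϖ1 hr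
  obtain ⟨W, -, hW⟩ := TaylorIn.comp_moebius hemb hr hρ1 hθ
  have hT3 := hW ϖ 0 0 hϖ1.le (by simp) (by simpa using hρ0.le) _ _ hT1
  set θ := autoFactor emb J d χ1 χ2 with hθdef
  set Φ : F → F → E := fun x y => if y = 0 then θ x * g 0 else θ y * f (x / y) with hΦ
  have hΦ1 : ∀ z, Φ z 1 = f z := fun z => by simp [hΦ]
  refine ⟨Φ, max (W * crNormWith emb r f Df) (crNormWith emb r g Dg), funext fun z =>
    (hΦ1 z).symm, fun l x y hl => ?_, ?_, ?_⟩
  · simp only [hΦ, mul_eq_zero, hl, false_or, map_mul, mul_div_mul_left _ _ hl]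
    split_ifs <;> ring
  · exact (hT3.congr fun z _ => by simp [hΦ1]).mono (le_max_left _ _)
  · refine (hT2.congr fun z hz => ?_).mono (le_max_right _ _)
    rcases eq_or_ne z 0 with rfl | hz0
    · simp [hΦ]
    · simp only [hΦ, if_neg hz0]
      rw [hext z hz0 hz, one_div, hθdef, autoFactor_apply]

theorem TaylorIn.crNorm (hq : 1 < q)
    (hval : ∀ x : F, x ≠ 0 → ∃ n : ℤ, ‖x‖ = (q : ℝ) ^ n)
    (hemb : ∀ (σ : S) (z : F), ‖emb σ z‖ = ‖z‖)
    (hϖ0 : ϖ ≠ 0) (hϖ1 : ‖ϖ‖ < 1) (hr : 0 ≤ r)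
    (hu : ∀ (f : F → E) (Df : (S → ℕ) → F → E), IsCrWith q emb r f Df →
      crNorm q emb r f = crNormWith emb r f Df) {f : F → E}
    (h : TaylorIn emb r (freeDirs emb J d) d f M) :
    TaylorIn emb r (freeDirs emb J d) d f (crNorm q emb r f) := by
  obtain ⟨Df, hDf, hT⟩ := (h.isCrJ hq hemb hϖ0 hϖ1 hr).taylorIn hq hval hemb hϖ0 hϖ1 hr
  rwa [hu f Df hDf]

theorem exists_bNorm_gAct_le (hq : 1 < q)
    (hval : ∀ x : F, x ≠ 0 → ∃ n : ℤ, ‖x‖ = (q : ℝ) ^ n)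
    (hemb : ∀ (σ : S) (z : F), ‖emb σ z‖ = ‖z‖)
    (hϖ0 : ϖ ≠ 0) (hϖ1 : ‖ϖ‖ < 1) (hr : 0 ≤ r) {a : E} (ha : 1 < ‖a‖)
    (hst : LinearlyStable emb r (freeDirs emb J d) d ϖ (autoFactor emb J d χ1 χ2))
    {g : Matrix (Fin 2) (Fin 2) F} (hg : g 0 0 * g 1 1 - g 0 1 * g 1 0 ≠ 0) :
    ∃ C : ℝ, ∀ (Φ : F → F → E) (M : ℝ),
      IsSection emb r (freeDirs emb J d) d ϖ (autoFactor emb J d χ1 χ2) Φ M →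
      BNorm q emb r J d χ1 χ2 ϖ (gAct emb J d χ1 χ2 g (fun z => Φ z 1)) ≤
        C * BNorm q emb r J d χ1 χ2 ϖ (fun z => Φ z 1) := by
  obtain ⟨C, hC, H⟩ := IsSection.exists_act hϖ0 hst χ1 hg
  refine ⟨C, fun Φ M h => ?_⟩
  have h1 := H Φ M h
  have hhom := h.1
  rw [IsHomog.gAct_eq hhom hϖ0 hϖ1 hg (h1.continuous hemb hr hst),
    h1.bNorm_eq hq hval hemb hϖ0 hϖ1 hr, h.bNorm_eq hq hval hemb hϖ0 hϖ1 hr]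
  rcases crNorm_eq_or_eq_zero hq hval hemb hr ha with hu | hz
  · have h2 := H Φ _ ⟨h.1,
      (h.2.1.crNorm hq hval hemb hϖ0 hϖ1 hr hu).mono (le_max_left _ _),
      (h.2.2.crNorm hq hval hemb hϖ0 hϖ1 hr hu).mono (le_max_right _ _)⟩
    exact max_le (h2.2.1.crNorm_le hq hr hu) (h2.2.2.crNorm_le hq hr hu)
  · simp [hz]

end Norms

/-- Lemme "autocont": with J' = J ∪ {σ ∉ J : d_σ+1 > r}, χ1' = χ1 and
χ2' = χ2 ∏_{σ∈J'∖J} σ^{d_σ}, the formula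
(g·f)(z) = χ1(det g) χ2'χ1'⁻¹(-cz+a) (-cz+a)^{d'} f((dz-b)/(-cz+a)), extended by
continuity at z = a/c, defines a left action of GL₂(F) on the Banach space
B(χ',J',d') by continuous linear automorphisms. -/
theorem statement5
    {p q e f0 : ℕ} (hp : 1 < p) (hf0 : 0 < f0) (he : 0 < e) (hq : q = p ^ f0)
    {F E : Type*} [NormedField F] [NormedField E]
    [IsUltrametricDist F] [IsUltrametricDist E]
    [CompleteSpace F] [CompleteSpace E]
    (ϖ : F) (hϖ : ‖ϖ‖ = (q : ℝ)⁻¹)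
    (hval : ∀ x : F, x ≠ 0 → ∃ n : ℤ, ‖x‖ = (q : ℝ) ^ n)
    (hres : ∀ (a : F) (n : ℤ), ∃ R : Finset F, R.card = q ∧
      (∀ x ∈ R, ‖x - a‖ ≤ (q : ℝ) ^ (-n)) ∧
      ∀ z : F, ‖z - a‖ ≤ (q : ℝ) ^ (-n) → ∃! x, x ∈ R ∧ ‖z - x‖ ≤ (q : ℝ) ^ (-(n + 1)))
    (hpF : ‖(p : F)‖ = (q : ℝ) ^ (-(e : ℤ)))
    (hpE : ‖(p : E)‖ = (p : ℝ) ^ (-((e * f0 : ℕ) : ℤ)))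
    {S : Type*} [Fintype S] (emb : S → (F →+* E))
    (hemb : ∀ (σ : S) (z : F), ‖emb σ z‖ = ‖z‖)
    (J : Set S) (d : S → ℕ) (χ1 χ2 : F →* E)
    (hχ1 : IsLocJChar q emb J χ1) (hχ2 : IsLocJChar q emb J χ2)
    (hχ1ne : ∀ z : F, z ≠ 0 → χ1 z ≠ 0) (hχ2ne : ∀ z : F, z ≠ 0 → χ2 z ≠ 0)
    (r : ℝ) (hrdef : r = -vP p (e * f0) (χ1 (p : F))) (hr0 : 0 ≤ r)
    (J' : Set S) (hJ' : J' = J ∪ {σ : S | σ ∉ J ∧ r < (d σ : ℝ) + 1})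
    (χ2' : F →* E) (hχ2' : χ2' = χ2 * monChar emb {σ : S | σ ∈ J' ∧ σ ∉ J} d) :
    -- the action is well defined: g·f ∈ B(χ',J',d') ...
    (∀ g : Matrix (Fin 2) (Fin 2) F, g 0 0 * g 1 1 - g 0 1 * g 1 0 ≠ 0 →
      ∀ f : F → E, MemB q emb r J' d χ1 χ2' f →
        MemB q emb r J' d χ1 χ2' (gAct emb J' d χ1 χ2' g f)) ∧
    -- ... g·f being the extension by continuity of the formula at z = a/c
    (∀ g : Matrix (Fin 2) (Fin 2) F, g 0 0 * g 1 1 - g 0 1 * g 1 0 ≠ 0 →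
      g 1 0 ≠ 0 → ∀ f : F → E, MemB q emb r J' d χ1 χ2' f →
        ContinuousAt (gAct emb J' d χ1 χ2' g f) (g 0 0 / g 1 0)) ∧
    -- f ↦ g·f is additive ...
    (∀ g : Matrix (Fin 2) (Fin 2) F, g 0 0 * g 1 1 - g 0 1 * g 1 0 ≠ 0 →
      ∀ f1 f2 : F → E, MemB q emb r J' d χ1 χ2' f1 → MemB q emb r J' d χ1 χ2' f2 →
        ∀ z : F, gAct emb J' d χ1 χ2' g (f1 + f2) z =
          gAct emb J' d χ1 χ2' g f1 z + gAct emb J' d χ1 χ2' g f2 z) ∧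
    -- ... and E-homogeneous (so E-linear) ...
    (∀ g : Matrix (Fin 2) (Fin 2) F, g 0 0 * g 1 1 - g 0 1 * g 1 0 ≠ 0 →
      ∀ (c : E) (f : F → E), MemB q emb r J' d χ1 χ2' f →
        ∀ z : F, gAct emb J' d χ1 χ2' g (c • f) z = c * gAct emb J' d χ1 χ2' g f z) ∧
    -- ... and continuous (= bounded) on B(χ',J',d')
    (∀ g : Matrix (Fin 2) (Fin 2) F, g 0 0 * g 1 1 - g 0 1 * g 1 0 ≠ 0 →
      ∃ C : ℝ, ∀ f : F → E, MemB q emb r J' d χ1 χ2' f →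
        BNorm q emb r J' d χ1 χ2' ϖ (gAct emb J' d χ1 χ2' g f) ≤
          C * BNorm q emb r J' d χ1 χ2' ϖ f) ∧
    -- these maps define a left action (hence each f ↦ g·f is an automorphism)
    (∀ f : F → E, MemB q emb r J' d χ1 χ2' f →
      ∀ z : F, gAct emb J' d χ1 χ2' (1 : Matrix (Fin 2) (Fin 2) F) f z = f z) ∧
    (∀ g h : Matrix (Fin 2) (Fin 2) F, g 0 0 * g 1 1 - g 0 1 * g 1 0 ≠ 0 →
      h 0 0 * h 1 1 - h 0 1 * h 1 0 ≠ 0 →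
      ∀ f : F → E, MemB q emb r J' d χ1 χ2' f →
        ∀ z : F, gAct emb J' d χ1 χ2' (g * h) f z =
          gAct emb J' d χ1 χ2' g (gAct emb J' d χ1 χ2' h f) z) := by
  have hq1 : 1 < q := by
    rw [hq]
    exact Nat.one_lt_pow hf0.ne' hp
  have hq1' : (1 : ℝ) < q := by exact_mod_cast hq1
  have hp1' : (1 : ℝ) < p := by exact_mod_cast hp
  have hϖp : 0 < ‖ϖ‖ := by rw [hϖ]; positivity
  have hϖ1 : ‖ϖ‖ < 1 := by rw [hϖ]; exact inv_lt_one_of_one_lt₀ hq1'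
  have hϖ0 : ϖ ≠ 0 := norm_pos_iff.mp hϖp
  have hpE0 : (p : E) ≠ 0 := norm_pos_iff.mp (by rw [hpE]; positivity)
  have hpE1 : ‖(p : E)‖ < 1 := by
    rw [hpE, zpow_neg, zpow_natCast]
    exact inv_lt_one_of_one_lt₀ (one_lt_pow₀ hp1' (Nat.mul_pos he hf0).ne')
  have hchar : CharZero E := charZero_of_norm_natCast_lt_one hpE0 hpE1
  have ha : 1 < ‖(p : E)⁻¹‖ := by
    rw [norm_inv]
    exact (one_lt_inv₀ (norm_pos_iff.mpr hpE0)).mpr hpE1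
  obtain ⟨ρ, hρ0, hρ1, hjet⟩ := exists_isJet_autoFactor hemb hϖ0 hϖ1 hϖ
    (hJ' ▸ Set.subset_union_left : J ⊆ J') (subset_freeDirs emb J' d) d hχ1 hχ2
  rw [← hχ2'] at hjet
  have hθ := hjet ⌊r⌋₊
  have hst : LinearlyStable emb r (freeDirs emb J' d) d ϖ (autoFactor emb J' d χ1 χ2') := by
    intro α β γ δ hD
    obtain ⟨C, hC, H⟩ :=
      IsHomog.exists_taylorIn_linear hq1 hϖ hval hres hemb hr0 hρ0 hρ1 hθ hD
    exact ⟨C, hC, fun Φ M h => H Φ h.1 M h.2.1 h.2.2⟩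
  have hlift := fun (f : F → E) (hf : MemB q emb r J' d χ1 χ2' f) =>
    hf.exists_isSection hq1 hval hemb hϖ0 hϖ1 hr0 hρ0 hρ1 hθ
  have hact : ∀ g : Matrix (Fin 2) (Fin 2) F, g 0 0 * g 1 1 - g 0 1 * g 1 0 ≠ 0 →
      ∀ (Φ : F → F → E) (M : ℝ),
        IsSection emb r (freeDirs emb J' d) d ϖ (autoFactor emb J' d χ1 χ2') Φ M →
        ∃ M', IsSection emb r (freeDirs emb J' d) d ϖ (autoFactor emb J' d χ1 χ2')
          (planeAct χ1 g Φ) M' := fun g hg Φ M h =>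
    let ⟨C, _, H⟩ := IsSection.exists_act hϖ0 hst χ1 hg
    ⟨C * M, H Φ M h⟩
  have hcont : ∀ g : Matrix (Fin 2) (Fin 2) F, g 0 0 * g 1 1 - g 0 1 * g 1 0 ≠ 0 →
      ∀ (Φ : F → F → E) (M : ℝ),
        IsSection emb r (freeDirs emb J' d) d ϖ (autoFactor emb J' d χ1 χ2') Φ M →
        Continuous fun z => planeAct χ1 g Φ z 1 := fun g hg Φ M h =>
    let ⟨_, h1⟩ := hact g hg Φ M h
    h1.continuous hemb hr0 hst
  have hgAct : ∀ g : Matrix (Fin 2) (Fin 2) F, g 0 0 * g 1 1 - g 0 1 * g 1 0 ≠ 0 →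
      ∀ (Φ : F → F → E) (M : ℝ),
        IsSection emb r (freeDirs emb J' d) d ϖ (autoFactor emb J' d χ1 χ2') Φ M →
        gAct emb J' d χ1 χ2' g (fun z => Φ z 1) = fun z => planeAct χ1 g Φ z 1 :=
    fun g hg Φ M h => IsHomog.gAct_eq h.1 hϖ0 hϖ1 hg (hcont g hg Φ M h)
  refine ⟨fun g hg f hf => ?_, fun g hg _ f hf => ?_, fun g hg f1 f2 hf1 hf2 z => ?_,
    fun g hg c f hf z => ?_, fun g hg => ?_, fun f hf z => ?_, fun g h hg hh f hf z => ?_⟩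
  · obtain ⟨Φ, M, rfl, hΦ⟩ := hlift f hf
    obtain ⟨M', h1⟩ := hact g hg Φ M hΦ
    rw [hgAct g hg Φ M hΦ]
    exact h1.memB hq1 hemb hϖ0 hϖ1 hr0 hst
  · obtain ⟨Φ, M, rfl, hΦ⟩ := hlift f hf
    rw [hgAct g hg Φ M hΦ]
    exact (hcont g hg Φ M hΦ).continuousAt
  · obtain ⟨Φ1, M1, rfl, h1⟩ := hlift f1 hf1
    obtain ⟨Φ2, M2, rfl, h2⟩ := hlift f2 hf2
    have hsum : ∀ z, planeAct χ1 g (fun x y => Φ1 x y + Φ2 x y) z 1 =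
        planeAct χ1 g Φ1 z 1 + planeAct χ1 g Φ2 z 1 := fun z => mul_add _ _ _
    have hhom : IsHomog (autoFactor emb J' d χ1 χ2') fun x y => Φ1 x y + Φ2 x y :=
      fun l x y hl => by
        beta_reduce
        rw [h1.1 l x y hl, h2.1 l x y hl, mul_add]
    have h3 := hhom.gAct_eq hϖ0 hϖ1 hg
      (((hcont g hg Φ1 M1 h1).add (hcont g hg Φ2 M2 h2)).congr fun z => (hsum z).symm)
    rw [hgAct g hg Φ1 M1 h1, hgAct g hg Φ2 M2 h2]
    exact (congrFun h3 z).trans (hsum z)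
  · obtain ⟨Φ, M, rfl, hΦ⟩ := hlift f hf
    have hsmul : ∀ z, planeAct χ1 g (fun x y => c * Φ x y) z 1 =
        c * planeAct χ1 g Φ z 1 := fun z => mul_left_comm _ _ _
    have hhom : IsHomog (autoFactor emb J' d χ1 χ2') fun x y => c * Φ x y :=
      fun l x y hl => by
        beta_reduce
        rw [hΦ.1 l x y hl, mul_left_comm]
    have h3 := hhom.gAct_eq hϖ0 hϖ1 hg
      ((continuous_const.mul (hcont g hg Φ M hΦ)).congr fun z => (hsmul z).symm)
    rw [hgAct g hg Φ M hΦ]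
    exact (congrFun h3 z).trans (hsmul z)
  · obtain ⟨C, H⟩ := exists_bNorm_gAct_le hq1 hval hemb hϖ0 hϖ1 hr0 ha hst hg
    refine ⟨C, fun f hf => ?_⟩
    obtain ⟨Φ, M, rfl, hΦ⟩ := hlift f hf
    exact H Φ M hΦ
  · obtain ⟨Φ, M, rfl, hΦ⟩ := hlift f hf
    rw [hgAct 1 (by simp) Φ M hΦ]
    simp [planeAct]
  · obtain ⟨Φ, M, rfl, hΦ⟩ := hlift f hf
    obtain ⟨M', h1⟩ := hact h hh Φ M hΦ
    have hdet : (g * h) 0 0 * (g * h) 1 1 - (g * h) 0 1 * (g * h) 1 0 ≠ 0 := by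
      have h2 := Matrix.det_mul g h
      simp only [Matrix.det_fin_two] at h2
      rw [h2]
      exact mul_ne_zero hg hh
    rw [hgAct (g * h) hdet Φ M hΦ, hgAct h hh Φ M hΦ, hgAct g hg _ M' h1, planeAct_mul]
end Paper
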